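/- If G is a plane graph in which every bounded face has length at most ℓ and whose weak dual G⁺ is connected, then the em-width of G satisfies emw(G) ≤ (tw(G) + 2)·ℓ − 1, where tw(G) is the treewidth of G. -/

import Mathlib

open Set Bornology

/-- A plane embedding of a simple graph: each vertex is mapped to a point of the
plane, each edge to an injective arc joining its endpoints; arcs avoid vertices
other than their endpoints and distinct arcs meet only at common endpoints. -/
structure PlaneEmbedding {V : Type} (G : SimpleGraph V) where
  pos : V → ℝ × ℝ
  pos_inj : Function.Injective pos
  arc : G.edgeSet → Set (ℝ × ℝ)
  arc_path : ∀ e : G.edgeSet, ∃ u v : V, (e : Sym2 V) = s(u, v) ∧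
    ∃ γ : Path (pos u) (pos v), Function.Injective ⇑γ ∧ Set.range ⇑γ = arc e
  arc_avoid : ∀ (e : G.edgeSet) (w : V), pos w ∈ arc e → w ∈ (e : Sym2 V)
  arc_inter : ∀ e f : G.edgeSet, e ≠ f → ∀ x ∈ arc e ∩ arc f,
    ∃ w : V, w ∈ (e : Sym2 V) ∧ w ∈ (f : Sym2 V) ∧ x = pos w

namespace PlaneEmbedding

variable {V : Type} {G : SimpleGraph V}

/-- The image (drawing) of the plane graph in the plane. -/
def image (P : PlaneEmbedding G) : Set (ℝ × ℝ) :=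
  Set.range P.pos ∪ ⋃ e : G.edgeSet, P.arc e

/-- A face: a connected component of the complement of the image. -/
def IsFace (P : PlaneEmbedding G) (f : Set (ℝ × ℝ)) : Prop :=
  ∃ x, x ∉ P.image ∧ f = connectedComponentIn (P.image)ᶜ x

def IsBoundedFace (P : PlaneEmbedding G) (f : Set (ℝ × ℝ)) : Prop :=
  P.IsFace f ∧ IsBounded f

def IsOuterFace (P : PlaneEmbedding G) (f : Set (ℝ × ℝ)) : Prop :=
  P.IsFace f ∧ ¬ IsBounded f

/-- The vertices on the boundary of a face `f`. -/
def boundaryVerts (P : PlaneEmbedding G) (f : Set (ℝ × ℝ)) : Set V :=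
  {v | P.pos v ∈ closure f}

/-- The weak dual: vertices are the bounded faces, two distinct faces being
adjacent when some edge lies on the boundary of both. -/
def weakDual (P : PlaneEmbedding G) :
    SimpleGraph {f : Set (ℝ × ℝ) // P.IsBoundedFace f} :=
  SimpleGraph.fromRel fun f g =>
    ∃ e : G.edgeSet, P.arc e ⊆ closure f.1 ∧ P.arc e ⊆ closure g.1

/-- `u⁺`: the bounded faces having `u` on their boundary. -/
def uPlus (P : PlaneEmbedding G) (u : V) :
    Set {f : Set (ℝ × ℝ) // P.IsBoundedFace f} :=
  {f | u ∈ P.boundaryVerts f.1}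

/-- The drawing of the subgraph induced by a set `S` of vertices. -/
def subImage (P : PlaneEmbedding G) (S : Set V) : Set (ℝ × ℝ) :=
  P.pos '' S ∪ ⋃ e ∈ {e : G.edgeSet | ∀ w, w ∈ (e : Sym2 V) → w ∈ S}, P.arc e

/-- The vertices of `S` lying on the boundary of the unbounded face of the
drawing of the subgraph induced by `S`. -/
def outerVerts (P : PlaneEmbedding G) (S : Set V) : Set V :=
  {v | v ∈ S ∧ ∃ x, x ∉ P.subImage S ∧
    ¬ IsBounded (connectedComponentIn (P.subImage S)ᶜ x) ∧
    P.pos v ∈ closure (connectedComponentIn (P.subImage S)ᶜ x)}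

/-- Remove the outer layer of vertices. -/
def peel (P : PlaneEmbedding G) (S : Set V) : Set V := S \ P.outerVerts S

/-- The embedding is (at most) `k`-outerplanar: `k` rounds of removing the
vertices on the outer boundary remove every vertex. -/
def OuterplanarAtMost (P : PlaneEmbedding G) (k : ℕ) : Prop :=
  (P.peel)^[k] Set.univ = ∅

/-- The drawing of the subgraph of all edges incident to vertices of `R`. -/
def familyImage (P : PlaneEmbedding G) (R : Set V) : Set (ℝ × ℝ) :=
  ⋃ e ∈ {e : G.edgeSet | ∃ v ∈ R, v ∈ (e : Sym2 V)}, P.arc e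

/-- `R` is nicely embedded: no bounded face of the subgraph of edges incident
to `R` strictly encloses a vertex of `G`. -/
def NicelyEmbedded (P : PlaneEmbedding G) (R : Set V) : Prop :=
  ∀ x, x ∉ P.familyImage R →
    IsBounded (connectedComponentIn (P.familyImage R)ᶜ x) →
    ∀ v : V, P.pos v ∉ connectedComponentIn (P.familyImage R)ᶜ x

/-- The facial completion: add a clique on the boundary of each bounded face. -/
def facialCompletion (P : PlaneEmbedding G) : SimpleGraph V :=
  G ⊔ SimpleGraph.fromRel fun u v =>
    ∃ f, P.IsBoundedFace f ∧ u ∈ P.boundaryVerts f ∧ v ∈ P.boundaryVerts f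

end PlaneEmbedding

/-- A tree together with a bag of vertices at each node. -/
structure Decomp (V : Type) : Type 1 where
  ι : Type
  tree : SimpleGraph ι
  isTree : tree.IsTree
  bag : ι → Set V

/-- `D` is a tree decomposition of `G`. -/
def IsTreeDecomp {V : Type} (G : SimpleGraph V) (D : Decomp V) : Prop :=
  (∀ v, ∃ i, v ∈ D.bag i) ∧
  (∀ u v, G.Adj u v → ∃ i, u ∈ D.bag i ∧ v ∈ D.bag i) ∧
  (∀ v, (D.tree.induce {i | v ∈ D.bag i}).Connected)

/-- The treewidth of a graph. -/
noncomputable def treewidth {V : Type} (G : SimpleGraph V) : ℕ :=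
  sInf {k | ∃ D : Decomp V, IsTreeDecomp G D ∧ ∀ i, (D.bag i).ncard ≤ k + 1}

/-- `D` is an embedded tree decomposition of the plane graph given by `P`. -/
def IsEmDecomp {V : Type} {G : SimpleGraph V} (P : PlaneEmbedding G)
    (D : Decomp V) : Prop :=
  IsTreeDecomp G D ∧ ∀ f, P.IsBoundedFace f → ∃ i, P.boundaryVerts f ⊆ D.bag i

/-- The em-width of a plane graph. -/
noncomputable def emwidth {V : Type} {G : SimpleGraph V}
    (P : PlaneEmbedding G) : ℕ :=
  sInf {k | ∃ D : Decomp V, IsEmDecomp P D ∧ ∀ i, (D.bag i).ncard ≤ k + 1}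

/-- A cut vertex: its removal disconnects two vertices that were connected. -/
def SimpleGraph.IsCutVertex {V : Type} (G : SimpleGraph V) (u : V) : Prop :=
  ∃ x y, ∃ (hx : x ≠ u) (hy : y ≠ u), G.Reachable x y ∧
    ¬ (G.induce {v | v ≠ u}).Reachable ⟨x, hx⟩ ⟨y, hy⟩

/-- An `r`-family: `r` vertices of degree 2 sharing the same two neighbors. -/
def IsRFamily {V : Type} (G : SimpleGraph V) (R : Set V) (r : ℕ) : Prop :=
  R.ncard = r ∧ ∃ a b : V, a ≠ b ∧ ∀ v ∈ R, G.neighborSet v = {a, b}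

namespace PlaneTopology

open Complex

/-- `f` has a continuous logarithm on `K`. -/
def HasLogOn (K : Set ℂ) (f : ℂ → ℂ) : Prop :=
  ∃ g : ℂ → ℂ, ContinuousOn g K ∧ ∀ z ∈ K, exp (g z) = f z

lemma exists_log {A : Type*} [TopologicalSpace A] [SimplyConnectedSpace A]
    [LocallyPathConnectedSpace A] (f : A → ℂ) (hf : Continuous f) (h0 : ∀ x, f x ≠ 0) :
    ∃ g : A → ℂ, Continuous g ∧ ∀ x, exp (g x) = f x := by
  have a₀ : A := Classical.arbitrary A
  obtain ⟨F, ⟨_, hF⟩, _⟩ := isCoveringMapOn_exp.existsUnique_continuousMap_lifts (⟨f, hf⟩ : C(A, ℂ))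
    (a₀ := a₀) (e₀ := log (f a₀)) (by simp [exp_log (h0 a₀)]) (fun a => by simpa using h0 a)
  exact ⟨F, F.continuous, fun x => congrFun hF x⟩

lemma exp_eq_const {X : Type*} [TopologicalSpace X] {S : Set X} (hS : IsPreconnected S)
    {f g : X → ℂ} (hf : ContinuousOn f S) (hg : ContinuousOn g S)
    (h : ∀ z ∈ S, exp (f z) = exp (g z)) :
    ∃ m : ℤ, ∀ z ∈ S, f z = g z + m * (2 * Real.pi * I) := by
  rcases S.eq_empty_or_nonempty with rfl | ⟨x, hx⟩
  · exact ⟨0, by simp⟩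
  have hpi : (2 * Real.pi * I : ℂ) ≠ 0 := two_pi_I_ne_zero
  have key : ∀ z ∈ S, ∃ n : ℤ, (f z - g z) / (2 * Real.pi * I) = n := by
    intro z hz
    obtain ⟨n, hn⟩ := exp_eq_exp_iff_exists_int.1 (h z hz)
    exact ⟨n, by rw [hn]; field_simp; ring⟩
  obtain ⟨m, hm⟩ := key x hx
  refine ⟨m, fun z hz => ?_⟩
  have : ((f z - g z) / (2 * Real.pi * I)).re = ((f x - g x) / (2 * Real.pi * I)).re := by
    have hd : DiscreteTopology (range ((↑) : ℤ → ℝ)) :=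
      Int.isClosedEmbedding_coe_real.isEmbedding.toHomeomorph.discreteTopology
    refine hS.constant_of_mapsTo (T := range ((↑) : ℤ → ℝ))
      (isDiscrete_iff_discreteTopology.2 hd)
      (f := fun z => ((f z - g z) / (2 * Real.pi * I)).re) ?_ (fun z hz => ?_) hz hx
    · exact continuous_re.comp_continuousOn ((hf.sub hg).div_const _)
    · obtain ⟨n, hn⟩ := key z hz
      exact ⟨n, by simp only [hn]; simp⟩
  obtain ⟨n, hn⟩ := key z hz
  rw [hn, hm] at this
  have hnm : (n : ℂ) = m := by
    have : (n : ℝ) = m := by simpa using this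
    exact_mod_cast this
  rw [hnm, div_eq_iff hpi] at hn
  linear_combination hn

lemma eq_zero_of_log_on_sphere {a : ℂ} {r : ℝ} (hr : 0 < r) {n : ℤ}
    (h : HasLogOn (Metric.sphere a r) fun z => (z - a) ^ n) : n = 0 := by
  obtain ⟨g, hg, hgz⟩ := h
  have hmem : ∀ t : ℝ, a + r * exp (t * I) ∈ Metric.sphere a r := by
    intro t
    simp [Complex.norm_exp, abs_of_pos hr]
  have hr' : (r : ℂ) ≠ 0 := by exact_mod_cast hr.ne'
  obtain ⟨m, hm⟩ := exp_eq_const (isPreconnected_univ (α := ℝ))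
    (f := fun t : ℝ => g (a + r * exp (t * I))) (g := fun t : ℝ => n * (log r + t * I))
    (hg.comp (by fun_prop) (fun t _ => hmem t)) (by fun_prop) (by
      intro t _
      rw [hgz _ (hmem t), exp_int_mul, exp_add, exp_log hr']
      simp)
  have h0 := hm 0 trivial
  have h1 := hm (2 * Real.pi) trivial
  have e1 : exp (((2 * Real.pi : ℝ) : ℂ) * I) = exp (((0 : ℝ) : ℂ) * I) := by
    push_cast; rw [exp_two_pi_mul_I]; simp
  simp only [e1] at h1
  rw [h0] at h1
  have : (n : ℂ) * (2 * Real.pi * I) = 0 := by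
    push_cast at h1
    linear_combination -h1
  simpa [two_pi_I_ne_zero, Real.pi_ne_zero] using this

lemma isPreconnected_norm_mem {S : Set ℝ} (hS : IsPreconnected S) (h0 : S ⊆ Ici 0) (a : ℂ) :
    IsPreconnected {z : ℂ | ‖z - a‖ ∈ S} := by
  have : {z : ℂ | ‖z - a‖ ∈ S} =
      (fun p : ℝ × ℝ => a + p.1 * exp (p.2 * I)) '' (S ×ˢ univ) := by
    ext z
    simp only [mem_ofPred_eq, mem_image, mem_prod, mem_univ, and_true, Prod.exists]
    constructor
    · intro hz
      exact ⟨_, arg (z - a), hz, by simp⟩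
    · rintro ⟨r, t, hr, rfl⟩
      have : |r| = r := abs_of_nonneg (h0 hr)
      simpa [Complex.norm_exp, this] using hr
  rw [this]
  exact (hS.prod isPreconnected_univ).image _ (by fun_prop)

/-- `p` and `q` lie in the same component of the complement of `K`. -/
def SameComp (K : Set ℂ) (p q : ℂ) : Prop := q ∈ connectedComponentIn Kᶜ p

lemma SameComp.left {K : Set ℂ} {p q : ℂ} (h : SameComp K p q) : p ∉ K := by
  by_contra hp
  have : connectedComponentIn Kᶜ p = ∅ := connectedComponentIn_eq_empty (by simpa using hp)
  rw [SameComp, this] at h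
  exact h

lemma SameComp.right {K : Set ℂ} {p q : ℂ} (h : SameComp K p q) : q ∉ K :=
  connectedComponentIn_subset _ _ h

lemma SameComp.eq {K : Set ℂ} {p q : ℂ} (h : SameComp K p q) :
    connectedComponentIn Kᶜ p = connectedComponentIn Kᶜ q := connectedComponentIn_eq h

lemma SameComp.refl {K : Set ℂ} {p : ℂ} (h : p ∉ K) : SameComp K p p := mem_connectedComponentIn h

lemma SameComp.symm {K : Set ℂ} {p q : ℂ} (h : SameComp K p q) : SameComp K q p := by
  rw [SameComp, ← h.eq]; exact mem_connectedComponentIn h.left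

lemma SameComp.trans {K : Set ℂ} {p q r : ℂ} (h : SameComp K p q) (h' : SameComp K q r) :
    SameComp K p r := by
  rw [SameComp, h.eq]; exact h'

lemma sameComp_of_isPreconnected {K S : Set ℂ} (hS : IsPreconnected S) (h : S ⊆ Kᶜ) {p q : ℂ}
    (hp : p ∈ S) (hq : q ∈ S) : SameComp K p q :=
  hS.subset_connectedComponentIn hp h hq

lemma SameComp.mono {K L : Set ℂ} (h : K ⊆ L) {p q : ℂ} (hL : SameComp L p q) : SameComp K p q :=
  connectedComponentIn_mono _ (compl_subset_compl.2 h) hL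

lemma isOpen_comp {K : Set ℂ} (hK : IsClosed K) (p : ℂ) : IsOpen (connectedComponentIn Kᶜ p) :=
  hK.isOpen_compl.connectedComponentIn

lemma closure_comp_subset {K : Set ℂ} (hK : IsClosed K) (p : ℂ) :
    closure (connectedComponentIn Kᶜ p) ⊆ connectedComponentIn Kᶜ p ∪ K := by
  intro z hz
  by_contra hcon
  rw [mem_union, not_or] at hcon
  have hz' : z ∈ connectedComponentIn Kᶜ z := mem_connectedComponentIn hcon.2
  obtain ⟨w, hw1, hw2⟩ := mem_closure_iff.1 hz _ (isOpen_comp hK z) hz'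
  apply hcon.1
  have h1 : SameComp K z w := hw1
  have h2 : SameComp K p w := hw2
  exact h2.trans h1.symm

lemma frontier_comp_subset {K : Set ℂ} (hK : IsClosed K) (p : ℂ) :
    frontier (connectedComponentIn Kᶜ p) ⊆ K := by
  intro z hz
  rw [frontier, (isOpen_comp hK p).interior_eq] at hz
  exact ((closure_comp_subset hK p) hz.1).resolve_left hz.2

lemma sameComp_of_unbounded {K : Set ℂ} (hK : IsCompact K) {p q : ℂ}
    (hp : ¬ IsBounded (connectedComponentIn Kᶜ p)) (hq : ¬ IsBounded (connectedComponentIn Kᶜ q)) :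
    SameComp K p q := by
  obtain ⟨R, hR⟩ := hK.isBounded.subset_closedBall 0
  have hS : IsPreconnected {z : ℂ | ‖z - 0‖ ∈ Ioi (max R 0)} :=
    isPreconnected_norm_mem isPreconnected_Ioi (fun x hx => mem_Ici.2 ((le_max_right R 0).trans (le_of_lt hx))) 0
  have hSK : {z : ℂ | ‖z - 0‖ ∈ Ioi (max R 0)} ⊆ Kᶜ := by
    intro z hz hzK
    have := hR hzK
    simp at this hz
    linarith
  have key : ∀ s : Set ℂ, ¬ IsBounded s → ∃ x ∈ s, x ∈ {z : ℂ | ‖z - 0‖ ∈ Ioi (max R 0)} := by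
    intro s hs
    by_contra hcon
    push Not at hcon
    apply hs
    refine (Metric.isBounded_closedBall (x := (0 : ℂ)) (r := max R 0)).subset ?_
    intro x hx
    have h2 : ¬ max R 0 < ‖x - 0‖ := hcon x hx
    rw [Metric.mem_closedBall, dist_eq_norm]
    exact not_lt.1 h2
  obtain ⟨x, hx, hx'⟩ := key _ hp
  obtain ⟨y, hy, hy'⟩ := key _ hq
  exact SameComp.trans hx ((sameComp_of_isPreconnected hS hSK hx' hy').trans (SameComp.symm hy))

lemma exists_extension {K : Set ℂ} (hK : IsClosed K) {g : ℂ → ℂ} (hg : ContinuousOn g K) :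
    ∃ G : ℂ → ℂ, Continuous G ∧ ∀ z ∈ K, G z = g z := by
  obtain ⟨G, hG⟩ := ContinuousMap.exists_restrict_eq hK ⟨K.domRestrict g, hg.domRestrict⟩
  exact ⟨G, G.continuous, fun z hz => DFunLike.congr_fun hG ⟨z, hz⟩⟩

lemma eq_zero_of_bounded {K : Set ℂ} (hK : IsCompact K) {p q r : ℂ} {k m n : ℤ} (hp : p ∉ K)
    (hq : q ∉ K) (hr : r ∉ K) (hb : IsBounded (connectedComponentIn Kᶜ p))
    (hpq : ¬ SameComp K p q) (hpr : ¬ SameComp K p r)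
    (h : HasLogOn K fun z => (z - p) ^ k * (z - q) ^ m * (z - r) ^ n) : k = 0 := by
  obtain ⟨g, hg, hgz⟩ := h
  obtain ⟨G, hG, hGg⟩ := exists_extension hK.isClosed hg
  set U := connectedComponentIn Kᶜ p with hU
  have hUo : IsOpen U := isOpen_comp hK.isClosed p
  have hcl := closure_comp_subset hK.isClosed p
  have hpU : p ∈ U := mem_connectedComponentIn hp
  have hne : ∀ z ∈ closure U, z - q ≠ 0 ∧ z - r ≠ 0 := by
    intro z hz
    constructor <;> (intro h; rw [sub_eq_zero] at h; subst h)
    · exact (hcl hz).elim hpq hq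
    · exact (hcl hz).elim hpr hr
  classical
  let Ψ : ℂ → ℂ := U.piecewise (fun z => exp (G z) * (z - q) ^ (-m) * (z - r) ^ (-n))
    (fun z => (z - p) ^ k)
  have hΨ : Continuous Ψ := by
    refine continuous_piecewise ?_ ?_ ?_
    · intro z hz
      have hzK := frontier_comp_subset hK.isClosed p hz
      obtain ⟨h1, h2⟩ := hne z hz.1
      rw [hGg z hzK, hgz z hzK, zpow_neg, zpow_neg]
      have := zpow_ne_zero m h1
      have := zpow_ne_zero n h2
      field_simp
    · refine ((continuous_exp.comp hG).continuousOn.mul ?_).mul ?_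
      · exact ContinuousOn.zpow₀ (by fun_prop) _ (fun z hz => .inl (hne z hz).1)
      · exact ContinuousOn.zpow₀ (by fun_prop) _ (fun z hz => .inl (hne z hz).2)
    · rw [hUo.isClosed_compl.closure_eq]
      refine ContinuousOn.zpow₀ (by fun_prop) _ (fun z hz => .inl ?_)
      intro h; rw [sub_eq_zero] at h; subst h; exact hz hpU
  have hΨ0 : ∀ z, Ψ z ≠ 0 := by
    intro z
    by_cases hz : z ∈ U
    · obtain ⟨h1, h2⟩ := hne z (subset_closure hz)
      simp only [Ψ, piecewise_eq_of_mem _ _ _ hz]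
      exact mul_ne_zero (mul_ne_zero (exp_ne_zero _) (zpow_ne_zero _ h1)) (zpow_ne_zero _ h2)
    · simp only [Ψ, piecewise_eq_of_notMem _ _ _ hz]
      refine zpow_ne_zero _ ?_
      intro h; rw [sub_eq_zero] at h; subst h; exact hz hpU
  obtain ⟨g', hg', hexp⟩ := exists_log Ψ hΨ hΨ0
  obtain ⟨R, hR⟩ := hb.subset_closedBall p
  have hR1 : 0 < |R| + 1 := by positivity
  refine eq_zero_of_log_on_sphere (a := p) hR1 ⟨g', hg'.continuousOn, fun z hz => ?_⟩
  rw [hexp]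
  refine piecewise_eq_of_notMem _ _ _ fun hzU => ?_
  have h1 := hR hzU
  simp at h1 hz
  rw [dist_eq_norm] at h1
  linarith [le_abs_self R]

lemma HasLogOn.mono {K L : Set ℂ} {f : ℂ → ℂ} (h : HasLogOn L f) (hKL : K ⊆ L) : HasLogOn K f := by
  obtain ⟨g, hg, h⟩ := h
  exact ⟨g, hg.mono hKL, fun z hz => h z (hKL hz)⟩

lemma HasLogOn.congr {K : Set ℂ} {f f' : ℂ → ℂ} (h : HasLogOn K f) (hf : ∀ z ∈ K, f z = f' z) :
    HasLogOn K f' := by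
  obtain ⟨g, hg, h⟩ := h
  exact ⟨g, hg, fun z hz => (h z hz).trans (hf z hz)⟩

lemma HasLogOn.mul {K : Set ℂ} {f f' : ℂ → ℂ} (h : HasLogOn K f) (h' : HasLogOn K f') :
    HasLogOn K fun z => f z * f' z := by
  obtain ⟨g, hg, h⟩ := h
  obtain ⟨g', hg', h'⟩ := h'
  exact ⟨g + g', hg.add hg', fun z hz => by rw [Pi.add_apply, exp_add, h z hz, h' z hz]⟩

lemma HasLogOn.inv {K : Set ℂ} {f : ℂ → ℂ} (h : HasLogOn K f) : HasLogOn K fun z => (f z)⁻¹ := by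
  obtain ⟨g, hg, h⟩ := h
  exact ⟨-g, hg.neg, fun z hz => by rw [Pi.neg_apply, exp_neg, h z hz]⟩

lemma HasLogOn.const_mul {K : Set ℂ} {f : ℂ → ℂ} (h : HasLogOn K f) {c : ℂ} (hc : c ≠ 0) :
    HasLogOn K fun z => c * f z := by
  obtain ⟨g, hg, h⟩ := h
  exact ⟨fun z => log c + g z, continuousOn_const.add hg, fun z hz => by
    rw [exp_add, h z hz, exp_log hc]⟩

lemma HasLogOn.sameComp {K : Set ℂ} (hK : IsCompact K) {p q : ℂ} (hp : p ∉ K) (hq : q ∉ K)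
    (h : HasLogOn K fun z => (z - p) / (z - q)) : SameComp K p q := by
  by_contra hcon
  have hlog : HasLogOn K fun z => (z - p) ^ (1 : ℤ) * (z - q) ^ (-1 : ℤ) * (z - q) ^ (0 : ℤ) :=
    h.congr fun z _ => by simp [div_eq_mul_inv]
  have hlog' : HasLogOn K fun z => (z - q) ^ (-1 : ℤ) * (z - p) ^ (1 : ℤ) * (z - p) ^ (0 : ℤ) :=
    h.congr fun z _ => by simp [div_eq_mul_inv, mul_comm]
  by_cases hb : IsBounded (connectedComponentIn Kᶜ p)
  · simpa using eq_zero_of_bounded hK hp hq hq hb hcon hcon hlog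
  · by_cases hb' : IsBounded (connectedComponentIn Kᶜ q)
    · simpa using eq_zero_of_bounded hK hq hp hp hb' (fun h => hcon h.symm) (fun h => hcon h.symm)
        hlog'
    · exact hcon (sameComp_of_unbounded hK hb hb')

lemma SameComp.hasLogOn {K : Set ℂ} (hK : IsCompact K) {p q : ℂ} (h : SameComp K p q) :
    HasLogOn K fun z => (z - p) / (z - q) := by
  have hUo := isOpen_comp hK.isClosed p
  set U := connectedComponentIn Kᶜ p with hU
  have hUK : ∀ x ∈ U, ∀ z ∈ K, z - x ≠ 0 := by
    intro x hx z hz h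
    rw [sub_eq_zero] at h; subst h
    exact connectedComponentIn_subset _ _ hx hz
  have hloc : ∀ x ∈ U, ∃ ε > 0, ∀ y, dist y x < ε → HasLogOn K fun z => (z - x) / (z - y) := by
    intro x hx
    obtain ⟨ε, hε, hball⟩ := Metric.isOpen_iff.1 hK.isClosed.isOpen_compl x
      (connectedComponentIn_subset _ _ hx)
    refine ⟨ε, hε, fun y hy => ?_⟩
    have hlog : HasLogOn K fun z => (z - y) / (z - x) := by
      have hsl : ∀ z ∈ K, (z - y) / (z - x) ∈ slitPlane := by
        intro z hz
        refine Complex.ball_one_subset_slitPlane ?_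
        have hzx := hUK x hx z hz
        have : (z - y) / (z - x) - 1 = (x - y) / (z - x) := by field_simp; ring
        rw [Metric.mem_ball, dist_eq_norm, this, norm_div, div_lt_one (norm_pos_iff.2 hzx)]
        have h1 : ε ≤ ‖z - x‖ := by
          by_contra hlt
          push Not at hlt
          exact hball (by rwa [Metric.mem_ball, dist_eq_norm]) hz
        rw [dist_comm, dist_eq_norm] at hy
        linarith
      refine ⟨fun z => log ((z - y) / (z - x)), ?_, fun z hz => exp_log (slitPlane_ne_zero (hsl z hz))⟩
      refine ContinuousOn.clog ?_ hsl
      exact ContinuousOn.div (by fun_prop) (by fun_prop) (hUK x hx)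
    exact hlog.inv.congr fun z _ => by simp
  have hsymm : ∀ x y, HasLogOn K (fun z => (z - x) / (z - y)) →
      HasLogOn K (fun z => (z - y) / (z - x)) :=
    fun x y h => h.inv.congr fun z _ => by simp
  have htrans : ∀ x y w, y ∈ U → HasLogOn K (fun z => (z - x) / (z - y)) →
      HasLogOn K (fun z => (z - y) / (z - w)) → HasLogOn K (fun z => (z - x) / (z - w)) :=
    fun x y w hy h h' => (h.mul h').congr fun z hz => by
      have := hUK y hy z hz
      field_simp
  have hpU : p ∈ U := mem_connectedComponentIn h.left
  by_contra hcon
  have hconn : IsPreconnected U := isPreconnected_connectedComponentIn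
  let A := {x | x ∈ U ∧ HasLogOn K fun z => (z - p) / (z - x)}
  let B := {x | x ∈ U ∧ ¬ HasLogOn K fun z => (z - p) / (z - x)}
  have hA : IsOpen A := by
    rw [Metric.isOpen_iff]
    rintro x ⟨hx, hpx⟩
    obtain ⟨ε, hε, hball⟩ := hloc x hx
    obtain ⟨δ, hδ, hballU⟩ := Metric.isOpen_iff.1 hUo x hx
    refine ⟨min ε δ, lt_min hε hδ, fun y hy => ?_⟩
    rw [Metric.mem_ball, lt_min_iff] at hy
    exact ⟨hballU hy.2, htrans _ x _ hx hpx (hball y hy.1)⟩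
  have hB : IsOpen B := by
    rw [Metric.isOpen_iff]
    rintro x ⟨hx, hpx⟩
    obtain ⟨ε, hε, hball⟩ := hloc x hx
    obtain ⟨δ, hδ, hballU⟩ := Metric.isOpen_iff.1 hUo x hx
    refine ⟨min ε δ, lt_min hε hδ, fun y hy => ?_⟩
    rw [Metric.mem_ball, lt_min_iff] at hy
    exact ⟨hballU hy.2, fun hpy => hpx (htrans _ y _ (hballU hy.2) hpy (hsymm _ _ (hball y hy.1)))⟩
  obtain ⟨x, hx, hxA, hxB⟩ := hconn A B hA hB (fun x hx => by
      by_cases hh : HasLogOn K fun z => (z - p) / (z - x)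
      · exact .inl ⟨hx, hh⟩
      · exact .inr ⟨hx, hh⟩) ⟨p, hpU, hpU, by
        refine ⟨fun _ => 0, continuousOn_const, fun z hz => ?_⟩
        exact exp_zero.trans (div_self (hUK p hpU z hz)).symm⟩ ⟨q, h, h, hcon⟩
  exact hxB.2 hxA.2

lemma exists_glue {K L : Set ℂ} (hK : IsClosed K) (hL : IsClosed L) {g h : ℂ → ℂ}
    (hg : ContinuousOn g K) (hh : ContinuousOn h L) (hgh : ∀ z ∈ K, z ∈ L → g z = h z) :
    ∃ f, ContinuousOn f (K ∪ L) ∧ (∀ z ∈ K, f z = g z) ∧ ∀ z ∈ L, f z = h z := by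
  classical
  have h1 : ∀ z ∈ K, K.piecewise g h z = g z := fun z hz => piecewise_eq_of_mem _ _ _ hz
  have h2 : ∀ z ∈ L, K.piecewise g h z = h z := by
    intro z hz
    by_cases hzK : z ∈ K
    · rw [h1 z hzK, hgh z hzK hz]
    · exact piecewise_eq_of_notMem _ _ _ hzK
  exact ⟨K.piecewise g h, (hg.congr h1).union_of_isClosed (hh.congr h2) hK hL, h1, h2⟩

lemma HasLogOn.union {K L : Set ℂ} (hK : IsClosed K) (hL : IsClosed L) {f : ℂ → ℂ} {c : ℂ}
    (hKL : K ∩ L ⊆ {c}) (h : HasLogOn K f) (h' : HasLogOn L f) : HasLogOn (K ∪ L) f := by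
  obtain ⟨g, hg, hgf⟩ := h
  obtain ⟨g', hg', hgf'⟩ := h'
  have : ∃ m : ℤ, ∀ z ∈ K, z ∈ L → g z = g' z + m * (2 * Real.pi * I) := by
    by_cases hc : c ∈ K ∩ L
    · obtain ⟨m, hm⟩ := exp_eq_exp_iff_exists_int.1 ((hgf c hc.1).trans (hgf' c hc.2).symm)
      exact ⟨m, fun z hz hz' => by rw [hKL ⟨hz, hz'⟩, hm]⟩
    · exact ⟨0, fun z hz hz' => absurd (hKL ⟨hz, hz'⟩ ▸ ⟨hz, hz'⟩) hc⟩
  obtain ⟨m, hm⟩ := this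
  obtain ⟨G, hG, hG1, hG2⟩ := exists_glue hK hL hg
    (h := fun z => g' z + m * (2 * Real.pi * I)) (hg'.add continuousOn_const) hm
  refine ⟨G, hG, fun z hz => hz.elim (fun hz => ?_) fun hz => ?_⟩
  · rw [hG1 z hz, hgf z hz]
  · rw [hG2 z hz, exp_add, exp_int_mul_two_pi_mul_I, mul_one, hgf' z hz]

open Complex

/-- `e` is an injective arc from `a` to `b`. -/
def IsArc (a b : ℂ) (e : Set ℂ) : Prop :=
  ∃ γ : ℝ → ℂ, Continuous γ ∧ InjOn γ (Icc 0 1) ∧ γ 0 = a ∧ γ 1 = b ∧ γ '' Icc 0 1 = e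

lemma isArc_image {γ : ℝ → ℂ} (hγ : Continuous γ) {s t : ℝ} (hst : s < t)
    (hinj : InjOn γ (Icc s t)) : IsArc (γ s) (γ t) (γ '' Icc s t) := by
  have hp : 0 < t - s := sub_pos.2 hst
  have himg : (fun u : ℝ => (t - s) * u + s) '' Icc 0 1 = Icc s t := by
    rw [image_affine_Icc' hp]; simp
  refine ⟨fun u => γ ((t - s) * u + s), by fun_prop, ?_, by simp, by simp, ?_⟩
  · intro u hu v hv huv
    have := hinj (himg ▸ mem_image_of_mem _ hu) (himg ▸ mem_image_of_mem _ hv) huv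
    have h2 : (t - s) * u = (t - s) * v := by simpa using this
    exact mul_left_cancel₀ hp.ne' h2
  · rw [← himg, image_image]

variable {a b : ℂ} {e : Set ℂ}

lemma IsArc.left_mem (h : IsArc a b e) : a ∈ e := by
  obtain ⟨γ, _, _, rfl, _, rfl⟩ := h
  exact mem_image_of_mem _ (by simp)

lemma IsArc.right_mem (h : IsArc a b e) : b ∈ e := by
  obtain ⟨γ, _, _, _, rfl, rfl⟩ := h
  exact mem_image_of_mem _ (by simp)

lemma IsArc.ne (h : IsArc a b e) : a ≠ b := by
  obtain ⟨γ, _, hi, rfl, rfl, rfl⟩ := h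
  intro h
  have := hi (by simp) (by simp) h
  norm_num at this

lemma IsArc.isCompact (h : IsArc a b e) : IsCompact e := by
  obtain ⟨γ, hc, _, rfl, rfl, rfl⟩ := h
  exact isCompact_Icc.image hc

lemma IsArc.joinedIn (h : IsArc a b e) : JoinedIn e a b := by
  obtain ⟨γ, hc, _, rfl, rfl, rfl⟩ := h
  exact ⟨⟨⟨fun t => γ t, by fun_prop⟩, by simp, by simp⟩, fun t => mem_image_of_mem _ t.2⟩

lemma IsArc.hasLogOn (h : IsArc a b e) {f : ℂ → ℂ} (hf : ContinuousOn f e)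
    (h0 : ∀ z ∈ e, f z ≠ 0) : HasLogOn e f := by
  obtain ⟨γ, hc, hi, rfl, rfl, rfl⟩ := h
  have hmem : ∀ t : ℝ, (projIcc (0 : ℝ) 1 zero_le_one t : ℝ) ∈ Icc (0 : ℝ) 1 := fun t => Subtype.prop _
  obtain ⟨g, hg, hgf⟩ := exists_log (fun t : ℝ => f (γ (projIcc (0 : ℝ) 1 zero_le_one t)))
    (hf.comp_continuous (by fun_prop) fun t => mem_image_of_mem _ (hmem t))
    (fun t => h0 _ (mem_image_of_mem _ (hmem t)))
  have hemb : Topology.IsClosedEmbedding (fun t : Icc (0 : ℝ) 1 => γ t) :=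
    Continuous.isClosedEmbedding (by fun_prop) fun x y hxy => Subtype.ext (hi x.2 y.2 hxy)
  obtain ⟨G, hG⟩ := ContinuousMap.exists_extension hemb (⟨fun t => g t, by fun_prop⟩ : C(Icc (0 : ℝ) 1, ℂ))
  refine ⟨G, G.continuous.continuousOn, ?_⟩
  rintro _ ⟨t, ht, rfl⟩
  have := DFunLike.congr_fun hG ⟨t, ht⟩
  simp at this
  rw [this, hgf, projIcc_of_mem _ ht]

lemma IsArc.hasLogOn_div (h : IsArc a b e) {p q : ℂ} (hp : p ∉ e) (hq : q ∉ e) :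
    HasLogOn e fun z => (z - p) / (z - q) := by
  have h1 : ∀ r, r ∉ e → ∀ z ∈ e, z - r ≠ 0 := by
    intro r hr z hz h; rw [sub_eq_zero] at h; subst h; exact hr hz
  exact h.hasLogOn (ContinuousOn.div (by fun_prop) (by fun_prop) (h1 q hq))
    fun z hz => div_ne_zero (h1 p hp z hz) (h1 q hq z hz)

/-- Subdividing an arc at an interior point, with the middle piece as small as desired. -/
lemma IsArc.exists_small (h : IsArc a b e) {y : ℂ} (hy : y ∈ e) (hya : y ≠ a) (hyb : y ≠ b)
    {N : Set ℂ} (hN : IsOpen N) (hyN : y ∈ N) :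
    ∃ x₁ x₂ e₁ m e₂, IsArc a x₁ e₁ ∧ IsArc x₁ x₂ m ∧ IsArc x₂ b e₂ ∧ e = e₁ ∪ m ∪ e₂ ∧
      m ⊆ N ∧ y ∈ m ∧ y ∉ e₁ ∧ y ∉ e₂ ∧ Disjoint e₁ e₂ := by
  obtain ⟨γ, hc, hi, rfl, rfl, rfl⟩ := h
  obtain ⟨t, ht, rfl⟩ := hy
  have ht0 : 0 < t := lt_of_le_of_ne ht.1 (by rintro rfl; exact hya rfl)
  have ht1 : t < 1 := lt_of_le_of_ne ht.2 (by rintro rfl; exact hyb rfl)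
  obtain ⟨ε, hε, hball⟩ := Metric.isOpen_iff.1 (hN.preimage hc) t hyN
  obtain ⟨δ, hδ, hδε, hδ0, hδ1⟩ : ∃ δ > 0, δ < ε ∧ 0 < t - δ ∧ t + δ < 1 := by
    refine ⟨min (ε / 2) (min (t / 2) ((1 - t) / 2)), by
      have : 0 < 1 - t := by linarith
      positivity, ?_, ?_, ?_⟩
    · linarith [min_le_left (ε / 2) (min (t / 2) ((1 - t) / 2))]
    · linarith [min_le_right (ε / 2) (min (t / 2) ((1 - t) / 2)), min_le_left (t / 2) ((1 - t) / 2)]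
    · linarith [min_le_right (ε / 2) (min (t / 2) ((1 - t) / 2)), min_le_right (t / 2) ((1 - t) / 2)]
  have hdis : ∀ s u s' u' : ℝ, 0 ≤ s → u < s' → u' ≤ 1 → Disjoint (γ '' Icc s u) (γ '' Icc s' u') := by
    intro s u s' u' hs hus hu
    rw [Set.disjoint_left]
    rintro _ ⟨r, hr, rfl⟩ ⟨r', hr', h⟩
    have := hi ⟨by linarith [hr.1, hr.2, hr'.1, hr'.2], by linarith [hr.1, hr.2, hr'.1, hr'.2]⟩
      ⟨by linarith [hr.1, hr.2, hr'.1, hr'.2], by linarith [hr.1, hr.2, hr'.1, hr'.2]⟩ h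
    linarith [hr.1, hr.2, hr'.1, hr'.2]
  have htm : ∀ s u, 0 ≤ s → u ≤ 1 → (t < s ∨ u < t) → γ t ∉ γ '' Icc s u := by
    rintro s u hs hu h ⟨r, hr, hrt⟩
    have := hi ⟨by linarith [hr.1], by linarith [hr.2]⟩ ht hrt
    subst this
    rcases h with h | h <;> linarith [hr.1, hr.2]
  refine ⟨γ (t - δ), γ (t + δ), γ '' Icc 0 (t - δ), γ '' Icc (t - δ) (t + δ), γ '' Icc (t + δ) 1,
    isArc_image hc hδ0 (hi.mono (Icc_subset_Icc_right (by linarith))),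
    isArc_image hc (by linarith) (hi.mono (Icc_subset_Icc (by linarith) (by linarith))),
    isArc_image hc hδ1 (hi.mono (Icc_subset_Icc_left (by linarith))), ?_, ?_, ?_, ?_, ?_, ?_⟩
  · rw [← image_union, ← image_union, Icc_union_Icc_eq_Icc (by linarith) (by linarith),
      Icc_union_Icc_eq_Icc (by linarith) (by linarith)]
  · rintro _ ⟨s, hs, rfl⟩
    refine hball ?_
    rw [Metric.mem_ball, Real.dist_eq, abs_lt]
    constructor <;> linarith [hs.1, hs.2]
  · exact mem_image_of_mem _ ⟨by linarith, by linarith⟩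
  · exact htm _ _ le_rfl (by linarith) (.inr (by linarith))
  · exact htm _ _ (by linarith) le_rfl (.inl (by linarith))
  · exact hdis _ _ _ _ le_rfl (by linarith) le_rfl

lemma IsArc.diff_eq {γ : ℝ → ℂ} (hi : InjOn γ (Icc 0 1)) :
    γ '' Icc 0 1 \ {γ 0, γ 1} = γ '' Ioo 0 1 := by
  rw [← Icc_sdiff_both, hi.image_sdiff_subset (by simp [insert_subset_iff]), image_pair]

lemma IsArc.isPreconnected_interior (h : IsArc a b e) : IsPreconnected (e \ {a, b}) := by
  obtain ⟨γ, hc, hi, rfl, rfl, rfl⟩ := h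
  rw [IsArc.diff_eq hi]
  exact isPreconnected_Ioo.image _ hc.continuousOn

lemma IsArc.nonempty_interior (h : IsArc a b e) : (e \ {a, b}).Nonempty := by
  obtain ⟨γ, hc, hi, rfl, rfl, rfl⟩ := h
  rw [IsArc.diff_eq hi]
  exact (nonempty_Ioo.2 zero_lt_one).image _

lemma IsArc.subset_closure (h : IsArc a b e) : e ⊆ closure (e \ {a, b}) := by
  obtain ⟨γ, hc, hi, rfl, rfl, rfl⟩ := h
  rw [IsArc.diff_eq hi]
  have := image_closure_subset_closure_image hc (s := Ioo 0 1)
  rwa [closure_Ioo zero_ne_one] at this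

lemma SameComp.union_arc {H : Set ℂ} (hH : IsCompact H) (h : IsArc a b e) {c : ℂ}
    (hc : H ∩ e ⊆ {c}) {p q : ℂ} (hpq : SameComp H p q) (hp : p ∉ e) (hq : q ∉ e) :
    SameComp (H ∪ e) p q := by
  refine HasLogOn.sameComp (hH.union h.isCompact) (fun hh => hh.elim hpq.left hp)
    (fun hh => hh.elim hpq.right hq) ?_
  exact (hpq.hasLogOn hH).union hH.isClosed h.isCompact.isClosed hc (h.hasLogOn_div hp hq)

lemma SameComp.union_bridge {H₁ H₂ : Set ℂ} (h1 : IsCompact H₁) (h2 : IsCompact H₂)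
    (hd : Disjoint H₁ H₂) (h : IsArc a b e) (ha : H₁ ∩ e ⊆ {a}) (hb : H₂ ∩ e ⊆ {b}) {p q : ℂ}
    (hpq : SameComp (H₁ ∪ H₂) p q) (hp : p ∉ e) (hq : q ∉ e) : SameComp (H₁ ∪ H₂ ∪ e) p q := by
  have hlog := hpq.hasLogOn (h1.union h2)
  have h3 : SameComp (H₁ ∪ e) p q := (hpq.mono subset_union_left).union_arc h1 h ha hp hq
  have hU : H₁ ∪ H₂ ∪ e = (H₁ ∪ e) ∪ H₂ := by rw [union_right_comm]
  rw [hU]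
  refine HasLogOn.sameComp ((h1.union h.isCompact).union h2) ?_ ?_ ?_
  · exact fun hh => hh.elim h3.left fun hh => hpq.left (.inr hh)
  · exact fun hh => hh.elim h3.right fun hh => hpq.right (.inr hh)
  refine (h3.hasLogOn (h1.union h.isCompact)).union (h1.union h.isCompact).isClosed h2.isClosed
    (c := b) ?_ (hlog.mono subset_union_right)
  rintro z ⟨hz | hz, hz2⟩
  · exact absurd hz2 (Set.disjoint_left.1 hd hz)
  · exact hb ⟨hz2, hz⟩

lemma IsArc.interior_eq (h : IsArc a b e) : interior e = ∅ := by
  by_contra hne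
  obtain ⟨x, hx⟩ := nonempty_iff_ne_empty.2 hne
  obtain ⟨y, hyU, hy⟩ : ∃ y ∈ interior e, y ≠ a ∧ y ≠ b := by
    by_contra hcon
    push Not at hcon
    have hfin : (interior e).Finite := (Set.toFinite {a, b}).subset fun y hy => by
      by_cases hya : y = a
      · exact .inl hya
      · exact .inr (hcon y hy hya)
    obtain ⟨ε, hε, hball⟩ := Metric.isOpen_iff.1 isOpen_interior x hx
    exact (infinite_of_mem_nhds x (Metric.ball_mem_nhds x hε)) (hfin.subset hball)
  obtain ⟨ε, hε, hball⟩ := Metric.isOpen_iff.1 isOpen_interior y hyU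
  obtain ⟨x₁, x₂, e₁, m, e₂, h1, hm, h2, he, hmN, hym, hy1, hy2, hd⟩ :=
    h.exists_small (interior_subset hyU) hy.1 hy.2 Metric.isOpen_ball (Metric.mem_ball_self hε)
  have hpre : IsPreconnected {z : ℂ | ‖z - y‖ ∈ Ioo 0 ε} :=
    isPreconnected_norm_mem isPreconnected_Ioo (fun x hx => hx.1.le) y
  clear h1 hm h2 he hmN hym hy1 hy2 hd
  obtain ⟨γ, hc, hi, rfl, rfl, rfl⟩ := h
  obtain ⟨t, ht, hty⟩ := interior_subset hyU
  have ht0 : 0 < t := lt_of_le_of_ne ht.1 (by rintro rfl; exact hy.1 hty.symm)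
  have ht1 : t < 1 := lt_of_le_of_ne ht.2 (by rintro rfl; exact hy.2 hty.symm)
  have hnear : ∀ᶠ s in nhds t, γ s ∈ Metric.ball y ε :=
    hc.continuousAt.eventually (by rw [hty]; exact Metric.ball_mem_nhds y hε)
  obtain ⟨δ, hδ, hδball⟩ := Metric.eventually_nhds_iff.1 hnear
  have hgoal : ∀ s ∈ Icc (0 : ℝ) 1, s ≠ t → dist s t < δ → γ s ∈ {z : ℂ | ‖z - y‖ ∈ Ioo 0 ε} := by
    intro s hs hst hsd
    refine ⟨norm_pos_iff.2 (sub_ne_zero.2 fun h => hst (hi hs ht (h.trans hty.symm))), ?_⟩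
    have := hδball hsd
    rwa [Metric.mem_ball, dist_eq_norm] at this
  have hclosed : ∀ s u : ℝ, IsClosed (γ '' Icc s u) := fun s u => (isCompact_Icc.image hc).isClosed
  obtain ⟨z, hz, hz1, hz2⟩ := isPreconnected_closed_iff.1 hpre _ _ (hclosed 0 t) (hclosed t 1) (by
      rintro z ⟨_, hz⟩
      rw [← image_union, Icc_union_Icc_eq_Icc ht0.le ht1.le]
      apply interior_subset
      apply hball
      rw [Metric.mem_ball, dist_eq_norm]; exact hz)
    (by
      set s := max 0 (t - δ / 2)
      have h1 : 0 ≤ s := le_max_left _ _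
      have h2 : s < t := max_lt ht0 (by linarith)
      have h3 : t - δ / 2 ≤ s := le_max_right _ _
      exact ⟨γ s, hgoal s ⟨h1, by linarith⟩ h2.ne (by rw [Real.dist_eq, abs_lt]; constructor <;> linarith),
        mem_image_of_mem _ ⟨h1, h2.le⟩⟩)
    (by
      set s := min 1 (t + δ / 2)
      have h1 : s ≤ 1 := min_le_left _ _
      have h2 : t < s := lt_min ht1 (by linarith)
      have h3 : s ≤ t + δ / 2 := min_le_right _ _
      exact ⟨γ s, hgoal s ⟨by linarith, h1⟩ h2.ne' (by rw [Real.dist_eq, abs_lt]; constructor <;> linarith),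
        mem_image_of_mem _ ⟨h2.le, h1⟩⟩)
  obtain ⟨s, hs, rfl⟩ := hz1
  obtain ⟨u, hu, hus⟩ := hz2
  have hsu : u = s := hi ⟨by linarith [hu.1], hu.2⟩ ⟨hs.1, by linarith [hs.2]⟩ hus
  have : s = t := le_antisymm hs.2 (hsu ▸ hu.1)
  subst this
  have h0 := hz.1
  rw [hty, sub_self, norm_zero] at h0
  exact lt_irrefl _ h0

/-- A component of `(H ∪ e)ᶜ` touching the arc `e` at an interior point touches all of `e`. -/
lemma IsArc.subset_closure_comp {H : Set ℂ} (hH : IsCompact H) (h : IsArc a b e)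
    (hHe : H ∩ e ⊆ {a, b}) {p x : ℂ} (hp : p ∉ H ∪ e) (hx : x ∈ e) (hxH : x ∉ H)
    (hxa : x ≠ a) (hxb : x ≠ b) (hxf : x ∈ closure (connectedComponentIn (H ∪ e)ᶜ p)) :
    e ⊆ closure (connectedComponentIn (H ∪ e)ᶜ p) := by
  set f := connectedComponentIn (H ∪ e)ᶜ p with hf
  by_contra hcon
  have hcon' : ¬ (e \ {a, b} ⊆ closure f) := fun hh =>
    hcon (h.subset_closure.trans (closure_minimal hh isClosed_closure))
  obtain ⟨y, ⟨hye, hyab⟩, hyf⟩ := not_subset.1 hcon'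
  simp only [mem_insert_iff, mem_singleton_iff, not_or] at hyab
  obtain ⟨x₁, x₂, e₁, m, e₂, h1, hm, h2, he, hmN, hym, hy1, hy2, hd⟩ :=
    h.exists_small hye hyab.1 hyab.2 isClosed_closure.isOpen_compl hyf
  have hcl := hH.isClosed
  have hcle := h.isCompact.isClosed
  have hHp : p ∉ H := fun hh => hp (.inl hh)
  have hep : p ∉ e := fun hh => hp (.inr hh)
  have hyH : y ∉ H := fun hh => by
    rcases hHe ⟨hh, hye⟩ with h | h
    · exact hyab.1 h
    · exact hyab.2 h
  have hfH : f ⊆ connectedComponentIn Hᶜ p :=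
    connectedComponentIn_mono _ (compl_subset_compl.2 subset_union_left)
  have hpx : SameComp H p x :=
    ((closure_comp_subset hcl p) (closure_mono hfH hxf)).resolve_right hxH
  have hxy : SameComp H x y := by
    refine sameComp_of_isPreconnected h.isPreconnected_interior ?_ ⟨hx, by simp [hxa, hxb]⟩
      ⟨hye, by simp [hyab]⟩
    rintro z ⟨hz, hz'⟩ hzH
    exact hz' (hHe ⟨hzH, hz⟩)
  have hae : e₁ ⊆ e := he ▸ fun z hz => .inl (.inl hz)
  have hbe : e₂ ⊆ e := he ▸ fun z hz => .inr hz
  have hb1 : b ∉ e₁ := fun hh => Set.disjoint_left.1 hd hh h2.right_mem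
  have ha2 : a ∉ e₂ := Set.disjoint_left.1 hd h1.left_mem
  have s1 : SameComp (H ∪ e₁) p y :=
    (hpx.trans hxy).union_arc hH h1 (c := a) (by
      rintro z ⟨hz, hz'⟩
      exact (hHe ⟨hz, hae hz'⟩).resolve_right fun hh => hb1 (hh ▸ hz')) (fun hh => hep (hae hh)) hy1
  have s2 : SameComp (H ∪ e₁ ∪ e₂) p y :=
    s1.union_arc (hH.union h1.isCompact) h2 (c := b) (by
      rintro z ⟨hz | hz, hz'⟩
      · exact (hHe ⟨hz, hbe hz'⟩).resolve_left fun hh => ha2 (hh ▸ hz')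
      · exact absurd hz' (Set.disjoint_left.1 hd hz)) (fun hh => hep (hbe hh)) hy2
  have hyf' : y ∉ f := fun hh => hyf (_root_.subset_closure hh)
  have hpre : IsPreconnected (connectedComponentIn (H ∪ e₁ ∪ e₂)ᶜ p) :=
    isPreconnected_connectedComponentIn
  have hfo : IsOpen f := isOpen_comp (hcl.union hcle) p
  obtain ⟨z, hz, hz1, hz2⟩ := hpre f (closure f)ᶜ hfo isClosed_closure.isOpen_compl (by
      intro z hz
      by_cases hzf : z ∈ closure f
      · left
        refine ((closure_comp_subset (hcl.union hcle) p) hzf).resolve_right ?_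
        have hz3 := connectedComponentIn_subset _ _ hz
        rintro (hh | hh)
        · exact hz3 (.inl (.inl hh))
        · rw [he] at hh
          rcases hh with (hh | hh) | hh
          · exact hz3 (.inl (.inr hh))
          · exact hmN hh hzf
          · exact hz3 (.inr hh)
      · exact .inr hzf)
    ⟨p, mem_connectedComponentIn s2.left, mem_connectedComponentIn hp⟩ ⟨y, s2, hyf⟩
  exact hz2 (_root_.subset_closure hz1)

open Complex

lemma exists_log_path {a b : ℂ} (π : Path a b) :
    HasLogOn (range π)ᶜ fun z => (b - z) / (a - z) := by
  have hne : ∀ (t : unitInterval) (z : ((range π)ᶜ : Set ℂ)), π t - z.1 ≠ 0 := fun t z h =>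
    z.2 ⟨t, sub_eq_zero.1 h⟩
  have hne0 : ∀ z : ((range π)ᶜ : Set ℂ), a - z.1 ≠ 0 := fun z => by simpa using hne 0 z
  let H : C(unitInterval × ((range π)ᶜ : Set ℂ), {z : ℂ // z ≠ 0}) :=
    ⟨fun x => ⟨(π x.1 - x.2.1) / (a - x.2.1), div_ne_zero (hne _ _) (hne0 _)⟩, by
      refine Continuous.subtype_mk (Continuous.div (by fun_prop) (by fun_prop) fun x => hne0 _) _⟩
  have H0 : ∀ z : ((range π)ᶜ : Set ℂ), H (0, z) = ⟨_, exp_ne_zero ((ContinuousMap.const ((range π)ᶜ : Set ℂ) (0 : ℂ)) z)⟩ := by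
    intro z
    ext
    simp [H, div_self (hne0 z)]
  let L := isCoveringMap_exp.liftHomotopy H (ContinuousMap.const ((range π)ᶜ : Set ℂ) 0) H0
  have hL := isCoveringMap_exp.liftHomotopy_lifts H (ContinuousMap.const ((range π)ᶜ : Set ℂ) 0) H0
  classical
  refine ⟨fun z => if hz : z ∈ (range π)ᶜ then L (1, ⟨z, hz⟩) else 0, ?_, ?_⟩
  · rw [continuousOn_iff_continuous_domRestrict]
    have : (range π)ᶜ.domRestrict (fun z => if hz : z ∈ (range π)ᶜ then L (1, ⟨z, hz⟩) else 0) =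
        fun z => L (1, z) := by
      ext z
      simp only [domRestrict_apply]
      rw [dif_pos z.2]
    rw [this]
    fun_prop
  · intro z hz
    have h2 := congrFun hL (1, ⟨z, hz⟩)
    have h3 : exp (L (1, ⟨z, hz⟩)) = (π 1 - z) / (a - z) := congrArg Subtype.val h2
    simp only [dif_pos hz]
    rw [h3, π.target]

variable {a b : ℂ} {e : Set ℂ}

lemma IsArc.not_isPreconnected_diff {H U : Set ℂ} (h : IsArc a b e) (hU : IsOpen U)
    (hUH : Disjoint U H) (heU : e \ {a, b} ⊆ U) (hj : JoinedIn H a b) :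
    ¬ IsPreconnected (U \ e) := by
  intro hpre
  have hab := h.ne
  have hec : IsClosed e := h.isCompact.isClosed
  obtain ⟨L, hL, hLe⟩ : HasLogOn eᶜ fun z => (b - z) / (a - z) := by
    obtain ⟨π, hπ⟩ := h.joinedIn
    exact (exists_log_path π).mono (compl_subset_compl.2 (range_subset_iff.2 hπ))
  obtain ⟨M, hM, hMe⟩ : HasLogOn Hᶜ fun z => (b - z) / (a - z) := by
    obtain ⟨π, hπ⟩ := hj
    exact (exists_log_path π).mono (compl_subset_compl.2 (range_subset_iff.2 hπ))
  have hUH' : U ⊆ Hᶜ := fun z hz hz' => Set.disjoint_left.1 hUH hz hz'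
  obtain ⟨m, hm⟩ := exp_eq_const hpre (f := L) (g := M) (hL.mono fun z hz => hz.2)
    (hM.mono fun z hz => hUH' hz.1) fun z hz => (hLe z hz.2).trans (hMe z (hUH' hz.1)).symm
  classical
  let G : ℂ → ℂ := e.piecewise (fun z => M z + m * (2 * Real.pi * I)) L
  have hG1 : ∀ z ∈ eᶜ, G z = L z := fun z hz => piecewise_eq_of_notMem _ _ _ hz
  have hG2 : ∀ z ∈ U, G z = M z + m * (2 * Real.pi * I) := by
    intro z hz
    by_cases hze : z ∈ e
    · exact piecewise_eq_of_mem _ _ _ hze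
    · rw [hG1 z hze, hm z ⟨hz, hze⟩]
  have hGc : ContinuousOn G (eᶜ ∪ U) :=
    (hL.congr hG1).union_of_isOpen (((hM.mono hUH').add continuousOn_const).congr hG2)
      hec.isOpen_compl hU
  have hlog : HasLogOn (eᶜ ∪ U) fun z => (b - z) / (a - z) := by
    refine ⟨G, hGc, fun z hz => hz.elim (fun hz => ?_) fun hz => ?_⟩
    · rw [hG1 z hz, hLe z hz]
    · rw [hG2 z hz, exp_add, exp_int_mul_two_pi_mul_I, mul_one, hMe z (hUH' hz)]
  have hr : 0 < ‖b - a‖ / 2 := by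
    have := norm_pos_iff.2 (sub_ne_zero.2 hab.symm); positivity
  have hsph : Metric.sphere a (‖b - a‖ / 2) ⊆ eᶜ ∪ U := by
    intro z hz
    by_cases hze : z ∈ e
    · refine .inr (heU ⟨hze, ?_⟩)
      rintro (rfl | rfl)
      · rw [Metric.mem_sphere, dist_self] at hz; linarith
      · rw [Metric.mem_sphere, dist_eq_norm] at hz; linarith
    · exact .inl hze
  have hlogb : HasLogOn (Metric.sphere a (‖b - a‖ / 2)) fun z => (b - z) / (b - a) := by
    have hsl : ∀ z ∈ Metric.sphere a (‖b - a‖ / 2), (b - z) / (b - a) ∈ slitPlane := by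
      intro z hz
      refine Complex.ball_one_subset_slitPlane ?_
      have hba : b - a ≠ 0 := sub_ne_zero.2 hab.symm
      have : (b - z) / (b - a) - 1 = -((z - a) / (b - a)) := by field_simp; ring
      rw [Metric.mem_sphere, dist_eq_norm] at hz
      rw [Metric.mem_ball, dist_eq_norm, this, norm_neg, norm_div, div_lt_one (norm_pos_iff.2 hba), hz]
      linarith
    exact ⟨fun z => log ((b - z) / (b - a)), ContinuousOn.clog (by fun_prop) hsl,
      fun z hz => exp_log (slitPlane_ne_zero (hsl z hz))⟩
  have hfin : HasLogOn (Metric.sphere a (‖b - a‖ / 2)) fun z => (z - a) ^ (1 : ℤ) := by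
    refine ((hlogb.mul (hlog.mono hsph).inv).const_mul (c := -(b - a))
      (neg_ne_zero.2 (sub_ne_zero.2 hab.symm))).congr fun z hz => ?_
    have h1 : b - z ≠ 0 := by
      intro h
      rw [sub_eq_zero] at h; subst h
      rw [Metric.mem_sphere, dist_eq_norm] at hz; linarith
    have h2 : a - z ≠ 0 := by
      intro h
      rw [sub_eq_zero] at h; subst h
      rw [Metric.mem_sphere, dist_self] at hz; linarith
    have hba : b - a ≠ 0 := sub_ne_zero.2 hab.symm
    field_simp
    ring
  exact one_ne_zero (eq_zero_of_log_on_sphere hr hfin)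

lemma IsArc.sameComp_of_three {H : Set ℂ} (hH : IsCompact H) (h : IsArc a b e)
    (hHe : H ∩ e ⊆ {a, b}) {p₁ p₂ p₃ : ℂ} (h1 : p₁ ∉ e) (h2 : p₂ ∉ e) (h3 : p₃ ∉ e)
    (h13 : SameComp H p₁ p₃) (h23 : SameComp H p₂ p₃) :
    SameComp (H ∪ e) p₁ p₂ ∨ SameComp (H ∪ e) p₁ p₃ ∨ SameComp (H ∪ e) p₂ p₃ := by
  by_cases haH : a ∈ H
  swap
  · refine .inr (.inl (h13.union_arc hH h (c := b) ?_ h1 h3))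
    rintro z ⟨hz, hz'⟩
    exact (hHe ⟨hz, hz'⟩).resolve_left (by rintro rfl; exact haH hz)
  by_cases hbH : b ∈ H
  swap
  · refine .inr (.inl (h13.union_arc hH h (c := a) ?_ h1 h3))
    rintro z ⟨hz, hz'⟩
    exact (hHe ⟨hz, hz'⟩).resolve_right (by rintro rfl; exact hbH hz)
  have hce := h.isCompact
  have hcK := hH.union hce
  obtain ⟨g₁, hg₁, hg₁'⟩ := h13.hasLogOn hH
  obtain ⟨g₂, hg₂, hg₂'⟩ := h23.hasLogOn hH
  obtain ⟨k₁, hk₁, hk₁'⟩ := h.hasLogOn_div h1 h3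
  obtain ⟨k₂, hk₂, hk₂'⟩ := h.hasLogOn_div h2 h3
  obtain ⟨α₁, hα₁⟩ := exp_eq_exp_iff_exists_int.1
    ((hk₁' a h.left_mem).trans (hg₁' a haH).symm)
  obtain ⟨β₁, hβ₁⟩ := exp_eq_exp_iff_exists_int.1
    ((hk₁' b h.right_mem).trans (hg₁' b hbH).symm)
  obtain ⟨α₂, hα₂⟩ := exp_eq_exp_iff_exists_int.1
    ((hk₂' a h.left_mem).trans (hg₂' a haH).symm)
  obtain ⟨β₂, hβ₂⟩ := exp_eq_exp_iff_exists_int.1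
    ((hk₂' b h.right_mem).trans (hg₂' b hbH).symm)
  have hnH : ∀ {p : ℂ}, p ∉ H → p ∉ e → p ∉ H ∪ e := fun h h' hh => hh.elim h h'
  have q1 := hnH h13.left h1
  have q2 := hnH h23.left h2
  have q3 := hnH h13.right h3
  have hd : ∀ {p : ℂ}, p ∉ H ∪ e → ∀ z ∈ H ∪ e, z - p ≠ 0 := by
    intro p hp z hz hh
    rw [sub_eq_zero] at hh; subst hh; exact hp hz
  -- the two logarithms have proportional monodromies along `e`
  have hlog : HasLogOn (H ∪ e) fun z => (z - p₁) ^ (β₂ - α₂) * (z - p₂) ^ (-(β₁ - α₁)) *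
      (z - p₃) ^ ((β₁ - α₁) - (β₂ - α₂)) := by
    obtain ⟨G, hG, hGH, hGe⟩ := exists_glue hH.isClosed hce.isClosed
      (g := fun z => (β₂ - α₂ : ℤ) * g₁ z - (β₁ - α₁ : ℤ) * g₂ z)
      (h := fun z => (β₂ - α₂ : ℤ) * k₁ z - (β₁ - α₁ : ℤ) * k₂ z -
        ((β₂ - α₂) * α₁ - (β₁ - α₁) * α₂ : ℤ) * (2 * Real.pi * I))
      ((continuousOn_const.mul hg₁).sub (continuousOn_const.mul hg₂))
      (((continuousOn_const.mul hk₁).sub (continuousOn_const.mul hk₂)).sub continuousOn_const) (by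
        intro z hz hz'
        rcases hHe ⟨hz, hz'⟩ with rfl | hzb
        · rw [hα₁, hα₂]; push_cast; ring
        · rw [hzb, hβ₁, hβ₂]; push_cast; ring)
    have hval : ∀ z ∈ H ∪ e, ((z - p₁) / (z - p₃)) ^ (β₂ - α₂) / ((z - p₂) / (z - p₃)) ^ (β₁ - α₁) =
        (z - p₁) ^ (β₂ - α₂) * (z - p₂) ^ (-(β₁ - α₁)) * (z - p₃) ^ ((β₁ - α₁) - (β₂ - α₂)) := by
      intro z hz
      rw [zpow_neg, zpow_sub₀ (hd q3 z hz), div_zpow, div_zpow]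
      have := zpow_ne_zero (β₂ - α₂) (hd q3 z hz)
      have := zpow_ne_zero (β₁ - α₁) (hd q3 z hz)
      have := zpow_ne_zero (β₁ - α₁) (hd q2 z hz)
      field_simp
    refine ⟨G, hG, fun z hz => ?_⟩
    refine Eq.trans ?_ (hval z hz)
    rcases hz with hz | hz
    · rw [hGH z hz, exp_sub, exp_int_mul, exp_int_mul, hg₁' z hz, hg₂' z hz]
    · rw [hGe z hz, exp_sub, exp_sub, exp_int_mul, exp_int_mul, hk₁' z hz, hk₂' z hz,
        exp_int_mul_two_pi_mul_I, div_one]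
  by_contra! hcon
  obtain ⟨n12, n13, n23⟩ := hcon
  have sy : ∀ {p q : ℂ}, ¬ SameComp (H ∪ e) p q → ¬ SameComp (H ∪ e) q p := fun h h' => h h'.symm
  have b1 : IsBounded (connectedComponentIn (H ∪ e)ᶜ p₁) → β₂ - α₂ = 0 := fun hb =>
    eq_zero_of_bounded hcK q1 q2 q3 hb n12 n13 hlog
  have b2 : IsBounded (connectedComponentIn (H ∪ e)ᶜ p₂) → -(β₁ - α₁) = 0 := fun hb =>
    eq_zero_of_bounded hcK q2 q1 q3 hb (sy n12) n23 (hlog.congr fun z _ => by ring)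
  have b3 : IsBounded (connectedComponentIn (H ∪ e)ᶜ p₃) → (β₁ - α₁) - (β₂ - α₂) = 0 := fun hb =>
    eq_zero_of_bounded hcK q3 q1 q2 hb (sy n13) (sy n23) (hlog.congr fun z _ => by ring)
  have hβ : β₁ = α₁ := by
    by_cases B2 : IsBounded (connectedComponentIn (H ∪ e)ᶜ p₂)
    · have := b2 B2; omega
    · by_cases B1 : IsBounded (connectedComponentIn (H ∪ e)ᶜ p₁)
      · by_cases B3 : IsBounded (connectedComponentIn (H ∪ e)ᶜ p₃)
        · have := b1 B1; have := b3 B3; omega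
        · exact absurd (sameComp_of_unbounded hcK B2 B3) n23
      · exact absurd (sameComp_of_unbounded hcK B1 B2) n12
  refine n13 (HasLogOn.sameComp hcK q1 q3 ?_)
  obtain ⟨G, hG, hGH, hGe⟩ := exists_glue hH.isClosed hce.isClosed (g := g₁)
    (h := fun z => k₁ z - α₁ * (2 * Real.pi * I)) hg₁ (hk₁.sub continuousOn_const) (by
      intro z hz hz'
      rcases hHe ⟨hz, hz'⟩ with rfl | hzb
      · rw [hα₁]; ring
      · rw [hzb, hβ₁, hβ]; ring)
  refine ⟨G, hG, fun z hz => hz.elim (fun hz => ?_) fun hz => ?_⟩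
  · rw [hGH z hz, hg₁' z hz]
  · rw [hGe z hz, exp_sub, hk₁' z hz, exp_int_mul_two_pi_mul_I, div_one]

/-- The components of the complement of `K`. -/
def comps (K : Set ℂ) : Set (Set ℂ) := {U | ∃ p, p ∉ K ∧ U = connectedComponentIn Kᶜ p}

lemma comp_eq_iff {K : Set ℂ} {p q : ℂ} (hq : q ∉ K) :
    connectedComponentIn Kᶜ p = connectedComponentIn Kᶜ q ↔ SameComp K p q :=
  ⟨fun h => by rw [SameComp, h]; exact mem_connectedComponentIn hq, fun h => h.eq⟩

lemma IsArc.exists_mem_diff {U : Set ℂ} (h : IsArc a b e) (hU : IsOpen U) (hne : U.Nonempty) :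
    (U \ e).Nonempty := by
  by_contra hcon
  rw [not_nonempty_iff_eq_empty, sdiff_eq_empty] at hcon
  have := interior_maximal hcon hU
  rw [h.interior_eq] at this
  exact hne.not_subset_empty this

lemma IsArc.exists_comp {H : Set ℂ} (h : IsArc a b e) (hHe : H ∩ e = {a, b}) :
    ∃ y, y ∉ H ∧ e \ {a, b} ⊆ connectedComponentIn Hᶜ y := by
  obtain ⟨y, hy⟩ := h.nonempty_interior
  have hsub : e \ {a, b} ⊆ Hᶜ := fun z hz hzH => hz.2 (hHe ▸ ⟨hzH, hz.1⟩)
  exact ⟨y, hsub hy, h.isPreconnected_interior.subset_connectedComponentIn hy hsub⟩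

lemma comp_union_of_ne {H : Set ℂ} (hHe : H ∩ e = {a, b}) {y p : ℂ} (heU : e \ {a, b} ⊆ connectedComponentIn Hᶜ y) (hp : p ∉ H)
    (hpy : ¬ SameComp H y p) : p ∉ H ∪ e ∧
      connectedComponentIn (H ∪ e)ᶜ p = connectedComponentIn Hᶜ p := by
  have hsub : connectedComponentIn Hᶜ p ⊆ (H ∪ e)ᶜ := by
    rintro z hz (hzH | hze)
    · exact connectedComponentIn_subset _ _ hz hzH
    · by_cases hzab : z ∈ ({a, b} : Set ℂ)
      · rw [← hHe] at hzab
        exact connectedComponentIn_subset _ _ hz hzab.1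
      · exact hpy (SameComp.trans (heU ⟨hze, hzab⟩) (SameComp.symm hz))
  have hpp : p ∈ connectedComponentIn Hᶜ p := mem_connectedComponentIn hp
  refine ⟨hsub hpp, Subset.antisymm ?_ ?_⟩
  · exact connectedComponentIn_mono _ (compl_subset_compl.2 subset_union_left)
  · exact isPreconnected_connectedComponentIn.subset_connectedComponentIn hpp hsub

lemma comps_union {H : Set ℂ} (hHe : H ∩ e = {a, b}) {y : ℂ} (heU : e \ {a, b} ⊆ connectedComponentIn Hᶜ y) :
    comps (H ∪ e) = (comps H \ {connectedComponentIn Hᶜ y}) ∪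
      (connectedComponentIn (H ∪ e)ᶜ) '' (connectedComponentIn Hᶜ y \ e) := by
  ext W
  constructor
  · rintro ⟨p, hp, rfl⟩
    have hpH : p ∉ H := fun hh => hp (.inl hh)
    by_cases hpy : SameComp H y p
    · exact .inr ⟨p, ⟨hpy, fun hh => hp (.inr hh)⟩, rfl⟩
    · left
      rw [(comp_union_of_ne hHe heU hpH hpy).2]
      exact ⟨⟨p, hpH, rfl⟩, fun hh => hpy ((comp_eq_iff hpH).1 hh.symm)⟩
  · rintro (⟨⟨p, hp, rfl⟩, hW⟩ | ⟨p, ⟨hp, hpe⟩, rfl⟩)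
    · have := comp_union_of_ne hHe heU hp fun hh => hW hh.eq.symm
      exact ⟨p, this.1, this.2.symm⟩
    · exact ⟨p, fun hh => hh.elim (fun hh => connectedComponentIn_subset _ _ hp hh) hpe, rfl⟩

lemma disjoint_comps_union {H : Set ℂ} {y : ℂ} :
    Disjoint (comps H \ {connectedComponentIn Hᶜ y})
      ((connectedComponentIn (H ∪ e)ᶜ) '' (connectedComponentIn Hᶜ y \ e)) := by
  rw [Set.disjoint_left]
  rintro _ ⟨⟨q, hq, h1⟩, hW⟩ ⟨p, ⟨hp, hpe⟩, rfl⟩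
  apply hW
  have hpH : p ∉ H := connectedComponentIn_subset _ _ hp
  have h2 : p ∈ connectedComponentIn (H ∪ e)ᶜ p :=
    mem_connectedComponentIn fun hh => hh.elim hpH hpe
  rw [h1] at h2
  rw [mem_singleton_iff, h1]
  exact SameComp.eq (SameComp.trans h2 (SameComp.symm hp))

lemma ncard_comps_union_of_joined {H : Set ℂ} (hH : IsCompact H) (h : IsArc a b e) (hHe : H ∩ e = {a, b})
    (hfin : (comps H).Finite) (hj : JoinedIn H a b) :
    (comps (H ∪ e)).Finite ∧ (comps (H ∪ e)).ncard = (comps H).ncard + 1 := by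
  obtain ⟨y, hy, heU⟩ := h.exists_comp hHe
  have hU : IsOpen (connectedComponentIn Hᶜ y) := isOpen_comp hH.isClosed y
  have hd := disjoint_comps_union (H := H) (e := e) (y := y)
  have hnc : ¬ IsPreconnected (connectedComponentIn Hᶜ y \ e) :=
    h.not_isPreconnected_diff hU (disjoint_compl_left.mono_left (connectedComponentIn_subset _ _))
      heU hj
  obtain ⟨p, hp⟩ := h.exists_mem_diff hU ⟨y, mem_connectedComponentIn hy⟩
  have hpK : ∀ q ∈ connectedComponentIn Hᶜ y \ e, q ∉ H ∪ e := fun q hq hh =>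
    hh.elim (connectedComponentIn_subset _ _ hq.1) hq.2
  obtain ⟨q, hq, hpq⟩ : ∃ q ∈ connectedComponentIn Hᶜ y \ e, ¬ SameComp (H ∪ e) p q := by
    by_contra! hcon
    apply hnc
    have : connectedComponentIn Hᶜ y \ e = connectedComponentIn (H ∪ e)ᶜ p := by
      refine Subset.antisymm (fun q hq => hcon q hq) fun q hq => ⟨?_, fun hh => ?_⟩
      · exact SameComp.trans hp.1 (SameComp.mono subset_union_left hq)
      · exact connectedComponentIn_subset _ _ hq (.inr hh)
    rw [this]; exact isPreconnected_connectedComponentIn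
  have himg : (connectedComponentIn (H ∪ e)ᶜ) '' (connectedComponentIn Hᶜ y \ e) =
      {connectedComponentIn (H ∪ e)ᶜ p, connectedComponentIn (H ∪ e)ᶜ q} := by
    ext W
    constructor
    · rintro ⟨r, hr, rfl⟩
      have hs : ∀ {s t : ℂ}, s ∈ connectedComponentIn Hᶜ y \ e → t ∈ connectedComponentIn Hᶜ y \ e →
          SameComp H s t := fun hs ht => SameComp.trans (SameComp.symm hs.1) ht.1
      rcases h.sameComp_of_three hH hHe.subset hp.2 hq.2 hr.2 (hs hp hr) (hs hq hr) with h1 | h1 | h1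
      · exact absurd h1 hpq
      · exact .inl h1.eq.symm
      · exact .inr h1.eq.symm
    · rintro (rfl | rfl)
      · exact ⟨p, hp, rfl⟩
      · exact ⟨q, hq, rfl⟩
  have hne : connectedComponentIn (H ∪ e)ᶜ p ≠ connectedComponentIn (H ∪ e)ᶜ q := fun hh =>
    hpq ((comp_eq_iff (hpK q hq)).1 hh)
  rw [comps_union hHe heU]
  have hfin1 : (comps H \ {connectedComponentIn Hᶜ y}).Finite := hfin.subset sdiff_subset
  rw [himg] at hd ⊢
  refine ⟨hfin1.union (by simp), ?_⟩
  rw [ncard_union_eq hd hfin1 (by simp), ncard_pair hne,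
    ← ncard_sdiff_singleton_add_one (show connectedComponentIn Hᶜ y ∈ comps H from ⟨y, hy, rfl⟩) hfin]

lemma ncard_comps_union_of_separated {H₁ H₂ : Set ℂ} (h1 : IsCompact H₁) (h2 : IsCompact H₂)
    (hd : Disjoint H₁ H₂) (h : IsArc a b e) (ha : H₁ ∩ e = {a}) (hb : H₂ ∩ e = {b})
    (hfin : (comps (H₁ ∪ H₂)).Finite) :
    (comps (H₁ ∪ H₂ ∪ e)).Finite ∧ (comps (H₁ ∪ H₂ ∪ e)).ncard = (comps (H₁ ∪ H₂)).ncard := by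
  have hH := h1.union h2
  have hHe : (H₁ ∪ H₂) ∩ e = {a, b} := by rw [union_inter_distrib_right, ha, hb]; rfl
  obtain ⟨y, hy, heU⟩ := h.exists_comp hHe
  have hU : IsOpen (connectedComponentIn (H₁ ∪ H₂)ᶜ y) := isOpen_comp hH.isClosed y
  have hdis := disjoint_comps_union (H := H₁ ∪ H₂) (e := e) (y := y)
  obtain ⟨p, hp⟩ := h.exists_mem_diff hU ⟨y, mem_connectedComponentIn hy⟩
  have himg : (connectedComponentIn (H₁ ∪ H₂ ∪ e)ᶜ) '' (connectedComponentIn (H₁ ∪ H₂)ᶜ y \ e) =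
      {connectedComponentIn (H₁ ∪ H₂ ∪ e)ᶜ p} := by
    ext W
    constructor
    · rintro ⟨r, hr, rfl⟩
      exact (SameComp.union_bridge h1 h2 hd h ha.subset hb.subset
        (SameComp.trans (SameComp.symm hr.1) hp.1) hr.2 hp.2).eq
    · rintro rfl
      exact ⟨p, hp, rfl⟩
  rw [comps_union hHe heU]
  have hfin1 : (comps (H₁ ∪ H₂) \ {connectedComponentIn (H₁ ∪ H₂)ᶜ y}).Finite :=
    hfin.subset sdiff_subset
  rw [himg] at hdis ⊢
  refine ⟨hfin1.union (by simp), ?_⟩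
  rw [ncard_union_eq hdis hfin1 (by simp), ncard_singleton, ncard_sdiff_singleton_add_one
    (show connectedComponentIn (H₁ ∪ H₂)ᶜ y ∈ comps (H₁ ∪ H₂) from ⟨y, hy, rfl⟩) hfin]

/-- A drawing of a multigraph with vertex type `V` and edge type `E` in the complex plane. -/
structure Drawing (V E : Type) where
  pos : V → ℂ
  pos_inj : Function.Injective pos
  fst : E → V
  snd : E → V
  arc : E → Set ℂ
  isArc : ∀ e, IsArc (pos (fst e)) (pos (snd e)) (arc e)
  avoid : ∀ e w, pos w ∈ arc e → w = fst e ∨ w = snd e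
  inter : ∀ e f, e ≠ f → ∀ x ∈ arc e ∩ arc f, x ∈ range pos

/-- Functions on the vertices that are constant along the edges of `X`. -/
def cycleFree {V E : Type} (s t : E → V) (X : Set E) : Submodule ℚ (V → ℚ) where
  carrier := {φ | ∀ e ∈ X, φ (s e) = φ (t e)}
  add_mem' := fun {a b} ha hb e he => by simp [ha e he, hb e he]
  zero_mem' := fun _ _ => rfl
  smul_mem' := fun c φ h e he => by simp [h e he]

/-- Functions on the faces that are constant across the edges of `X`. -/
def cutFree {E Φ : Type} (inc : E → Φ → Prop) (X : Set E) : Submodule ℚ (Φ → ℚ) where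
  carrier := {φ | ∀ e ∈ X, ∀ f f', inc e f → inc e f' → φ f = φ f'}
  add_mem' := fun {a b} ha hb e he f f' h h' => by simp [ha e he f f' h h', hb e he f f' h h']
  zero_mem' := fun _ _ _ _ _ _ => rfl
  smul_mem' := fun c φ hφ e he f f' h h' => by simp [hφ e he f f' h h']

/-- Any two complementary nonempty parts of `A` have edges sharing a face. -/
def FaceConn {E Φ : Type} (inc : E → Φ → Prop) (A : Set E) : Prop :=
  ∀ B ⊆ A, B.Nonempty → (A \ B).Nonempty → ∃ e ∈ B, ∃ e' ∈ A \ B, ∃ f, inc e f ∧ inc e' f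

namespace Drawing

variable {V E : Type} (D : Drawing V E)

/-- The drawing of all vertices and the edges in `X`. -/
def skel (X : Set E) : Set ℂ := range D.pos ∪ ⋃ e ∈ X, D.arc e

lemma arc_subset_skel {X : Set E} {e : E} (he : e ∈ X) : D.arc e ⊆ D.skel X :=
  fun _ hz => .inr (mem_biUnion he hz)

lemma pos_mem_skel (X : Set E) (v : V) : D.pos v ∈ D.skel X := .inl ⟨v, rfl⟩

lemma skel_mono {X Y : Set E} (h : X ⊆ Y) : D.skel X ⊆ D.skel Y :=
  union_subset_union_right _ (biUnion_subset_biUnion_left h)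

lemma fst_mem (e : E) : D.pos (D.fst e) ∈ D.arc e := (D.isArc e).left_mem

lemma snd_mem (e : E) : D.pos (D.snd e) ∈ D.arc e := (D.isArc e).right_mem

lemma fst_ne_snd (e : E) : D.fst e ≠ D.snd e := fun h => (D.isArc e).ne (congrArg D.pos h)

lemma skel_insert (X : Set E) (e : E) : D.skel (insert e X) = D.skel X ∪ D.arc e := by
  rw [skel, skel, biUnion_insert, union_assoc, union_comm (D.arc e)]

lemma skel_inter_arc {X : Set E} {e : E} (he : e ∉ X) :
    D.skel X ∩ D.arc e = {D.pos (D.fst e), D.pos (D.snd e)} := by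
  ext z
  constructor
  · rintro ⟨hz, hze⟩
    have hpos : ∀ v, D.pos v ∈ D.arc e → D.pos v = D.pos (D.fst e) ∨ D.pos v = D.pos (D.snd e) :=
      fun v hv => (D.avoid e v hv).imp (congrArg _) (congrArg _)
    rcases hz with ⟨v, rfl⟩ | hz
    · exact hpos v hze
    · obtain ⟨e', he', hz⟩ := mem_iUnion₂.1 hz
      obtain ⟨v, rfl⟩ := D.inter e e' (by rintro rfl; exact he he') z ⟨hze, hz⟩
      exact hpos v hze
  · rintro (rfl | rfl)
    · exact ⟨D.pos_mem_skel _ _, D.fst_mem e⟩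
    · exact ⟨D.pos_mem_skel _ _, D.snd_mem e⟩

variable [Fintype V]

lemma finrank_cycleFree_insert {s t : E → V} {X : Set E} {e : E}
    (h : ∃ φ ∈ cycleFree s t X, φ (s e) ≠ φ (t e)) :
    Module.finrank ℚ (cycleFree s t (insert e X)) + 1 = Module.finrank ℚ (cycleFree s t X) := by
  obtain ⟨φ, hφ, hne⟩ := h
  let L : Module.Dual ℚ (cycleFree s t X) :=
    (LinearMap.proj (R := ℚ) (φ := fun _ : V => ℚ) (s e) -
      LinearMap.proj (R := ℚ) (φ := fun _ : V => ℚ) (t e)) ∘ₗ (cycleFree s t X).subtype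
  have hL : L ≠ 0 := fun h => hne (sub_eq_zero.1 (by simpa [L] using LinearMap.congr_fun h ⟨φ, hφ⟩))
  have h1 := Module.Dual.finrank_ker_add_one_of_ne_zero hL
  have h2 : (LinearMap.ker L).map (cycleFree s t X).subtype = cycleFree s t (insert e X) := by
    ext ψ
    simp only [Submodule.mem_map, LinearMap.mem_ker, Submodule.subtype_apply, Subtype.exists,
      exists_and_right, exists_eq_right]
    constructor
    · rintro ⟨hψ, h0⟩ e' (rfl | he')
      · exact sub_eq_zero.1 (by simpa [L] using h0)
      · exact hψ e' he'
    · intro hψ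
      exact ⟨fun e' he' => hψ e' (.inr he'), by
        have := hψ e (.inl rfl)
        simp [L, this]⟩
  rw [← h2, ← h1, ((LinearMap.ker L).equivMapOfInjective _
    (cycleFree s t X).injective_subtype).finrank_eq]

lemma comps_skel_empty : (comps (D.skel ∅)).Finite ∧ (comps (D.skel ∅)).ncard = 1 := by
  have hc : IsPreconnected (D.skel ∅)ᶜ := by
    have : D.skel ∅ = range D.pos := by simp [skel]
    rw [this]
    exact ((finite_range _).countable.isPathConnected_compl_of_one_lt_rank
      (by simp [Complex.rank_real_complex])).isConnected.isPreconnected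
  have hne : ((D.skel ∅)ᶜ).Nonempty := by
    by_contra h
    have h2 : IsCompact (univ : Set ℂ) := by
      rw [not_nonempty_iff_eq_empty, compl_empty_iff] at h
      rw [← h]; simpa [skel] using (finite_range D.pos).isCompact
    exact noncompact_univ ℂ h2
  have : comps (D.skel ∅) = {(D.skel ∅)ᶜ} := by
    ext W
    constructor
    · rintro ⟨p, hp, rfl⟩
      exact hc.connectedComponentIn hp
    · rintro rfl
      obtain ⟨p, hp⟩ := hne
      exact ⟨p, hp, (hc.connectedComponentIn hp).symm⟩
  rw [this]; simp

variable [Fintype E]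

lemma isCompact_skel (X : Set E) : IsCompact (D.skel X) :=
  (finite_range _).isCompact.union ((toFinite X).isCompact_biUnion fun e _ => (D.isArc e).isCompact)

lemma isClosed_skel (X : Set E) : IsClosed (D.skel X) := (D.isCompact_skel X).isClosed

lemma comps_skel_insert {X : Set E} {e : E} (he : e ∉ X) (hfin : (comps (D.skel X)).Finite) :
    (comps (D.skel (insert e X))).Finite ∧
      (comps (D.skel (insert e X))).ncard + Module.finrank ℚ (cycleFree D.fst D.snd X) =
        (comps (D.skel X)).ncard + 1 + Module.finrank ℚ (cycleFree D.fst D.snd (insert e X)) := by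
  rw [skel_insert]
  by_cases h : ∃ φ ∈ cycleFree D.fst D.snd X, φ (D.fst e) ≠ φ (D.snd e)
  · have h1 := finrank_cycleFree_insert h
    obtain ⟨φ, hφ, hne⟩ := h
    set S : Set V := {v | φ v = φ (D.fst e)} with hS
    let part : Set V → Set ℂ := fun T =>
      (D.pos '' T) ∪ ⋃ e' ∈ {e' | e' ∈ X ∧ D.fst e' ∈ T}, D.arc e'
    have hcomp : ∀ T, IsCompact (part T) := fun T =>
      ((toFinite T).image _).isCompact.union
        ((toFinite _).isCompact_biUnion fun e _ => (D.isArc e).isCompact)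
    have hunion : D.skel X = part S ∪ part Sᶜ := by
      ext z
      constructor
      · rintro (⟨v, rfl⟩ | hz)
        · by_cases hv : v ∈ S
          · exact .inl (.inl ⟨v, hv, rfl⟩)
          · exact .inr (.inl ⟨v, hv, rfl⟩)
        · obtain ⟨e', he', hz⟩ := mem_iUnion₂.1 hz
          by_cases hv : D.fst e' ∈ S
          · exact .inl (.inr (mem_biUnion (show e' ∈ {e' | e' ∈ X ∧ D.fst e' ∈ S} from ⟨he', hv⟩) hz))
          · exact .inr (.inr (mem_biUnion (show e' ∈ {e' | e' ∈ X ∧ D.fst e' ∈ Sᶜ} from ⟨he', hv⟩) hz))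
      · have : ∀ T, z ∈ part T → z ∈ D.skel X := by
          rintro T (⟨v, _, rfl⟩ | hz)
          · exact D.pos_mem_skel _ _
          · obtain ⟨e', he', hz⟩ := mem_iUnion₂.1 hz
            exact D.arc_subset_skel he'.1 hz
        rintro (hz | hz) <;> exact this _ hz
    have hST : ∀ e' ∈ X, (D.fst e' ∈ S ↔ D.snd e' ∈ S) := fun e' he' => by
      simp only [hS, mem_ofPred_eq, hφ e' he']
    have hvert : ∀ T : Set V, (∀ e' ∈ X, (D.fst e' ∈ T ↔ D.snd e' ∈ T)) →
        ∀ v, D.pos v ∈ part T → v ∈ T := by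
      rintro T hT v (⟨w, hw, hwv⟩ | hz)
      · rwa [← D.pos_inj hwv]
      · obtain ⟨e', he', hz⟩ := mem_iUnion₂.1 hz
        rcases D.avoid e' v hz with rfl | rfl
        · exact he'.2
        · exact (hT e' he'.1).1 he'.2
    have hST' : ∀ e' ∈ X, (D.fst e' ∈ Sᶜ ↔ D.snd e' ∈ Sᶜ) := fun e' he' => not_congr (hST e' he')
    have hdis : Disjoint (part S) (part Sᶜ) := by
      rw [Set.disjoint_left]
      intro z hz hz'
      have : ∀ v, z ≠ D.pos v := by
        rintro v rfl
        exact hvert _ hST' v hz' (hvert _ hST v hz)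
      rcases hz with ⟨w, hw, hwv⟩ | hz
      · exact this w hwv.symm
      rcases hz' with ⟨w, hw, hwv⟩ | hz'
      · exact this w hwv.symm
      obtain ⟨e₁, he₁, hz⟩ := mem_iUnion₂.1 hz
      obtain ⟨e₂, he₂, hz'⟩ := mem_iUnion₂.1 hz'
      obtain ⟨w, hw⟩ := D.inter e₁ e₂ (by rintro rfl; exact he₂.2 he₁.2) z ⟨hz, hz'⟩
      exact this w hw.symm
    have hint := D.skel_inter_arc he
    have hfS : D.fst e ∈ S := rfl
    have hsS : D.snd e ∈ Sᶜ := fun h => hne (Eq.symm h)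
    have hi1 : part S ∩ D.arc e = {D.pos (D.fst e)} := by
      ext z
      constructor
      · rintro ⟨hz, hze⟩
        have : z ∈ D.skel X ∩ D.arc e := ⟨hunion ▸ .inl hz, hze⟩
        rw [hint] at this
        rcases this with h | h
        · exact h
        · rw [mem_singleton_iff] at h
          subst h
          exact absurd (hvert _ hST _ hz) hsS
      · rintro rfl
        exact ⟨.inl ⟨_, hfS, rfl⟩, D.fst_mem e⟩
    have hi2 : part Sᶜ ∩ D.arc e = {D.pos (D.snd e)} := by
      ext z
      constructor
      · rintro ⟨hz, hze⟩
        have : z ∈ D.skel X ∩ D.arc e := ⟨hunion ▸ .inr hz, hze⟩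
        rw [hint] at this
        rcases this with h | h
        · subst h
          exact absurd hfS (hvert _ hST' _ hz)
        · exact h
      · rintro rfl
        exact ⟨.inl ⟨_, hsS, rfl⟩, D.snd_mem e⟩
    rw [hunion] at hfin ⊢
    have h2 := ncard_comps_union_of_separated (hcomp S) (hcomp Sᶜ) hdis (D.isArc e) hi1 hi2 hfin
    exact ⟨h2.1, by rw [h2.2]; omega⟩
  · push Not at h
    have hZ : cycleFree D.fst D.snd (insert e X) = cycleFree D.fst D.snd X := by
      ext φ
      constructor
      · exact fun hφ e' he' => hφ e' (.inr he')
      · rintro hφ e' (rfl | he')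
        · exact h φ hφ
        · exact hφ e' he'
    have hj : JoinedIn (D.skel X) (D.pos (D.fst e)) (D.pos (D.snd e)) := by
      classical
      let φ : V → ℚ := fun v => if JoinedIn (D.skel X) (D.pos (D.fst e)) (D.pos v) then 1 else 0
      have hφ : φ ∈ cycleFree D.fst D.snd X := by
        intro e' he'
        have hj : JoinedIn (D.skel X) (D.pos (D.fst e')) (D.pos (D.snd e')) :=
          (D.isArc e').joinedIn.mono (D.arc_subset_skel he')
        have : JoinedIn (D.skel X) (D.pos (D.fst e)) (D.pos (D.fst e')) ↔
            JoinedIn (D.skel X) (D.pos (D.fst e)) (D.pos (D.snd e')) :=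
          ⟨fun h => h.trans hj, fun h => h.trans hj.symm⟩
        simp only [φ, this]
      have h1 := h φ hφ
      simp only [φ, if_pos (JoinedIn.refl (D.pos_mem_skel X (D.fst e)))] at h1
      by_contra hcon
      simp [hcon] at h1
    have h2 := ncard_comps_union_of_joined (D.isCompact_skel X) (D.isArc e) (D.skel_inter_arc he)
      hfin hj
    exact ⟨h2.1, by rw [h2.2, hZ]⟩

lemma euler (X : Set E) : (comps (D.skel X)).Finite ∧
    (comps (D.skel X)).ncard + Fintype.card V =
      1 + X.ncard + Module.finrank ℚ (cycleFree D.fst D.snd X) := by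
  induction X, toFinite X using Set.Finite.induction_on with
  | empty =>
    obtain ⟨h1, h2⟩ := D.comps_skel_empty
    refine ⟨h1, ?_⟩
    have : cycleFree D.fst D.snd ∅ = ⊤ := by
      ext φ; simp [cycleFree]
    rw [h2, this]
    simp
  | insert he hX ih =>
    obtain ⟨h1, h2⟩ := D.comps_skel_insert he ih.1
    refine ⟨h1, ?_⟩
    rw [ncard_insert_of_notMem he hX]
    omega

end Drawing

lemma eq_of_mem_comps {K U U' : Set ℂ} (hU : U ∈ comps K) (hU' : U' ∈ comps K) {z : ℂ} (hz : z ∈ U)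
    (hz' : z ∈ U') : U = U' := by
  obtain ⟨p, _, rfl⟩ := hU
  obtain ⟨p', _, rfl⟩ := hU'
  exact (connectedComponentIn_eq hz).trans (connectedComponentIn_eq hz').symm

lemma disjoint_of_mem_comps {K U : Set ℂ} (hU : U ∈ comps K) {z : ℂ} (hz : z ∈ U) : z ∉ K := by
  obtain ⟨p, _, rfl⟩ := hU
  exact connectedComponentIn_subset _ _ hz

lemma nonempty_of_mem_comps {K U : Set ℂ} (hU : U ∈ comps K) : U.Nonempty := by
  obtain ⟨p, hp, rfl⟩ := hU
  exact ⟨p, mem_connectedComponentIn hp⟩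

lemma exists_mem_comps {K : Set ℂ} {z : ℂ} (hz : z ∉ K) : ∃ U ∈ comps K, z ∈ U :=
  ⟨_, ⟨z, hz, rfl⟩, mem_connectedComponentIn hz⟩

namespace Drawing

variable {V E : Type} (D : Drawing V E)

/-- The faces of a drawing. -/
abbrev Face : Type := comps (D.skel univ)

/-- The edge `e` is on the boundary of the face `f`. -/
def Inc (e : E) (f : D.Face) : Prop := D.arc e ⊆ closure f.1

/-- The vertex `v` is on the boundary of the face `f`. -/
def VInc (v : V) (f : D.Face) : Prop := D.pos v ∈ closure f.1

/-- The edges at the vertex `v`. -/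
def star (v : V) : Set E := {e | D.fst e = v ∨ D.snd e = v}

variable {D} in
lemma arc_inter_nonempty_iff {e : E} {Ω : Set ℂ} (ho : IsOpen Ω) :
    (D.arc e ∩ Ω).Nonempty ↔ ∃ x ∈ D.arc e, x ∈ Ω ∧ x ∉ range D.pos := by
  constructor
  · rintro ⟨x, hx, hxΩ⟩
    obtain ⟨y, hyΩ, hy⟩ := mem_closure_iff.1 ((D.isArc e).subset_closure hx) Ω ho hxΩ
    refine ⟨y, hy.1, hyΩ, ?_⟩
    rintro ⟨v, rfl⟩
    exact hy.2 ((D.avoid e v hy.1).imp (congrArg _) (congrArg _))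
  · rintro ⟨x, hx, hxΩ, -⟩
    exact ⟨x, hx, hxΩ⟩

lemma exists_mem_arc (e : E) : ∃ x ∈ D.arc e, x ∉ range D.pos := by
  obtain ⟨x, h, -, h'⟩ := (D.arc_inter_nonempty_iff (e := e) isOpen_univ).1 ⟨_, D.fst_mem e, trivial⟩
  exact ⟨x, h, h'⟩

lemma exists_arc_of_mem {z : ℂ} (hz : z ∈ D.skel univ) (hzv : z ∉ range D.pos) :
    ∃ e, z ∈ D.arc e := by
  rcases hz with h | h
  · exact absurd h hzv
  · simpa using h

lemma isPreconnected_compl_skel {X : Set E} (h : (comps (D.skel X)).ncard = 1) :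
    IsPreconnected (D.skel X)ᶜ := by
  obtain ⟨U, hU⟩ := ncard_eq_one.1 h
  have : (D.skel X)ᶜ = U := by
    ext z
    constructor
    · intro hz
      obtain ⟨W, hW, hzW⟩ := exists_mem_comps hz
      rw [hU, mem_singleton_iff] at hW
      rwa [← hW]
    · exact disjoint_of_mem_comps (hU ▸ rfl : U ∈ comps (D.skel X))
  rw [this]
  obtain ⟨p, -, rfl⟩ : U ∈ comps (D.skel X) := hU ▸ rfl
  exact isPreconnected_connectedComponentIn

lemma inter_compl_skel_nonempty {X : Set E} {e : E} :
    (D.arc e ∩ (D.skel X)ᶜ).Nonempty ↔ e ∉ X := by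
  constructor
  · rintro ⟨z, hz, hzX⟩ he
    exact hzX (D.arc_subset_skel he hz)
  · intro he
    obtain ⟨x, hx, hxv⟩ := D.exists_mem_arc e
    refine ⟨x, hx, fun h => hxv ?_⟩
    rcases (D.skel_inter_arc he).subset ⟨h, hx⟩ with h | h <;> exact ⟨_, h.symm⟩

lemma vInc_of_inc {v : V} {e : E} {f : D.Face} (he : e ∈ D.star v) (hf : D.Inc e f) : D.VInc v f := by
  apply hf
  rcases he with rfl | rfl
  · exact D.fst_mem e
  · exact D.snd_mem e

variable [Fintype V] [Fintype E]

instance : Finite D.Face := (D.euler univ).1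

lemma dense_compl_skel (X : Set E) : Dense (D.skel X)ᶜ := by
  rw [← interior_eq_empty_iff_dense_compl]
  induction X, toFinite X using Set.Finite.induction_on with
  | empty =>
    rw [interior_eq_empty_iff_dense_compl]
    simpa [skel] using (finite_range D.pos).countable.dense_compl ℂ
  | insert he hX ih =>
    rw [skel_insert, interior_union_isClosed_of_interior_empty (D.isClosed_skel _) (D.isArc _).interior_eq]
    exact ih

lemma isOpen_face {X : Set E} {U : Set ℂ} (hU : U ∈ comps (D.skel X)) : IsOpen U := by
  obtain ⟨p, hp, rfl⟩ := hU
  exact isOpen_comp (D.isClosed_skel _) p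

lemma exists_face_closure (z : ℂ) : ∃ f : D.Face, z ∈ closure f.1 := by
  have h : z ∈ closure (⋃ f : D.Face, f.1) := by
    refine closure_mono ?_ (D.dense_compl_skel univ z)
    intro w hw
    obtain ⟨U, hU, hwU⟩ := exists_mem_comps hw
    exact mem_iUnion.2 ⟨⟨U, hU⟩, hwU⟩
  rw [closure_iUnion_of_finite] at h
  exact mem_iUnion.1 h

lemma mem_of_mem_closure {f : D.Face} {z : ℂ} (hz : z ∈ closure f.1) (hK : z ∉ D.skel univ) :
    z ∈ f.1 := by
  obtain ⟨f, p, hp, rfl⟩ := f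
  exact (closure_comp_subset (D.isClosed_skel _) p hz).resolve_right hK

lemma inc_of_mem {e : E} {f : D.Face} {x : ℂ} (hx : x ∈ D.arc e) (hxf : x ∈ closure f.1)
    (hxv : x ∉ range D.pos) : D.Inc e f := by
  obtain ⟨f, p, hp, rfl⟩ := f
  have hu : D.skel univ = D.skel {e}ᶜ ∪ D.arc e := by
    rw [← skel_insert]; congr; ext e'; simp [em]
  have hi := D.skel_inter_arc (X := {e}ᶜ) (e := e) (by simp)
  have hxa : x ≠ D.pos (D.fst e) := fun h => hxv ⟨_, h.symm⟩
  have hxb : x ≠ D.pos (D.snd e) := fun h => hxv ⟨_, h.symm⟩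
  unfold Inc
  simp only [hu] at hp hxf ⊢
  refine (D.isArc e).subset_closure_comp (D.isCompact_skel _) hi.subset hp hx ?_ hxa hxb hxf
  intro h
  rcases hi.subset ⟨h, hx⟩ with h | h
  · exact hxa h
  · exact hxb h

/-- In a connected open set without vertices, one can pass from any face to any other through edges. -/
lemma agree {Ω : Set ℂ} (hc : IsPreconnected Ω) (hd : ∀ v, D.pos v ∉ Ω)
    {Q : Set D.Face} (hQ : ∀ e, (D.arc e ∩ Ω).Nonempty → ∀ f f', D.Inc e f → D.Inc e f' → f ∈ Q → f' ∈ Q)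
    {f f' : D.Face} (hf : (f.1 ∩ Ω).Nonempty) (hf' : (f'.1 ∩ Ω).Nonempty) (h : f ∈ Q) : f' ∈ Q := by
  by_contra h'
  have hcl : ∀ S : Set D.Face, IsClosed (⋃ g ∈ S, closure g.1) := fun S =>
    (toFinite S).isClosed_biUnion fun _ _ => isClosed_closure
  obtain ⟨z, hzΩ, hz, hz'⟩ := isPreconnected_closed_iff.1 hc _ _ (hcl Q) (hcl Qᶜ)
    (fun z _ => by
      obtain ⟨g, hg⟩ := D.exists_face_closure z
      by_cases hgQ : g ∈ Q
      · exact .inl (mem_biUnion hgQ hg)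
      · exact .inr (mem_biUnion hgQ hg))
    (hf.imp fun z hz => ⟨hz.2, mem_biUnion h (subset_closure hz.1)⟩)
    (hf'.imp fun z hz => ⟨hz.2, mem_biUnion h' (subset_closure hz.1)⟩)
  obtain ⟨g, hgQ, hg⟩ := mem_iUnion₂.1 hz
  obtain ⟨g', hgQ', hg'⟩ := mem_iUnion₂.1 hz'
  by_cases hzK : z ∈ D.skel univ
  · have hzv : z ∉ range D.pos := by
      rintro ⟨v, rfl⟩
      exact hd v hzΩ
    obtain ⟨e, he⟩ := D.exists_arc_of_mem hzK hzv
    exact hgQ' (hQ e ⟨z, he, hzΩ⟩ g g' (D.inc_of_mem he hg hzv) (D.inc_of_mem he hg' hzv) hgQ)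
  · have : g = g' := Subtype.ext
      (eq_of_mem_comps g.2 g'.2 (D.mem_of_mem_closure hg hzK) (D.mem_of_mem_closure hg' hzK))
    exact hgQ' (this ▸ hgQ)

lemma exists_inc_inter {e : E} {Ω : Set ℂ} (ho : IsOpen Ω) (he : (D.arc e ∩ Ω).Nonempty) :
    ∃ f, D.Inc e f ∧ (f.1 ∩ Ω).Nonempty := by
  obtain ⟨x, hx, hxΩ, hxv⟩ := (arc_inter_nonempty_iff ho).1 he
  obtain ⟨f, hf⟩ := D.exists_face_closure x
  obtain ⟨y, hy⟩ := mem_closure_iff.1 hf Ω ho hxΩ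
  exact ⟨f, D.inc_of_mem hx hf hxv, ⟨y, hy.symm⟩⟩

lemma exists_inc (e : E) : ∃ f, D.Inc e f := by
  obtain ⟨f, hf, -⟩ := D.exists_inc_inter (e := e) isOpen_univ ⟨_, D.fst_mem e, trivial⟩
  exact ⟨f, hf⟩

lemma exists_inc_of_inter {Ω : Set ℂ} (ho : IsOpen Ω) (hc : IsPreconnected Ω)
    (hd : ∀ v, D.pos v ∉ Ω) {e : E} (he : (D.arc e ∩ Ω).Nonempty) {f : D.Face}
    (hf : (f.1 ∩ Ω).Nonempty) : ∃ e', (D.arc e' ∩ Ω).Nonempty ∧ D.Inc e' f := by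
  by_contra! hcon
  obtain ⟨f', hef', hf'⟩ := D.exists_inc_inter ho he
  have : f' ∈ ({f} : Set D.Face) := D.agree hc hd (fun e' he' g g' hg hg' hgf => by
    rw [mem_singleton_iff] at hgf
    subst hgf
    exact absurd hg (hcon e' he')) hf hf' rfl
  rw [mem_singleton_iff] at this
  subst this
  exact hcon e he hef'

lemma faceConn_of_isPreconnected {Ω : Set ℂ} (ho : IsOpen Ω) (hc : IsPreconnected Ω)
    (hd : ∀ v, D.pos v ∉ Ω) : FaceConn D.Inc {e | (D.arc e ∩ Ω).Nonempty} := by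
  rintro B hB ⟨e, he⟩ ⟨e', he', heB'⟩
  by_contra! hcon
  obtain ⟨f, hef, hf⟩ := D.exists_inc_inter ho (hB he)
  obtain ⟨f', hef', hf'⟩ := D.exists_inc_inter ho he'
  have : f' ∈ {g | ∃ e ∈ B, D.Inc e g} := D.agree hc hd (fun e₁ he₁ g g' hg hg' hgQ => by
    obtain ⟨e₂, he₂, hg₂⟩ := hgQ
    by_cases h : e₁ ∈ B
    · exact ⟨e₁, h, hg'⟩
    · exact absurd hg (hcon e₂ he₂ e₁ ⟨he₁, h⟩ g hg₂)) hf hf' ⟨e, he, hef⟩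
  obtain ⟨e₂, he₂, hf₂⟩ := this
  exact hcon e₂ he₂ e' ⟨he', heB'⟩ f' hf₂ hef'

lemma faceConn_compl {X : Set E} (h : (comps (D.skel X)).ncard = 1) : FaceConn D.Inc Xᶜ := by
  have := D.faceConn_of_isPreconnected (D.isClosed_skel X).isOpen_compl
    (D.isPreconnected_compl_skel h) fun v => not_not.2 (D.pos_mem_skel X v)
  simp only [inter_compl_skel_nonempty] at this
  exact this

lemma faceConn_univ : FaceConn D.Inc univ := by
  simpa using D.faceConn_compl D.comps_skel_empty.2

lemma faceConn_compl_singleton (e : E) : FaceConn D.Inc {e}ᶜ := by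
  refine D.faceConn_compl ?_
  classical
  have h1 := finrank_cycleFree_insert (s := D.fst) (t := D.snd) (X := ∅) (e := e)
    ⟨Pi.single (D.fst e) 1, fun _ h => h.elim, by simp [(D.fst_ne_snd e).symm]⟩
  have h2 := (D.comps_skel_insert (X := ∅) (e := e) (by simp) D.comps_skel_empty.1).2
  rw [D.comps_skel_empty.2] at h2
  simp only [insert_empty_eq] at h1 h2
  omega

lemma exists_edge [Nonempty E] (f : D.Face) : ∃ e, D.Inc e f := by
  obtain ⟨e⟩ := ‹Nonempty E›
  have hd : (D.arc e ∩ (D.skel ∅)ᶜ).Nonempty := D.inter_compl_skel_nonempty.2 (by simp)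
  obtain ⟨e', -, h⟩ := D.exists_inc_of_inter (D.isClosed_skel ∅).isOpen_compl
    (D.isPreconnected_compl_skel D.comps_skel_empty.2) (fun v => not_not.2 (D.pos_mem_skel ∅ v)) hd
    (f := f) ((nonempty_of_mem_comps f.2).imp fun z hz =>
      ⟨hz, fun h => disjoint_of_mem_comps f.2 hz (D.skel_mono (empty_subset _) h)⟩)
  exact ⟨e', h⟩

/-- A punctured disk around a vertex met only by the edges at that vertex. -/
lemma exists_punctured (v : V) : ∃ Ω : Set ℂ, IsOpen Ω ∧ IsPreconnected Ω ∧ (∀ w, D.pos w ∉ Ω) ∧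
    (∀ e, (D.arc e ∩ Ω).Nonempty ↔ e ∈ D.star v) ∧
    ∀ f : D.Face, (f.1 ∩ Ω).Nonempty ↔ D.VInc v f := by
  have hfin : ∀ᶠ r in nhdsWithin (0 : ℝ) (Ioi 0), (∀ w, w ≠ v → D.pos w ∉ Metric.ball (D.pos v) r) ∧
      (∀ e, D.pos v ∉ D.arc e → Disjoint (D.arc e) (Metric.ball (D.pos v) r)) ∧
      ∀ f : D.Face, D.pos v ∉ closure f.1 → Disjoint (closure f.1) (Metric.ball (D.pos v) r) := by
    have hcl : ∀ C : Set ℂ, IsClosed C → D.pos v ∉ C →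
        ∀ᶠ r in nhdsWithin (0 : ℝ) (Ioi 0), Disjoint C (Metric.ball (D.pos v) r) := by
      intro C hC hv
      obtain ⟨r, hr, h⟩ := Metric.isOpen_iff.1 hC.isOpen_compl _ hv
      filter_upwards [Ioo_mem_nhdsGT hr] with r' hr'
      exact disjoint_left.2 fun z hz hz' => h (Metric.ball_subset_ball hr'.2.le hz') hz
    refine .and ?_ (.and ?_ ?_)
    · refine Filter.eventually_all.2 fun w => Filter.eventually_imp_distrib_left.2 fun hw => ?_
      filter_upwards [hcl {D.pos w} isClosed_singleton fun h => hw (D.pos_inj h).symm] with r hr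
      exact disjoint_singleton_left.1 hr
    · exact Filter.eventually_all.2 fun e => Filter.eventually_imp_distrib_left.2
        (hcl _ (D.isArc e).isCompact.isClosed)
    · exact Filter.eventually_all.2 fun f => Filter.eventually_imp_distrib_left.2
        (hcl _ isClosed_closure)
  obtain ⟨r, ⟨h1, h2, h3⟩, hr⟩ := (hfin.and self_mem_nhdsWithin).exists
  have hΩ : {z : ℂ | ‖z - D.pos v‖ ∈ Ioo 0 r} = Metric.ball (D.pos v) r \ {D.pos v} := by
    ext z
    simp [sub_eq_zero, dist_eq_norm, and_comm]
  have hΩo : IsOpen (Metric.ball (D.pos v) r \ {D.pos v}) := Metric.isOpen_ball.sdiff isClosed_singleton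
  refine ⟨Metric.ball (D.pos v) r \ {D.pos v}, hΩo,
    hΩ ▸ isPreconnected_norm_mem isPreconnected_Ioo (fun x hx => hx.1.le) _, ?_, ?_, ?_⟩
  · intro w hw
    by_cases h : w = v
    · exact hw.2 (by rw [h]; rfl)
    · exact h1 w h hw.1
  · intro e
    constructor
    · rintro ⟨z, hz, hzΩ⟩
      by_contra he
      refine disjoint_left.1 (h2 e fun h => he ?_) hz hzΩ.1
      exact (D.avoid e v h).imp Eq.symm Eq.symm
    · intro he
      have hv : D.pos v ∈ D.arc e := by
        rcases he with rfl | rfl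
        · exact D.fst_mem e
        · exact D.snd_mem e
      obtain ⟨x, hx, hxb, hxv⟩ := (arc_inter_nonempty_iff (e := e) Metric.isOpen_ball).1
        ⟨_, hv, Metric.mem_ball_self hr⟩
      exact ⟨x, hx, hxb, fun h => hxv ⟨v, h.symm⟩⟩
  · intro f
    constructor
    · rintro ⟨z, hz, hzΩ⟩
      by_contra hf
      exact disjoint_left.1 (h3 f hf) (subset_closure hz) hzΩ.1
    · intro hf
      obtain ⟨z, hz, hzf⟩ := mem_closure_iff.1 hf _ Metric.isOpen_ball (Metric.mem_ball_self hr)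
      refine ⟨z, hzf, hz, fun h => disjoint_of_mem_comps f.2 hzf ?_⟩
      rw [h]
      exact D.pos_mem_skel _ _

lemma faceConn_star (v : V) : FaceConn D.Inc (D.star v) := by
  obtain ⟨Ω, ho, hc, hd, he, -⟩ := D.exists_punctured v
  have := D.faceConn_of_isPreconnected ho hc hd
  simp only [he] at this
  exact this

lemma exists_inc_of_vInc {v : V} {f : D.Face} (hf : D.VInc v f) (hv : (D.star v).Nonempty) :
    ∃ e ∈ D.star v, D.Inc e f := by
  obtain ⟨Ω, ho, hc, hd, he, hfΩ⟩ := D.exists_punctured v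
  obtain ⟨e, heΩ⟩ := hv
  obtain ⟨e', he', h⟩ := D.exists_inc_of_inter ho hc hd ((he e).2 heΩ) ((hfΩ f).2 hf)
  exact ⟨e', (he e').1 he', h⟩

lemma eq_of_star_eq_empty {v : V} (hv : D.star v = ∅) {f f' : D.Face} (hf : D.VInc v f)
    (hf' : D.VInc v f') : f = f' := by
  obtain ⟨Ω, ho, hc, hd, he, hfΩ⟩ := D.exists_punctured v
  have : f' ∈ ({f} : Set D.Face) := D.agree hc hd (fun e' he' => by
    have := (he e').1 he'
    simp [hv] at this) ((hfΩ f).2 hf) ((hfΩ f').2 hf') rfl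
  exact this.symm

lemma finrank_cutFree (X : Set E) :
    Module.finrank ℚ (cutFree D.Inc X) = (comps (D.skel Xᶜ)).ncard := by
  have hfin := (D.euler Xᶜ).1
  have hsub : ∀ f : D.Face, ∃ U : comps (D.skel Xᶜ), f.1 ⊆ U.1 := by
    rintro ⟨f, p, hp, rfl⟩
    have hp' : p ∉ D.skel Xᶜ := fun h => hp (D.skel_mono (subset_univ _) h)
    exact ⟨⟨_, p, hp', rfl⟩, connectedComponentIn_mono _
      (compl_subset_compl.2 (D.skel_mono (subset_univ _)))⟩
  choose π hπ using hsub
  have hπ' : ∀ f U, (f.1 ∩ U.1).Nonempty → π f = U := by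
    rintro f U ⟨z, hz, hzU⟩
    exact Subtype.ext (eq_of_mem_comps (π f).2 U.2 (hπ f hz) hzU)
  have hsurj : Function.Surjective π := by
    intro U
    obtain ⟨z, hzU, hz⟩ := (D.dense_compl_skel univ).inter_open_nonempty U.1 (D.isOpen_face U.2)
      (nonempty_of_mem_comps U.2)
    obtain ⟨f, hf, hzf⟩ := exists_mem_comps hz
    exact ⟨⟨f, hf⟩, hπ' _ _ ⟨z, hzf, hzU⟩⟩
  obtain ⟨σ, hσ⟩ := hsurj.hasRightInverse
  have hrange : LinearMap.range (LinearMap.funLeft ℚ ℚ π) = cutFree D.Inc X := by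
    ext φ
    constructor
    · rintro ⟨ψ, rfl⟩ e he f f' hf hf'
      obtain ⟨x, hx, hxX⟩ := (D.inter_compl_skel_nonempty (X := Xᶜ) (e := e)).2 (by simpa using he)
      obtain ⟨U, hU, hxU⟩ := exists_mem_comps hxX
      have key : ∀ g : D.Face, D.Inc e g → π g = ⟨U, hU⟩ := fun g hg => hπ' _ _ (by
        rw [inter_comm]
        exact mem_closure_iff.1 (hg hx) U (D.isOpen_face hU) hxU)
      simp only [LinearMap.funLeft_apply, key f hf, key f' hf']
    · intro hφ
      refine ⟨φ ∘ σ, ?_⟩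
      ext f
      have hU := (π f).2
      have hpre : IsPreconnected (π f).1 := by
        obtain ⟨p, -, hp⟩ := hU
        rw [hp]
        exact isPreconnected_connectedComponentIn
      have hint : ∀ g, π g = π f → (g.1 ∩ (π f).1).Nonempty := fun g hg =>
        (nonempty_of_mem_comps g.2).imp fun z hz => ⟨hz, hg ▸ hπ g hz⟩
      have := D.agree (Q := {g | φ g = φ f}) hpre
        (fun v hv => disjoint_of_mem_comps hU hv (D.pos_mem_skel _ v))
        (fun e ⟨z, hz, hzU⟩ g g' hg hg' hgf => by
          have he : e ∈ X := by
            by_contra he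
            exact disjoint_of_mem_comps hU hzU (D.arc_subset_skel (X := Xᶜ) he hz)
          exact (hφ e he g' g hg' hg).trans hgf)
        (hint f rfl) (hint (σ (π f)) (hσ _)) rfl
      exact this
  rw [← hrange, LinearMap.finrank_range_of_inj (LinearMap.funLeft_injective_of_surjective ℚ ℚ π hsurj)]
  have := hfin.fintype
  rw [Module.finrank_fintype_fun_eq_card, ← Nat.card_eq_fintype_card, Nat.card_coe_set_eq]

end Drawing

/-- Functions constant on `S`. -/
def constOn {α : Type} (S : Set α) : Submodule ℚ (α → ℚ) where
  carrier := {φ | ∀ x ∈ S, ∀ y ∈ S, φ x = φ y}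
  add_mem' := fun {a b} ha hb x hx y hy => by simp [ha x hx y hy, hb x hx y hy]
  zero_mem' := fun _ _ _ _ => rfl
  smul_mem' := fun c φ h x hx y hy => by simp [h x hx y hy]

lemma finrank_constOn {α : Type} [Finite α] {S : Set α} (hS : S.Nonempty) :
    Module.finrank ℚ (constOn S) + S.ncard = Nat.card α + 1 := by
  classical
  have := Fintype.ofFinite α
  obtain ⟨x₀, hx₀⟩ := hS
  let q : α → Option ↥Sᶜ := fun x => if h : x ∈ S then none else some ⟨x, h⟩
  have hqS : ∀ x ∈ S, q x = none := fun x hx => by simp [q, hx]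
  have hqS' : ∀ x (h : x ∉ S), q x = some ⟨x, h⟩ := fun x hx => by simp [q, hx]
  have hq : Function.Surjective q := by
    rintro (_ | ⟨x, hx⟩)
    · exact ⟨x₀, hqS _ hx₀⟩
    · exact ⟨x, hqS' x hx⟩
  have hr : LinearMap.range (LinearMap.funLeft ℚ ℚ q) = constOn S := by
    ext φ
    constructor
    · rintro ⟨ψ, rfl⟩ x hx y hy
      simp [LinearMap.funLeft_apply, hqS x hx, hqS y hy]
    · intro hφ
      refine ⟨fun o => o.elim (φ x₀) fun x => φ x, ?_⟩
      ext x
      by_cases hx : x ∈ S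
      · simpa [LinearMap.funLeft_apply, hqS x hx] using hφ _ hx₀ _ hx
      · simp [LinearMap.funLeft_apply, hqS' x hx]
  rw [← hr, LinearMap.finrank_range_of_inj (LinearMap.funLeft_injective_of_surjective ℚ ℚ q hq),
    Module.finrank_fintype_fun_eq_card, Fintype.card_option, ← Nat.card_eq_fintype_card,
    Nat.card_coe_set_eq, ← ncard_add_ncard_compl S]
  ring

lemma finrank_cutFree_add_le {E Φ : Type} [Finite Φ] {inc : E → Φ → Prop} {A : Set E}
    (hA : FaceConn inc A) :
    Module.finrank ℚ (cutFree inc A) + {f | ∃ e ∈ A, inc e f}.ncard ≤ Nat.card Φ + 1 := by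
  have := Fintype.ofFinite Φ
  rcases eq_empty_or_nonempty {f | ∃ e ∈ A, inc e f} with h | h
  · rw [h]
    have := (cutFree inc A).finrank_le
    rw [Module.finrank_fintype_fun_eq_card] at this
    rw [ncard_empty, Nat.card_eq_fintype_card]
    omega
  · rw [← finrank_constOn h]
    refine Nat.add_le_add_right (Submodule.finrank_mono ?_) _
    rintro φ hφ x ⟨e, he, hx⟩ y ⟨e', he', hy⟩
    by_contra hne
    obtain ⟨e₁, ⟨h1, g₁, hg₁, hx₁⟩, e₂, ⟨h2, h2'⟩, f, hf₁, hf₂⟩ :=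
      hA {e | e ∈ A ∧ ∃ g, inc e g ∧ φ g = φ x} (fun _ h => h.1) ⟨e, he, x, hx, rfl⟩
        ⟨e', he', fun ⟨_, g, hg, hgx⟩ => hne (hgx.symm.trans (hφ e' he' _ _ hg hy))⟩
    exact h2' ⟨h2, f, hf₂, (hφ e₁ h1 _ _ hf₁ hg₁).trans hx₁⟩

/-- The incidences between vertices, edges and faces of a plane multigraph without loops. -/
structure PlaneMap (V E Φ : Type) [Finite V] [Finite E] [Finite Φ] where
  fst : E → V
  snd : E → V
  inc : E → Φ → Prop
  vinc : V → Φ → Prop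
  fst_ne_snd : ∀ e, fst e ≠ snd e
  euler : ∀ X : Set E, Module.finrank ℚ (cutFree inc X) + Nat.card V =
    1 + Xᶜ.ncard + Module.finrank ℚ (cycleFree fst snd Xᶜ)
  exists_inc : ∀ e, ∃ f, inc e f
  faceConn_univ : FaceConn inc univ
  faceConn_compl : ∀ e, FaceConn inc {e}ᶜ
  faceConn_star : ∀ v, FaceConn inc {e | fst e = v ∨ snd e = v}
  vinc_of_inc : ∀ {v e f}, fst e = v ∨ snd e = v → inc e f → vinc v f
  exists_inc_of_vinc : ∀ {v e f}, fst e = v ∨ snd e = v → vinc v f →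
    ∃ e', (fst e' = v ∨ snd e' = v) ∧ inc e' f
  eq_of_isolated : ∀ {v}, (∀ e, ¬ (fst e = v ∨ snd e = v)) → ∀ {f f'}, vinc v f → vinc v f' → f = f'
  exists_edge : Nonempty E → ∀ f, ∃ e, inc e f

/-- The incidences of a drawing. -/
noncomputable def Drawing.planeMap {V E : Type} [Fintype V] [Fintype E] (D : Drawing V E) :
    PlaneMap V E D.Face where
  fst := D.fst
  snd := D.snd
  inc := D.Inc
  vinc := D.VInc
  fst_ne_snd := D.fst_ne_snd
  euler X := by rw [D.finrank_cutFree, Nat.card_eq_fintype_card, (D.euler Xᶜ).2]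
  exists_inc := D.exists_inc
  faceConn_univ := D.faceConn_univ
  faceConn_compl := D.faceConn_compl_singleton
  faceConn_star := D.faceConn_star
  vinc_of_inc := D.vInc_of_inc
  exists_inc_of_vinc he hf := D.exists_inc_of_vInc hf ⟨_, he⟩
  eq_of_isolated h _ _ := D.eq_of_star_eq_empty (eq_empty_of_forall_notMem h)
  exists_edge _ f := D.exists_edge f

namespace PlaneMap

variable {V E Φ : Type} [Finite V] [Finite E] [Finite Φ] (M : PlaneMap V E Φ)

/-- The edges at the vertex `v`. -/
def star (v : V) : Set E := {e | M.fst e = v ∨ M.snd e = v}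

/-- The faces incident to the edges in `A`. -/
def faces (A : Set E) : Set Φ := {f | ∃ e ∈ A, M.inc e f}

/-- The vertices with edges of two different colours. -/
def border {ι : Type} (c : E → ι) : Set V := {v | ∃ e ∈ M.star v, ∃ e' ∈ M.star v, c e ≠ c e'}

/-- The faces with edges of two different colours. -/
def dborder {ι : Type} (c : E → ι) : Set Φ := {f | ∃ e e', M.inc e f ∧ M.inc e' f ∧ c e ≠ c e'}

/-- The subspace attached to an edge set on the vertex side. -/
abbrev Z (X : Set E) : Submodule ℚ (V → ℚ) := cycleFree M.fst M.snd X

/-- The subspace attached to an edge set on the face side. -/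
abbrev Zd (X : Set E) : Submodule ℚ (Φ → ℚ) := cutFree M.inc X

lemma euler_univ : Nat.card Φ + Nat.card V = 1 + Nat.card E + Module.finrank ℚ (M.Z univ) := by
  have := Fintype.ofFinite Φ
  have h := M.euler ∅
  have h0 : cutFree M.inc ∅ = ⊤ := by ext φ; simp [cutFree]
  rwa [h0, finrank_top, Module.finrank_fintype_fun_eq_card, ← Nat.card_eq_fintype_card, compl_empty,
    ncard_univ] at h

lemma single_mem_Z [DecidableEq V] {v : V} {X : Set E} (h : ∀ e ∈ X, e ∉ M.star v) :
    Pi.single v 1 ∈ M.Z X := by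
  intro e he
  have := h e he
  simp only [star, mem_ofPred_eq, not_or] at this
  rw [Pi.single_eq_of_ne this.1, Pi.single_eq_of_ne this.2]

lemma const_mem_Z (X : Set E) (a : ℚ) : (fun _ => a) ∈ M.Z X := fun _ _ => rfl

lemma constOn_le {α : Type} [Finite α] [DecidableEq α] {S : Set α} {M : Submodule ℚ (α → ℚ)}
    (h1 : ∀ a : ℚ, (fun _ => a) ∈ M) (h2 : ∀ v ∉ S, Pi.single v 1 ∈ M) : constOn S ≤ M := by
  have := Fintype.ofFinite α
  intro φ hφ
  rcases S.eq_empty_or_nonempty with rfl | ⟨x₀, hx₀⟩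
  · rw [pi_eq_sum_univ' φ]
    exact M.sum_mem fun v _ => M.smul_mem _ (by simpa using h2 v (by simp))
  · have : φ = (fun _ => φ x₀) + ∑ v, (φ v - φ x₀) • (Pi.single v 1 : α → ℚ) := by
      ext x
      simp [Finset.sum_apply, Pi.single_apply]
    rw [this]
    refine M.add_mem (h1 _) (M.sum_mem fun v _ => ?_)
    by_cases hv : v ∈ S
    · rw [hφ v hv x₀ hx₀, sub_self, zero_smul]
      exact M.zero_mem
    · exact M.smul_mem _ (h2 v hv)

lemma card_le_finrank_constOn {α : Type} [Finite α] (S : Set α) :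
    Nat.card α ≤ Module.finrank ℚ (constOn S) + S.ncard ∧
      (S.Nonempty → Nat.card α + 1 ≤ Module.finrank ℚ (constOn S) + S.ncard) := by
  rcases S.eq_empty_or_nonempty with rfl | h
  · have := Fintype.ofFinite α
    have h0 : constOn (∅ : Set α) = ⊤ := by ext φ; simp [constOn]
    rw [h0, finrank_top, Module.finrank_fintype_fun_eq_card, Nat.card_eq_fintype_card]
    simp
  · have := finrank_constOn h
    exact ⟨by omega, fun _ => by omega⟩

lemma Z_anti {X Y : Set E} (h : X ⊆ Y) : M.Z Y ≤ M.Z X := fun _ hφ e he => hφ e (h he)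

lemma Zd_anti {X Y : Set E} (h : X ⊆ Y) : M.Zd Y ≤ M.Zd X := fun _ hφ e he => hφ e (h he)

lemma le_sum_finrank_Z (c : E → Fin 3) :
    Module.finrank ℚ (constOn (M.border c)) + 2 * Module.finrank ℚ (M.Z univ) ≤
      Module.finrank ℚ (M.Z {e | c e = 0}ᶜ) + Module.finrank ℚ (M.Z {e | c e = 1}ᶜ) +
        Module.finrank ℚ (M.Z {e | c e = 2}ᶜ) := by
  classical
  have := Fintype.ofFinite V
  set A := M.Z {e | c e = 0}ᶜ
  set B := M.Z {e | c e = 1}ᶜ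
  set C := M.Z {e | c e = 2}ᶜ
  have h1 := Submodule.finrank_sup_add_finrank_inf_eq A B
  have h2 := Submodule.finrank_sup_add_finrank_inf_eq (A ⊔ B) C
  have hA : M.Z univ ≤ A := M.Z_anti (subset_univ _)
  have hB : M.Z univ ≤ B := M.Z_anti (subset_univ _)
  have hC : M.Z univ ≤ C := M.Z_anti (subset_univ _)
  have h3 : Module.finrank ℚ (M.Z univ) ≤ Module.finrank ℚ ↥(A ⊓ B) :=
    Submodule.finrank_mono (le_inf hA hB)
  have h4 : Module.finrank ℚ (M.Z univ) ≤ Module.finrank ℚ ↥((A ⊔ B) ⊓ C) :=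
    Submodule.finrank_mono (le_inf (hA.trans le_sup_left) hC)
  have h5 : Module.finrank ℚ (constOn (M.border c)) ≤ Module.finrank ℚ ↥(A ⊔ B ⊔ C) := by
    refine Submodule.finrank_mono (constOn_le (fun a => ?_) fun v hv => ?_)
    · exact Submodule.mem_sup_right (M.const_mem_Z _ a)
    · have hv' : ∀ e ∈ M.star v, ∀ e' ∈ M.star v, c e = c e' := by
        simpa [border] using hv
      have key : ∃ i : Fin 3, ∀ e ∈ {e | c e = i}ᶜ, e ∉ M.star v := by
        rcases (M.star v).eq_empty_or_nonempty with h | ⟨e₀, he₀⟩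
        · exact ⟨0, fun e _ => by simp [h]⟩
        · exact ⟨c e₀, fun e he h => he (hv' e h e₀ he₀)⟩
      obtain ⟨i, hi⟩ := key
      have := M.single_mem_Z hi
      fin_cases i
      · exact Submodule.mem_sup_left (Submodule.mem_sup_left this)
      · exact Submodule.mem_sup_left (Submodule.mem_sup_right this)
      · exact Submodule.mem_sup_right this
  omega

/-- A partition of the edges into three face-connected parts with few border vertices has few border
faces. -/
lemma ncard_dborder_le [Nonempty E] {c : E → Fin 3} (hc : ∀ i, FaceConn M.inc {e | c e = i}) {K : ℕ}
    (hK : 1 ≤ K) (hb : (M.border c).ncard ≤ K) : (M.dborder c).ncard ≤ K + 1 := by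
  have hfin3 : ∀ i : Fin 3, i = 0 ∨ i = 1 ∨ i = 2 := by decide
  have f0 := finrank_cutFree_add_le (hc 0)
  have f1 := finrank_cutFree_add_le (hc 1)
  have f2 := finrank_cutFree_add_le (hc 2)
  have e0 := M.euler {e | c e = 0}
  have e1 := M.euler {e | c e = 1}
  have e2 := M.euler {e | c e = 2}
  have eu := M.euler_univ
  have hZ := M.le_sum_finrank_Z c
  have hE : {e | c e = 0}ᶜ.ncard + {e | c e = 1}ᶜ.ncard + {e | c e = 2}ᶜ.ncard = 2 * Nat.card E := by
    have h0 := ncard_add_ncard_compl {e | c e = 0}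
    have h1 := ncard_add_ncard_compl {e | c e = 1}
    have h2 : {e | c e = 2}ᶜ.ncard = {e | c e = 0}.ncard + {e | c e = 1}.ncard := by
      rw [← ncard_union_eq]
      · congr 1
        ext e
        rcases hfin3 (c e) with h | h | h <;> simp [h]
      · exact disjoint_left.2 fun e (h : c e = 0) (h' : c e = 1) => by simp [h] at h'
    omega
  have hF : Nat.card Φ + (M.dborder c).ncard ≤ (M.faces {e | c e = 0}).ncard +
      (M.faces {e | c e = 1}).ncard + (M.faces {e | c e = 2}).ncard := by
    set F : Fin 3 → Set Φ := fun i => M.faces {e | c e = i}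
    have h1 := ncard_union_add_ncard_inter (F 0) (F 1)
    have h2 := ncard_union_add_ncard_inter (F 0 ∪ F 1) (F 2)
    have h3 : F 0 ∪ F 1 ∪ F 2 = univ := by
      ext f
      obtain ⟨e, he⟩ := M.exists_edge inferInstance f
      have : f ∈ F (c e) := ⟨e, rfl, he⟩
      rcases hfin3 (c e) with h | h | h <;> rw [h] at this <;> simp [this]
    have h4 : M.dborder c ⊆ (F 0 ∩ F 1) ∪ ((F 0 ∪ F 1) ∩ F 2) := by
      rintro f ⟨e, e', he, he', hne⟩
      have h : f ∈ F (c e) := ⟨e, rfl, he⟩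
      have h' : f ∈ F (c e') := ⟨e', rfl, he'⟩
      rcases hfin3 (c e) with a | a | a <;> rcases hfin3 (c e') with b | b | b <;>
        rw [a] at h <;> rw [b] at h' <;> simp_all
    have h5 := (ncard_le_ncard h4).trans (ncard_union_le _ _)
    rw [h3, ncard_univ] at h2
    change _ ≤ (F 0).ncard + (F 1).ncard + (F 2).ncard
    omega
  simp only [faces] at hF
  obtain ⟨h1, h2⟩ := card_le_finrank_constOn (M.border c)
  by_cases hne : (M.border c).Nonempty
  · have := h2 hne
    simp only [Z] at *
    omega
  · have h3 : (M.border c).ncard = 0 := by rw [not_nonempty_iff_eq_empty.1 hne, ncard_empty]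
    simp only [Z] at *
    omega

end PlaneMap

section Link

variable {E Φ : Type} {inc : E → Φ → Prop}

/-- `e` and `e'` are joined by a chain of edges in `A`, consecutive ones sharing a face. -/
def Link (inc : E → Φ → Prop) (A : Set E) : E → E → Prop :=
  Relation.ReflTransGen fun a b => a ∈ A ∧ b ∈ A ∧ ∃ f, inc a f ∧ inc b f

/-- The part of `A` linked to `e`. -/
def part (inc : E → Φ → Prop) (A : Set E) (e : E) : Set E := {e' | Link inc A e e'}

lemma Link.symm {A : Set E} {a b : E} (h : Link inc A a b) : Link inc A b a := by
  induction h with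
  | refl => exact .refl
  | tail _ h ih =>
    obtain ⟨h1, h2, f, h3, h4⟩ := h
    exact Relation.ReflTransGen.head ⟨h2, h1, f, h4, h3⟩ ih

lemma Link.mono {A B : Set E} (hAB : A ⊆ B) {a b : E} (h : Link inc A a b) : Link inc B a b := by
  induction h with
  | refl => exact .refl
  | tail _ h ih => exact Relation.ReflTransGen.tail ih ⟨hAB h.1, hAB h.2.1, h.2.2⟩

lemma Link.trans {A : Set E} {a b c : E} (h : Link inc A a b) (h' : Link inc A b c) :
    Link inc A a c := Relation.ReflTransGen.trans h h'

lemma Link.single {A : Set E} {a b : E} {f : Φ} (ha : a ∈ A) (hb : b ∈ A) (hf : inc a f)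
    (hf' : inc b f) : Link inc A a b :=
  Relation.ReflTransGen.single ⟨ha, hb, f, hf, hf'⟩

lemma mem_part_self {A : Set E} (e : E) : e ∈ part inc A e := .refl

lemma part_subset {A : Set E} {e : E} (he : e ∈ A) : part inc A e ⊆ A := by
  intro e' h
  induction h with
  | refl => exact he
  | tail _ h _ => exact h.2.1

lemma mem_part_of_share {A : Set E} {e a b : E} {f : Φ} (he : e ∈ A) (ha : a ∈ part inc A e) (hb : b ∈ A)
    (hf : inc a f) (hf' : inc b f) : b ∈ part inc A e :=
  Link.trans ha (.single (part_subset he ha) hb hf hf')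

lemma Link.in_part {A : Set E} {e e' : E} (h : Link inc A e e') : Link inc (part inc A e) e e' := by
  induction h with
  | refl => exact .refl
  | tail h h' ih => exact ih.tail ⟨h, Relation.ReflTransGen.tail h h', h'.2.2⟩

lemma faceConn_iff {A : Set E} : FaceConn inc A ↔ ∀ e ∈ A, ∀ e' ∈ A, Link inc A e e' := by
  constructor
  · intro h e he e' he'
    by_contra hcon
    obtain ⟨a, ha, b, hb, f, hf, hf'⟩ := h (part inc A e) (part_subset he) ⟨e, mem_part_self e⟩
      ⟨e', he', hcon⟩
    exact hb.2 (mem_part_of_share he ha hb.1 hf hf')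
  · rintro h B hB ⟨e, he⟩ ⟨e', he'⟩
    by_contra! hcon
    have : ∀ x, Link inc A e x → x ∈ B := by
      intro x hx
      induction hx with
      | refl => exact he
      | @tail a b _ h' ih =>
        obtain ⟨h1, h2, f, h3, h4⟩ := h'
        by_contra hb
        exact hcon a ih b ⟨h2, hb⟩ f h3 h4
    exact he'.2 (this e' (h e (hB he) e' he'.1))

lemma faceConn_of_forall_link {A : Set E} {d : E} (h : ∀ e ∈ A, Link inc A e d) : FaceConn inc A :=
  faceConn_iff.2 fun e he e' he' => (h e he).trans (h e' he').symm

lemma faceConn_part (A : Set E) (e : E) : FaceConn inc (part inc A e) :=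
  faceConn_of_forall_link fun _ h => (Link.in_part h).symm

lemma FaceConn.subset_part {A B : Set E} (h : FaceConn inc B) (hBA : B ⊆ A) {b e : E} (hb : b ∈ B)
    (hbe : b ∈ part inc A e) : B ⊆ part inc A e :=
  fun x hx => Link.trans hbe ((faceConn_iff.1 h b hb x hx).mono hBA)

lemma FaceConn.part_eq {A : Set E} (h : FaceConn inc A) {e : E} (he : e ∈ A) : part inc A e = A :=
  (part_subset he).antisymm (h.subset_part Subset.rfl he (mem_part_self e))

lemma part_eq_of_mem {A : Set E} {e e' : E} (h : e' ∈ part inc A e) : part inc A e' = part inc A e :=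
  ext fun _ => ⟨fun hx => Link.trans h hx, fun hx => (Link.symm h).trans hx⟩

lemma FaceConn.union {A B : Set E} (hA : FaceConn inc A) (hB : FaceConn inc B) {a b : E} {f : Φ}
    (ha : a ∈ A) (hb : b ∈ B) (hf : inc a f) (hf' : inc b f) : FaceConn inc (A ∪ B) := by
  refine faceConn_of_forall_link (d := a) ?_
  rintro e (he | he)
  · exact (faceConn_iff.1 hA e he a ha).mono subset_union_left
  · exact ((faceConn_iff.1 hB e he b hb).mono subset_union_right).trans
      (Link.single (.inr hb) (.inl ha) hf' hf)

/-- Removing one component of the complement of a connected set leaves a connected set. -/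
lemma FaceConn.diff_part {W D : Set E} (hW : FaceConn inc W) (hD : FaceConn inc D) (hDW : D ⊆ W)
    (hne : D.Nonempty) {y : E} (hy : y ∈ W \ D) : FaceConn inc (W \ part inc (W \ D) y) := by
  obtain ⟨d, hd⟩ := hne
  have hDs : D ⊆ W \ part inc (W \ D) y := fun x hx => ⟨hDW hx, fun h => (part_subset hy h).2 hx⟩
  refine faceConn_of_forall_link (d := d) fun b hb => ?_
  by_cases hbD : b ∈ D
  · exact (faceConn_iff.1 hD b hbD d hd).mono hDs
  have hb' : b ∈ W \ D := ⟨hb.1, hbD⟩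
  have hYs : part inc (W \ D) b ⊆ W \ part inc (W \ D) y := fun x hx =>
    ⟨(part_subset hb' hx).1, fun h => hb.2 (Link.trans h (Link.symm hx))⟩
  obtain ⟨e, he, e', he', f, hf, hf'⟩ := hW (part inc (W \ D) b)
    (fun x hx => (part_subset hb' hx).1) ⟨b, mem_part_self b⟩
    ⟨d, hDW hd, fun h => (part_subset hb' h).2 hd⟩
  have heD : e' ∈ D := by
    by_contra h
    exact he'.2 (mem_part_of_share hb' he ⟨he'.1, h⟩ hf hf')
  exact ((Link.in_part he).mono hYs).trans ((Link.single (hYs he) (hDs heD) hf hf').trans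
    ((faceConn_iff.1 hD e' heD d hd).mono hDs))

lemma FaceConn.compl_part {D : Set E} (hu : FaceConn inc univ) (hD : FaceConn inc D)
    (hne : D.Nonempty) {y : E} (hy : y ∉ D) : FaceConn inc (part inc Dᶜ y)ᶜ := by
  have := hu.diff_part hD (subset_univ D) hne (y := y) ⟨trivial, hy⟩
  rwa [← compl_eq_univ_sdiff, ← compl_eq_univ_sdiff] at this

end Link

namespace PlaneMap

variable {V E Φ : Type} [Finite V] [Finite E] [Finite Φ] (M : PlaneMap V E Φ)

/-- Edge sets with a hierarchical decomposition into connected sets with few border vertices. -/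
inductive Dec (K : ℕ) : Set E → Prop
  | leaf (e : E) : Dec K {e}
  | node (c : E → Fin 3) (h0 : Dec K {e | c e = 0}) (h1 : Dec K {e | c e = 1})
      (hc : ∀ i, FaceConn M.inc {e | c e = i}) (hb : (M.border c).ncard ≤ K) :
      Dec K {e | c e ≠ 2}

/-- Connected edge sets whose decompositions can be completed. -/
def Good (K : ℕ) (A : Set E) : Prop :=
  FaceConn M.inc A ∧ ∀ y ∉ A, (∀ z ∉ A, z ∉ part M.inc Aᶜ y → M.Dec K (part M.inc Aᶜ z)) →
    M.Dec K (part M.inc Aᶜ y)ᶜ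

variable {M}

lemma Dec.good {K : ℕ} {A : Set E} (h : M.Dec K A) (hA : FaceConn M.inc A) (hA' : FaceConn M.inc Aᶜ) :
    M.Good K A := by
  refine ⟨hA, fun y hy _ => ?_⟩
  rwa [hA'.part_eq hy, compl_compl]

variable (M)

lemma faceConn_singleton (e : E) : FaceConn M.inc {e} :=
  faceConn_of_forall_link (d := e) fun x hx => by rw [mem_singleton_iff.1 hx]; exact .refl

lemma good_singleton (K : ℕ) (e : E) : M.Good K {e} :=
  (Dec.leaf e).good (M.faceConn_singleton e) (M.faceConn_compl e)

/-- The vertices at which an edge of `W` meets an edge outside `W` or of a different colour. -/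
def wborder {ι : Type} (c : E → ι) (W : Set E) : Set V :=
  {v | ∃ e ∈ M.star v, ∃ e' ∈ M.star v, e ∈ W ∧ (e' ∉ W ∨ c e ≠ c e')}

lemma wborder_mono {ι : Type} {c : E → ι} {W W' : Set E} (hWW : W' ⊆ W)
    (hs : ∀ e ∈ W', ∀ e', c e' = c e → e' ∈ W') : M.wborder c W' ⊆ M.wborder c W := by
  rintro v ⟨e, he, e', he', heW, h⟩
  exact ⟨e, he, e', he', hWW heW, .inr fun hc => h.elim (fun h => h (hs e heW e' hc.symm)) fun h => h hc⟩

/-- Building a decomposition from the colour classes. -/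
lemma dec_of_colouring {K : ℕ} {ι : Type} (n : ℕ) : ∀ (c : E → ι) (W : Set E), (c '' W).ncard = n →
    W.Nonempty → Wᶜ.Nonempty → FaceConn M.inc W → FaceConn M.inc Wᶜ →
    (∀ e ∈ W, ∀ e', c e' = c e → e' ∈ W) → (∀ e ∈ W, M.Good K {e' | c e' = c e}) →
    (M.wborder c W).ncard ≤ K → M.Dec K W := by
  classical
  induction n using Nat.strong_induction_on with
  | h n ih =>
  intro c W hn hW hW' hWc hWc' hs hg hb
  subst hn
  have hu := M.faceConn_univ
  have hsub : ∀ {B : Set E} {e : E}, e ∈ W → e ∈ B → (∀ x ∈ {e' | c e' = c e}, x ∈ B) →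
      {e' | c e' = c e} ⊆ part M.inc B e := fun {B e} he heB hB =>
    (hg e he).1.subset_part hB rfl (mem_part_self e)
  by_cases hA : ∃ e₀ ∈ W, ¬ FaceConn M.inc {e' | c e' = c e₀}ᶜ
  · obtain ⟨e₀, he₀, hD'⟩ := hA
    set D := {e' | c e' = c e₀} with hDdef
    have hDne : D.Nonempty := ⟨e₀, rfl⟩
    have hD : FaceConn M.inc D := (hg e₀ he₀).1
    have hDW : D ⊆ W := fun x hx => hs e₀ he₀ x hx
    obtain ⟨y, hy⟩ := hW'
    have hyD : y ∉ D := fun h => hy (hDW h)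
    set W1 := part M.inc Dᶜ y
    have hW1 : Wᶜ ⊆ W1 := hWc'.subset_part (compl_subset_compl.2 hDW) hy (mem_part_self y)
    have hW1' : W1ᶜ ⊆ W := by rwa [compl_subset_comm]
    have hDW1 : D ⊆ W1ᶜ := fun x hx h => part_subset (A := Dᶜ) hyD h hx
    have hfib : ∀ e ∈ W, e ∉ D → {e' | c e' = c e} ⊆ part M.inc Dᶜ e := fun e he heD =>
      hsub he heD fun x hx h => heD (show c e = c e₀ from (Eq.symm hx).trans h)
    have hdecz : ∀ z ∉ D, z ∉ W1 → M.Dec K (part M.inc Dᶜ z) := by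
      intro z hz hzW1
      have hzs : part M.inc Dᶜ z ⊆ W := fun x hx => hW1' fun h => hzW1 (Link.trans h (Link.symm hx))
      have hsz : ∀ e ∈ part M.inc Dᶜ z, ∀ e', c e' = c e → e' ∈ part M.inc Dᶜ z := by
        intro e he e' he'
        rw [← part_eq_of_mem he]
        exact hfib e (hzs he) (part_subset (A := Dᶜ) hz he) he'
      refine ih _ ?_ c _ rfl ⟨z, mem_part_self z⟩ ⟨y, fun h => hzW1 (Link.symm h)⟩ (faceConn_part _ _)
        (hu.compl_part hD hDne hz) hsz (fun e he => hg e (hzs he))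
        ((ncard_le_ncard (M.wborder_mono hzs hsz)).trans hb)
      refine ncard_lt_ncard ⟨image_mono hzs, fun h => ?_⟩
      obtain ⟨x, hx, hxe⟩ := h ⟨e₀, he₀, rfl⟩
      exact part_subset (A := Dᶜ) hz hx hxe
    have hdec1 : M.Dec K W1ᶜ := (hg e₀ he₀).2 y hyD hdecz
    have hgood1 : M.Good K W1ᶜ := hdec1.good (hu.compl_part hD hDne hyD)
      (by rw [compl_compl]; exact faceConn_part _ _)
    let c' : E → ι := fun e => if e ∈ W1 then c e else c e₀
    have hc'1 : ∀ e ∈ W1, c' e = c e := fun e he => if_pos he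
    have hc'2 : ∀ e ∉ W1, c' e = c e₀ := fun e he => if_neg he
    have hside : ∀ e ∈ W, ∀ e', c e' = c e → (e ∈ W1 ↔ e' ∈ W1) := by
      intro e he e' he'
      by_cases heD : e ∈ D
      · exact iff_of_false (hDW1 heD) (hDW1 (show c e' = c e₀ from he'.trans heD))
      · have := hfib e he heD he'
        exact ⟨fun h => Link.trans h this, fun h => Link.trans h (Link.symm this)⟩
    have hf1 : ∀ e ∈ W, e ∉ W1 → {e' | c' e' = c' e} = W1ᶜ := by
      intro e he heW1
      ext e'
      rw [mem_ofPred_eq, hc'2 e heW1]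
      by_cases h : e' ∈ W1
      · rw [hc'1 _ h]
        exact iff_of_false (fun h' => hDW1 (show e' ∈ D from h') h) (fun h' => h' h)
      · exact iff_of_true (hc'2 _ h) h
    have hf2 : ∀ e ∈ W, e ∈ W1 → {e' | c' e' = c' e} = {e' | c e' = c e} := by
      intro e he heW1
      ext e'
      rw [mem_ofPred_eq, mem_ofPred_eq, hc'1 e heW1]
      by_cases h : e' ∈ W1
      · rw [hc'1 _ h]
      · rw [hc'2 _ h]
        exact iff_of_false (fun h' => hDW1 (show e ∈ D from h'.symm) heW1)
          fun h' => h ((hside e he e' h').1 heW1)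
    have hlt : (c' '' W).ncard < (c '' W).ncard := by
      refine ncard_lt_ncard ⟨?_, fun h => ?_⟩
      · rintro _ ⟨e, he, rfl⟩
        by_cases h : e ∈ W1
        · exact ⟨e, he, (hc'1 e h).symm⟩
        · exact ⟨e₀, he₀, (hc'2 e h).symm⟩
      · obtain ⟨z, hzD, hz⟩ : ∃ z, z ∉ D ∧ z ∉ W1 := by
          by_contra! hcon
          apply hD'
          have : Dᶜ = W1 := Subset.antisymm (fun z hz => hcon z hz) (part_subset hyD)
          rw [this]
          exact faceConn_part _ _
        obtain ⟨e, he, hez⟩ := h ⟨z, hW1' hz, rfl⟩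
        by_cases heW1 : e ∈ W1
        · rw [hc'1 e heW1] at hez
          exact hz ((hside e he z hez.symm).1 heW1)
        · rw [hc'2 e heW1] at hez
          exact hzD hez.symm
    refine ih _ hlt c' W rfl hW ⟨y, hy⟩ hWc hWc' ?_ ?_ ((ncard_le_ncard ?_).trans hb)
    · intro e he e' he'
      by_cases heW1 : e ∈ W1
      · have : e' ∈ {e' | c e' = c e} := hf2 e he heW1 ▸ he'
        exact hs e he e' this
      · have : e' ∈ W1ᶜ := hf1 e he heW1 ▸ he'
        exact hW1' this
    · intro e he
      by_cases heW1 : e ∈ W1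
      · rw [hf2 e he heW1]
        exact hg e he
      · rw [hf1 e he heW1]
        exact hgood1
    · rintro v ⟨e, he, e', he', heW, h⟩
      refine ⟨e, he, e', he', heW, h.imp id fun h hc => h ?_⟩
      have := hside e heW e' hc.symm
      by_cases heW1 : e ∈ W1
      · rw [hc'1 e heW1, hc'1 e' (this.1 heW1), hc]
      · rw [hc'2 e heW1, hc'2 e' fun h => heW1 (this.2 h)]
  push Not at hA
  obtain ⟨e₀, he₀, x₀, hx₀, f₀, hf₀, hf₀'⟩ := hu W (subset_univ W) hW (by rwa [← compl_eq_univ_sdiff])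
  set P := {e' | c e' = c e₀} with hPdef
  have hPW : P ⊆ W := fun x hx => hs e₀ he₀ x hx
  by_cases hWP : W ⊆ P
  · have hWP' : P = W := hPW.antisymm hWP
    obtain ⟨y, hy⟩ := hW'
    have hyP : y ∉ P := fun h => hy (hPW h)
    have := (hg e₀ he₀).2 y hyP
    rw [(hA e₀ he₀).part_eq hyP, compl_compl] at this
    rw [← hWP']
    exact this fun z hz hz' => absurd hz hz'
  obtain ⟨p, hpW, hpP⟩ := not_subset.1 hWP
  obtain ⟨y, hy⟩ := hW'
  obtain ⟨p₂, hp₂, x₂, hx₂, f₂, hf₂, hf₂'⟩ := hA e₀ he₀ (W \ P) (fun x hx => hx.2) ⟨p, hpW, hpP⟩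
    ⟨y, fun h => hy (hPW h), fun h => hy h.1⟩
  have hx₂W : x₂ ∈ Wᶜ := fun h => hx₂.2 ⟨h, hx₂.1⟩
  set C2 := part M.inc (W \ P) p₂ with hC2
  have hC2W : C2 ⊆ W := fun x hx => (part_subset hp₂ hx).1
  have hC2P : ∀ x ∈ C2, x ∉ P := fun x hx => (part_subset hp₂ hx).2
  have hC2s : ∀ e ∈ C2, ∀ e', c e' = c e → e' ∈ C2 := by
    intro e he e' he'
    rw [hC2, ← part_eq_of_mem he]
    refine hsub (B := W \ P) (hC2W he) ⟨hC2W he, hC2P e he⟩ (fun x hx => ⟨hs e (hC2W he) x hx, fun h => ?_⟩) he'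
    exact hC2P e he (show c e = c e₀ from (Eq.symm hx).trans h)
  have hC1s : ∀ e ∈ W \ C2, ∀ e', c e' = c e → e' ∈ W \ C2 := fun e he e' he' =>
    ⟨hs e he.1 e' he', fun h => he.2 (hC2s e' h e he'.symm)⟩
  have he₀C1 : e₀ ∈ W \ C2 := ⟨he₀, fun h => hC2P e₀ h rfl⟩
  have hC1c : FaceConn M.inc (W \ C2) :=
    hWc.diff_part (hg e₀ he₀).1 hPW ⟨e₀, rfl⟩ hp₂
  have hC2c : FaceConn M.inc C2 := faceConn_part _ _
  have hC1' : FaceConn M.inc (W \ C2)ᶜ := by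
    have : (W \ C2)ᶜ = C2 ∪ Wᶜ := by
      ext x; by_cases hx : x ∈ C2 <;> simp [hx]
    rw [this]
    exact hC2c.union hWc' (mem_part_self p₂) hx₂W hf₂ hf₂'
  have hC2' : FaceConn M.inc C2ᶜ := by
    have : C2ᶜ = (W \ C2) ∪ Wᶜ := by
      ext x
      by_cases hx : x ∈ W
      · simp [hx]
      · have : x ∉ C2 := fun h => hx (hC2W h)
        simp [hx, this]
    rw [this]
    exact hC1c.union hWc' he₀C1 hx₀.2 hf₀ hf₀'
  have hdec2 : M.Dec K C2 := by
    refine ih _ (ncard_lt_ncard ⟨image_mono hC2W, fun h => ?_⟩) c C2 rfl ⟨p₂, mem_part_self p₂⟩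
      ⟨e₀, he₀C1.2⟩ hC2c hC2' hC2s (fun e he => hg e (hC2W he))
      ((ncard_le_ncard (M.wborder_mono hC2W hC2s)).trans hb)
    obtain ⟨x, hx, hxe⟩ := h ⟨e₀, he₀, rfl⟩
    exact hC2P x hx hxe
  have hdec1 : M.Dec K (W \ C2) := by
    refine ih _ (ncard_lt_ncard ⟨image_mono sdiff_subset, fun h => ?_⟩) c (W \ C2) rfl ⟨e₀, he₀C1⟩
      ⟨p₂, fun h => h.2 (mem_part_self p₂)⟩ hC1c hC1' hC1s (fun e he => hg e he.1)
      ((ncard_le_ncard (M.wborder_mono sdiff_subset hC1s)).trans hb)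
    obtain ⟨x, hx, hxe⟩ := h ⟨p₂, hp₂.1, rfl⟩
    exact hx.2 (hC2s p₂ (mem_part_self p₂) x hxe)
  let d : E → Fin 3 := fun e => if e ∈ C2 then 1 else if e ∈ W then 0 else 2
  have h0 : {e | d e = 0} = W \ C2 := by
    ext e; by_cases h : e ∈ C2 <;> by_cases h' : e ∈ W <;> simp [d, h, h']
  have h1 : {e | d e = 1} = C2 := by
    ext e; by_cases h : e ∈ C2 <;> by_cases h' : e ∈ W <;> simp [d, h, h']
  have h2 : {e | d e = 2} = Wᶜ := by
    ext e
    by_cases h : e ∈ C2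
    · simp [d, h, hC2W h]
    · by_cases h' : e ∈ W <;> simp [d, h, h']
  have h2' : {e | d e ≠ 2} = W := by
    rw [← compl_compl W, ← h2]; rfl
  rw [← h2']
  refine .node d (h0 ▸ hdec1) (h1 ▸ hdec2) ?_ ((ncard_le_ncard ?_).trans hb)
  · intro i
    fin_cases i
    · exact h0 ▸ hC1c
    · exact h1 ▸ hC2c
    · exact h2 ▸ hWc'
  · have key : ∀ e e', d e ≠ d e' → e ∈ W → e' ∉ W ∨ c e ≠ c e' := by
      intro e e' hd he
      by_contra! hcon
      apply hd
      have : e ∈ C2 ↔ e' ∈ C2 := ⟨fun h => hC2s e h e' hcon.2.symm, fun h => hC2s e' h e hcon.2⟩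
      simp [d, this, he, hcon.1]
    rintro v ⟨e, he, e', he', hd⟩
    by_cases heW : e ∈ W
    · exact ⟨e, he, e', he', heW, key e e' hd heW⟩
    · by_cases heW' : e' ∈ W
      · exact ⟨e', he', e, he, heW', key e' e hd.symm heW'⟩
      · have h2 : e ∉ C2 := fun h => heW (hC2W h)
        have h2' : e' ∉ C2 := fun h => heW' (hC2W h)
        exact absurd (by simp [d, heW, heW', h2, h2']) hd

end PlaneMap

section Next

variable {ι : Type} {T : SimpleGraph ι}

lemma exists_next (hT : T.IsTree) {t x : ι} (h : x ≠ t) :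
    ∃ a, T.Adj t a ∧ T.dist a x + 1 = T.dist t x := by
  obtain ⟨p, hp⟩ := hT.connected.exists_walk_length_eq_dist t x
  cases p with
  | nil => exact absurd rfl h
  | cons hadj q =>
    refine ⟨_, hadj, ?_⟩
    have h1 := T.dist_le q
    have h2 := hT.connected.dist_triangle (u := t) (v := _) (w := x) (G := T) |>.trans
      (Nat.add_le_add_right (SimpleGraph.dist_eq_one_iff_adj.2 hadj).le _)
    simp only [SimpleGraph.Walk.length_cons] at hp
    omega

lemma next_unique (hT : T.IsTree) {t x a b : ι} (ha : T.Adj t a) (hb : T.Adj t b)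
    (ha' : T.dist a x + 1 = T.dist t x) (hb' : T.dist b x + 1 = T.dist t x) : a = b := by
  obtain ⟨p, hp⟩ := hT.connected.exists_walk_length_eq_dist a x
  obtain ⟨q, hq⟩ := hT.connected.exists_walk_length_eq_dist b x
  have h1 : (SimpleGraph.Walk.cons ha p).IsPath :=
    SimpleGraph.Walk.isPath_of_length_eq_dist _ (by simp [hp, ha'])
  have h2 : (SimpleGraph.Walk.cons hb q).IsPath :=
    SimpleGraph.Walk.isPath_of_length_eq_dist _ (by simp [hq, hb'])
  have := congrArg (fun w => w.1.snd) ((hT.isAcyclic.subsingleton_path t x).elim ⟨_, h1⟩ ⟨_, h2⟩)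
  simpa using this

open Classical in
/-- The neighbour of `t` in the direction of `x`. -/
noncomputable def next (T : SimpleGraph ι) (t x : ι) : ι :=
  if h : ∃ a, T.Adj t a ∧ T.dist a x + 1 = T.dist t x then h.choose else t

lemma next_spec (hT : T.IsTree) {t x : ι} (h : x ≠ t) :
    T.Adj t (next T t x) ∧ T.dist (next T t x) x + 1 = T.dist t x := by
  have := exists_next hT h
  rw [next, dif_pos this]
  exact this.choose_spec

lemma next_eq (hT : T.IsTree) {t x a : ι} (ha : T.Adj t a) (ha' : T.dist a x + 1 = T.dist t x) :
    next T t x = a := by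
  have h : x ≠ t := by
    rintro rfl
    simp at ha'
  have := next_spec hT h
  exact next_unique hT this.1 ha this.2 ha'

lemma next_eq_of_adj (hT : T.IsTree) {t x y : ι} (hxy : T.Adj x y) (hx : x ≠ t) (hy : y ≠ t) :
    next T t x = next T t y := by
  have key : ∀ {x y : ι}, T.Adj x y → x ≠ t → T.dist t y = T.dist t x + 1 →
      next T t x = next T t y := by
    intro x y hxy hx h
    obtain ⟨h1, h2⟩ := next_spec hT hx
    refine (next_eq hT h1 ?_).symm
    have h3 := hT.connected.dist_triangle (u := t) (v := next T t x) (w := y)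
    have h4 := hT.connected.dist_triangle (u := next T t x) (v := x) (w := y)
    rw [SimpleGraph.dist_eq_one_iff_adj.2 h1] at h3
    rw [SimpleGraph.dist_eq_one_iff_adj.2 hxy] at h4
    omega
  rcases hT.dist_eq_dist_add_one_of_adj t hxy with h | h
  · exact (key hxy.symm hy h).symm
  · exact key hxy hx h

lemma next_eq_of_connected (hT : T.IsTree) {S : Set ι} (hS : (T.induce S).Connected) {t i j : ι}
    (ht : t ∉ S) (hi : i ∈ S) (hj : j ∈ S) : next T t i = next T t j := by
  obtain ⟨w⟩ := hS.preconnected ⟨i, hi⟩ ⟨j, hj⟩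
  have : ∀ {a b : S}, (T.induce S).Walk a b → next T t a = next T t b := by
    intro a b w
    induction w with
    | nil => rfl
    | cons h p ih =>
      exact (next_eq_of_adj hT h (ne_of_mem_of_not_mem (Subtype.mem _) ht)
        (ne_of_mem_of_not_mem (Subtype.mem _) ht)).trans ih
  exact this w

lemma next_eq_of_next (hT : T.IsTree) {s t x y : ι} (hst : T.Adj s t) (hxs : x ≠ s)
    (hx : next T s x = t) (hxt : x ≠ t) (hy : next T t y = next T t x) :
    y ≠ s ∧ next T s y = t := by
  have h1 := (next_spec hT hxs).2
  rw [hx] at h1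
  have h2 := (next_spec hT hxt).2
  have hs : next T t y ≠ s := by
    rw [hy]
    intro h
    rw [h] at h2
    omega
  have hys : y ≠ s := by
    rintro rfl
    exact hs (next_eq hT hst.symm (by simp [SimpleGraph.dist_eq_one_iff_adj.2 hst.symm]))
  refine ⟨hys, next_eq hT hst ?_⟩
  rcases hT.dist_eq_dist_add_one_of_adj y hst with h | h <;>
    rw [SimpleGraph.dist_comm (u := y), SimpleGraph.dist_comm (u := y)] at h
  · exact h.symm
  · exact absurd (next_eq hT hst.symm h.symm) hs

end Next

namespace PlaneMap

variable {V E Φ : Type} [Finite V] [Finite E] [Finite Φ] (M : PlaneMap V E Φ)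
variable {ι : Type} {T : SimpleGraph ι} {X : ι → Set V} {φ : E → ι}

/-- The edges assigned to nodes beyond `t`, seen from `s`. -/
def beyond (T : SimpleGraph ι) (φ : E → ι) (s t : ι) : Set E := {e | φ e ≠ s ∧ next T s (φ e) = t}

lemma dec_of_node (hT : T.IsTree) (hX : ∀ v, (T.induce {i | v ∈ X i}).Connected)
    (hφ : ∀ v, ∀ e ∈ M.star v, v ∈ X (φ e)) {K : ℕ} {t : ι} (hK : (X t).ncard ≤ K) {A W : Set E}
    (hW : W.Nonempty) (hW' : Wᶜ.Nonempty) (hWc : FaceConn M.inc W) (hWc' : FaceConn M.inc Wᶜ)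
    (hAW : A ⊆ W)
    (hA : ∀ e ∈ A, φ e ≠ t → part M.inc (beyond T φ t (next T t (φ e))) e ⊆ A ∧
      M.Good K (part M.inc (beyond T φ t (next T t (φ e))) e))
    (hs : ∀ e ∈ W, e ∉ A → part M.inc Aᶜ e ⊆ W ∧ M.Good K (part M.inc Aᶜ e)) : M.Dec K W := by
  classical
  let c : E → Set E := fun e => if e ∈ A then if φ e = t then {e} else
    part M.inc (beyond T φ t (next T t (φ e))) e else part M.inc Aᶜ e
  have c1 : ∀ {e}, e ∈ A → φ e = t → c e = {e} := fun h h' => by simp [c, h, h']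
  have c2 : ∀ {e}, e ∈ A → φ e ≠ t → c e = part M.inc (beyond T φ t (next T t (φ e))) e :=
    fun h h' => by simp [c, h, h']
  have c3 : ∀ {e}, e ∉ A → c e = part M.inc Aᶜ e := fun h => by simp [c, h]
  have self : ∀ e, e ∈ c e := by
    intro e
    by_cases h : e ∈ A
    · by_cases h' : φ e = t
      · rw [c1 h h']; rfl
      · rw [c2 h h']; exact mem_part_self e
    · rw [c3 h]; exact mem_part_self e
  have hmem : ∀ {e e'}, e' ∈ c e → c e' = c e := by
    intro e e' he
    by_cases h : e ∈ A
    · by_cases h' : φ e = t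
      · rw [c1 h h'] at he
        rw [he]
      · rw [c2 h h'] at he
        obtain ⟨h1, h2⟩ := part_subset (A := beyond T φ t (next T t (φ e))) ⟨h', rfl⟩ he
        rw [c2 h h', c2 ((hA e h h').1 he) h1, h2, part_eq_of_mem he]
    · rw [c3 h] at he
      rw [c3 h, c3 (part_subset (A := Aᶜ) h he), part_eq_of_mem he]
  have heq : ∀ e, {e' | c e' = c e} = c e := fun e =>
    ext fun e' => ⟨fun h => by have := self e'; rwa [h] at this, hmem⟩
  have hcW : ∀ e ∈ W, c e ⊆ W := by
    intro e he
    by_cases h : e ∈ A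
    · by_cases h' : φ e = t
      · rw [c1 h h']; exact singleton_subset_iff.2 he
      · rw [c2 h h']; exact (hA e h h').1.trans hAW
    · rw [c3 h]; exact (hs e he h).1
  refine M.dec_of_colouring _ c W rfl hW hW' hWc hWc' (fun e he e' h => ?_) (fun e he => ?_)
    ((ncard_le_ncard ?_ (toFinite _)).trans hK)
  · refine hcW e he ?_
    rw [← h]
    exact self e'
  · rw [heq]
    by_cases h : e ∈ A
    · by_cases h' : φ e = t
      · rw [c1 h h']; exact M.good_singleton K e
      · rw [c2 h h']; exact (hA e h h').2
    · rw [c3 h]; exact (hs e he h).2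
  · rintro v ⟨e, he, e', he', heW, h⟩
    by_contra hv
    have ht : ∀ a ∈ M.star v, φ a ≠ t := fun a ha hat => hv (hat ▸ hφ v a ha)
    have hnext : ∀ a ∈ M.star v, ∀ b ∈ M.star v, next T t (φ a) = next T t (φ b) :=
      fun a ha b hb => next_eq_of_connected hT (hX v) hv (hφ v a ha) (hφ v b hb)
    have hstar : ∀ b ∈ M.star v, M.star v ⊆ part M.inc (beyond T φ t (next T t (φ b))) b :=
      fun b hb => (M.faceConn_star v).subset_part
      (A := beyond T φ t (next T t (φ b))) (fun a ha => ⟨ht a ha, hnext a ha b hb⟩) hb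
        (mem_part_self b)
    have hce : e' ∈ c e := by
      by_cases hA' : e ∈ A
      · rw [c2 hA' (ht e he)]
        exact hstar e he he'
      · rw [c3 hA']
        refine (M.faceConn_star v).subset_part (A := Aᶜ) (fun a ha haA => hA' ?_) he (mem_part_self e) he'
        exact (hA a haA (ht a ha)).1 (hstar a ha he)
    exact h.elim (fun h => h (hcW e heW hce)) fun h => h (hmem hce).symm

lemma good_part_beyond (hT : T.IsTree) (hX : ∀ v, (T.induce {i | v ∈ X i}).Connected)
    (hφ : ∀ v, ∀ e ∈ M.star v, v ∈ X (φ e)) {K : ℕ} (hK : ∀ t, (X t).ncard ≤ K) (n : ℕ) :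
    ∀ {s t : ι} {e : E}, T.Adj s t → e ∈ beyond T φ s t →
      (∀ a ∈ part M.inc (beyond T φ s t) e, T.dist t (φ a) ≤ n) →
      M.Good K (part M.inc (beyond T φ s t) e) := by
  induction n using Nat.strong_induction_on with
  | h n ih =>
  intro s t e hst he hn
  have hsub : ∀ a ∈ part M.inc (beyond T φ s t) e, φ a ≠ t →
      part M.inc (beyond T φ t (next T t (φ a))) a ⊆ part M.inc (beyond T φ s t) e := by
    intro a ha hat
    obtain ⟨h1, h2⟩ := part_subset he ha
    refine (faceConn_part _ _).subset_part (fun b hb => ?_) (mem_part_self a) ha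
    obtain ⟨-, h4⟩ := part_subset (A := beyond T φ t (next T t (φ a))) ⟨hat, rfl⟩ hb
    exact next_eq_of_next hT hst h1 h2 hat h4
  refine ⟨faceConn_part _ _, fun y hy hz => ?_⟩
  have hyc := M.faceConn_univ.compl_part (faceConn_part (inc := M.inc) (beyond T φ s t) e)
    ⟨e, mem_part_self e⟩ (y := y)
  refine M.dec_of_node hT hX hφ (hK t) (A := part M.inc (beyond T φ s t) e)
    ⟨e, fun h => part_subset (A := (part M.inc (beyond T φ s t) e)ᶜ) hy h (mem_part_self e)⟩
    ⟨y, by rw [compl_compl]; exact mem_part_self y⟩ (hyc hy)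
    (by rw [compl_compl]; exact faceConn_part _ _)
    (fun a ha h => part_subset (A := (part M.inc (beyond T φ s t) e)ᶜ) hy h ha)
    (fun a ha hat => ⟨hsub a ha hat, ?_⟩) fun a ha haA => ⟨fun b hb hb' => ?_, ?_⟩
  · obtain ⟨h1, h2⟩ := next_spec hT hat
    have hna := hn a ha
    refine ih (n - 1) (by omega) h1 ⟨hat, rfl⟩ fun b hb => ?_
    obtain ⟨h3, h4⟩ := part_subset (A := beyond T φ t (next T t (φ a))) ⟨hat, rfl⟩ hb
    have := hn b (hsub a ha hat hb)
    have h5 := (next_spec hT h3).2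
    rw [h4] at h5
    omega
  · exact ha (Link.trans hb' (Link.symm hb))
  · exact (hz a haA ha).good (faceConn_part _ _) (M.faceConn_univ.compl_part (faceConn_part _ _)
      ⟨e, mem_part_self e⟩ haA)

/-- A tree decomposition gives a decomposition of the complement of an edge. -/
lemma dec_compl_singleton (hT : T.IsTree) (hX : ∀ v, (T.induce {i | v ∈ X i}).Connected)
    (hφ : ∀ v, ∀ e ∈ M.star v, v ∈ X (φ e)) {K : ℕ} (hK : ∀ t, (X t).ncard ≤ K) (e₀ : E)
    (hne : ({e₀}ᶜ : Set E).Nonempty) : M.Dec K {e₀}ᶜ := by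
  have hb : ∀ (s t : ι), ∃ n, ∀ a ∈ beyond T φ s t, T.dist t (φ a) ≤ n := fun s t => by
    obtain ⟨n, hn⟩ := ((toFinite (beyond T φ s t)).image fun a => T.dist t (φ a)).bddAbove
    exact ⟨n, fun a ha => hn ⟨a, ha, rfl⟩⟩
  refine M.dec_of_node hT hX hφ (hK (φ e₀)) (A := {e₀}ᶜ) hne (by simp) (M.faceConn_compl e₀)
    (by rw [compl_compl]; exact M.faceConn_singleton e₀) Subset.rfl (fun a _ hat => ⟨?_, ?_⟩)
    fun a ha ha' => absurd ha ha'
  · intro b hb h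
    rw [mem_singleton_iff.1 h] at hb
    exact (part_subset (A := beyond T φ (φ e₀) (next T (φ e₀) (φ a))) ⟨hat, rfl⟩ hb).1 rfl
  · obtain ⟨n, hn⟩ := hb (φ e₀) (next T (φ e₀) (φ a))
    exact M.good_part_beyond hT hX hφ hK n (next_spec hT hat).1 ⟨hat, rfl⟩ fun b hb =>
      hn b (part_subset (A := beyond T φ (φ e₀) (next T (φ e₀) (φ a))) ⟨hat, rfl⟩ hb)

end PlaneMap

namespace PlaneMap

variable {V E Φ : Type} [Finite V] [Finite E] [Finite Φ] (M : PlaneMap V E Φ)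

lemma finrank_Zd_add (X : Set E) : Module.finrank ℚ (M.Zd X) + Nat.card V =
    1 + Xᶜ.ncard + Module.finrank ℚ (M.Z Xᶜ) := M.euler X

lemma ncard_faces_singleton_le (e : E) : {f | M.inc e f}.ncard ≤ 2 := by
  have h1 := M.euler_univ
  have h2 := M.finrank_Zd_add {e}
  have h3 : Module.finrank ℚ (M.Zd {e}) + _ ≤ _ := finrank_cutFree_add_le (M.faceConn_singleton e)
  have h4 : Module.finrank ℚ (M.Z univ) ≤ Module.finrank ℚ (M.Z {e}ᶜ) :=
    Submodule.finrank_mono (M.Z_anti (subset_univ _))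
  have h5 := ncard_add_ncard_compl ({e} : Set E)
  rw [ncard_singleton] at h5
  simp only [mem_singleton_iff, exists_eq_left] at h3
  omega

lemma exists_Z_compl_singleton {e : E} {O : Φ} (he : ∀ f, M.inc e f → f = O) :
    ∃ φ ∈ M.Z {e}ᶜ, φ (M.fst e) ≠ φ (M.snd e) := by
  have := Fintype.ofFinite Φ
  by_contra! h
  have h1 := M.euler_univ
  have h2 := M.finrank_Zd_add {e}
  have h0 : M.Zd {e} = ⊤ := by
    refine eq_top_iff.2 fun φ _ d hd f f' hf hf' => ?_
    rw [mem_singleton_iff.1 hd] at hf hf'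
    rw [he f hf, he f' hf']
  have h4 : Module.finrank ℚ (M.Z {e}ᶜ) ≤ Module.finrank ℚ (M.Z univ) :=
    Submodule.finrank_mono fun φ hφ d _ => by
      by_cases hd : d = e
      · rw [hd]; exact h φ hφ
      · exact hφ d hd
  have h5 := ncard_add_ncard_compl ({e} : Set E)
  rw [ncard_singleton] at h5
  rw [h0, finrank_top, Module.finrank_fintype_fun_eq_card, ← Nat.card_eq_fintype_card] at h2
  omega

/-- The faces other than `O` are connected through edges. -/
def WeakConn (O : Φ) : Prop := ∀ S : Set Φ, S.Nonempty → O ∉ S → (∃ f ∉ S, f ≠ O) →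
  ∃ e f g, M.inc e f ∧ M.inc e g ∧ f ∈ S ∧ g ∉ S ∧ g ≠ O

variable {M} {O : Φ}

lemma WeakConn.finrank_le (h : M.WeakConn O) {A : Set E} (hA : ∀ e, ¬ M.inc e O → e ∈ A) :
    Module.finrank ℚ (M.Zd A) ≤ 2 := by
  have hle : M.Zd A ≤ constOn {f | f ≠ O} := by
    intro φ hφ x hx y hy
    by_contra hne
    obtain ⟨e, f, g, hf, hg, ⟨hfO, hfx⟩, hgx, hgO⟩ := h {f | f ≠ O ∧ φ f = φ x} ⟨x, hx, rfl⟩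
      (fun h => h.1 rfl) ⟨y, fun h => hne h.2.symm, hy⟩
    have hfg : φ f ≠ φ g := fun h => hgx ⟨hgO, h.symm.trans hfx⟩
    refine hfg (hφ e (hA e fun hO => ?_) _ _ hf hg)
    have h3 : ({f, g, O} : Set Φ) ⊆ {f | M.inc e f} := by
      rintro _ (rfl | rfl | rfl) <;> assumption
    have h4 := (ncard_le_ncard h3 (toFinite _)).trans (M.ncard_faces_singleton_le e)
    rw [ncard_insert_of_notMem (by
      rintro (rfl | h)
      · exact hfg rfl
      · exact hfO h), ncard_pair hgO] at h4
    omega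
  refine (Submodule.finrank_mono hle).trans ?_
  rcases ({f | f ≠ O} : Set Φ).eq_empty_or_nonempty with h0 | h0
  · have h1 : Nat.card Φ ≤ 1 := by
      rw [← ncard_univ, ncard_le_one]
      intro a _ b _
      have : ∀ a, a = O := fun a => by
        by_contra h
        exact h0.subset h
      rw [this a, this b]
    have := Fintype.ofFinite Φ
    have := (constOn ({f | f ≠ O} : Set Φ)).finrank_le
    rw [Module.finrank_fintype_fun_eq_card, ← Nat.card_eq_fintype_card] at this
    omega
  · have h1 := finrank_constOn h0
    have h2 := ncard_add_ncard_compl ({O} : Set Φ)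
    rw [ncard_singleton] at h2
    have h3 : ({f | f ≠ O} : Set Φ) = {O}ᶜ := rfl
    rw [h3] at h1 ⊢
    omega

/-- No cut vertex separates two edges incident both to `O` and to another face. -/
lemma WeakConn.not_separated (h : M.WeakConn O) {X : Set V} {u : V}
    (hX : ∀ e, (M.fst e ∈ X ∨ M.snd e ∈ X) → (M.fst e ∈ X ∨ M.fst e = u) ∧ (M.snd e ∈ X ∨ M.snd e = u))
    {a b : E} (ha : M.fst a ∈ X ∨ M.snd a ∈ X) (hb : ¬ (M.fst b ∈ X ∨ M.snd b ∈ X))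
    (haO : M.inc a O) (hbO : M.inc b O) (ha' : ∃ f ≠ O, M.inc a f) (hb' : ∃ f ≠ O, M.inc b f) :
    False := by
  classical
  have := Fintype.ofFinite V
  have := Fintype.ofFinite Φ
  set A : Set E := {e | M.fst e ∈ X ∨ M.snd e ∈ X} with hA
  have h1 := M.finrank_Zd_add A
  have h2 := M.finrank_Zd_add Aᶜ
  rw [compl_compl] at h2
  have h3 := M.euler_univ
  have h4 := ncard_add_ncard_compl A
  have h5 := Submodule.finrank_sup_add_finrank_inf_eq (M.Z A) (M.Z Aᶜ)
  have h6 : Nat.card V ≤ Module.finrank ℚ ↥(M.Z A ⊔ M.Z Aᶜ) := by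
    have h7 : constOn {u} ≤ M.Z A ⊔ M.Z Aᶜ := by
      refine constOn_le (fun a => Submodule.mem_sup_left (M.const_mem_Z _ a)) fun v hv => ?_
      by_cases hvX : v ∈ X
      · refine Submodule.mem_sup_right (M.single_mem_Z fun e he hev => he ?_)
        rcases hev with rfl | rfl
        · exact .inl hvX
        · exact .inr hvX
      · refine Submodule.mem_sup_left (M.single_mem_Z fun e he hev => ?_)
        obtain ⟨h8, h9⟩ := hX e he
        rcases hev with rfl | rfl
        · exact h8.elim hvX hv
        · exact h9.elim hvX hv
    have h8 := finrank_constOn (singleton_nonempty u)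
    rw [ncard_singleton] at h8
    have := Submodule.finrank_mono h7
    omega
  have h7 : Module.finrank ℚ (M.Z univ) ≤ Module.finrank ℚ ↥(M.Z A ⊓ M.Z Aᶜ) :=
    Submodule.finrank_mono (le_inf (M.Z_anti (subset_univ _)) (M.Z_anti (subset_univ _)))
  have key : ∀ (B : Set E) (a : E), a ∈ B → M.inc a O → (∃ f ≠ O, M.inc a f) →
      Module.finrank ℚ (M.Zd B) + 1 ≤ Module.finrank ℚ (M.Zd {e | e ∈ B ∧ ¬ M.inc e O}) := by
    rintro B a ha haO ⟨f, hf, haf⟩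
    refine Submodule.finrank_lt_finrank_of_lt (lt_of_le_of_ne (M.Zd_anti fun _ h => h.1) fun h => ?_)
    have h8 : (Pi.single O 1 : Φ → ℚ) ∈ M.Zd {e | e ∈ B ∧ ¬ M.inc e O} := by
      rintro e ⟨-, he⟩ f f' hf hf'
      rw [Pi.single_eq_of_ne (fun h => he (by rwa [← h])),
        Pi.single_eq_of_ne (fun h => he (by rwa [← h]))]
    rw [← h] at h8
    have := h8 a ha O f haO haf
    rw [Pi.single_eq_same, Pi.single_eq_of_ne hf] at this
    exact one_ne_zero this
  have h8 := key A a ha haO ha'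
  have h9 := key Aᶜ b hb hbO hb'
  have h10 := Submodule.finrank_sup_add_finrank_inf_eq (M.Zd {e | e ∈ A ∧ ¬ M.inc e O})
    (M.Zd {e | e ∈ Aᶜ ∧ ¬ M.inc e O})
  have h11 := (M.Zd {e | e ∈ A ∧ ¬ M.inc e O} ⊔ M.Zd {e | e ∈ Aᶜ ∧ ¬ M.inc e O}).finrank_le
  rw [Module.finrank_fintype_fun_eq_card, ← Nat.card_eq_fintype_card] at h11
  have h12 : Module.finrank ℚ
      ↥(M.Zd {e | e ∈ A ∧ ¬ M.inc e O} ⊓ M.Zd {e | e ∈ Aᶜ ∧ ¬ M.inc e O}) ≤ 2 := by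
    refine (Submodule.finrank_mono (t := M.Zd {e | ¬ M.inc e O}) fun φ hφ e he => ?_).trans
      (h.finrank_le fun e he => he)
    by_cases heA : e ∈ A
    · exact hφ.1 e ⟨heA, he⟩
    · exact hφ.2 e ⟨heA, he⟩
  omega

/-- The faces around a vertex, other than `O`, are connected through edges. -/
lemma WeakConn.conn_vinc (h : M.WeakConn O) {u : V} {S T : Set Φ} (hS : S.Nonempty) (hT : T.Nonempty)
    (hd : Disjoint S T) (hST : ∀ f, M.vinc u f → f ≠ O → f ∈ S ∨ f ∈ T)
    (hSu : ∀ f ∈ S, M.vinc u f ∧ f ≠ O) (hTu : ∀ f ∈ T, M.vinc u f ∧ f ≠ O) :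
    ∃ e, ∃ f ∈ S, ∃ g ∈ T, M.inc e f ∧ M.inc e g := by
  classical
  have := Fintype.ofFinite V
  have := Fintype.ofFinite Φ
  by_contra! hno
  obtain ⟨s, hs⟩ := hS
  obtain ⟨t, ht⟩ := hT
  have hst : ∀ f, f ∈ S → f ∉ T := fun _ h => disjoint_left.1 hd h
  by_cases hiso : ∀ e, e ∉ M.star u
  · exact hst s hs (by rwa [M.eq_of_isolated hiso (hSu s hs).1 (hTu t ht).1])
  push Not at hiso
  obtain ⟨e₀, he₀⟩ := hiso
  set A : Set E := {e | e ∈ M.star u ∧ ∃ f ∈ S, M.inc e f} with hA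
  set B : Set E := M.star u \ A with hB
  have hshare : ∀ a ∈ A, ∀ b ∈ B, ∀ f, M.inc a f → M.inc b f → f = O := by
    rintro a ⟨ha, g, hg, hag⟩ b ⟨hb, hbA⟩ f haf hbf
    by_contra hf
    rcases hST f (M.vinc_of_inc ha haf) hf with h | h
    · exact hbA ⟨hb, f, h, hbf⟩
    · exact hno a g hg f h hag haf
  have hAn : A.Nonempty := by
    obtain ⟨a, ha, has⟩ := M.exists_inc_of_vinc he₀ (hSu s hs).1
    exact ⟨a, ha, s, hs, has⟩
  have hBT : ∀ b ∈ M.star u, (∃ f ∈ T, M.inc b f) → b ∈ B := fun b hb ⟨f, hf, hbf⟩ =>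
    ⟨hb, fun ⟨_, g, hg, hbg⟩ => hno b g hg f hf hbg hbf⟩
  have hBn : ∃ b ∈ M.star u, ∃ f ∈ T, M.inc b f := by
    obtain ⟨b, hb, hbt⟩ := M.exists_inc_of_vinc he₀ (hTu t ht).1
    exact ⟨b, hb, t, ht, hbt⟩
  obtain ⟨a, haA, b₀, hb₀, f₀, haf₀, hbf₀⟩ := M.faceConn_star u A (fun _ h => h.1) hAn
    (hBn.imp fun b hb => hBT b hb.1 hb.2)
  have haO : M.inc a O := by rwa [hshare a haA b₀ hb₀ f₀ haf₀ hbf₀] at haf₀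
  obtain ⟨b, ⟨hb, f₁, hf₁, hbf₁⟩, a', ⟨ha', ha''⟩, f₂, hbf₂, haf₂⟩ := M.faceConn_star u
    {b | b ∈ M.star u ∧ ∃ f ∈ T, M.inc b f} (fun _ h => h.1) hBn ⟨a, haA.1, fun h =>
      (hBT a haA.1 h.2).2 haA⟩
  have hbO : M.inc b O := by
    suffices f₂ = O by rwa [this] at hbf₂
    by_contra hf
    rcases hST f₂ (M.vinc_of_inc hb hbf₂) hf with h | h
    · exact hno b f₂ h f₁ hf₁ hbf₂ hbf₁
    · exact ha'' ⟨ha', f₂, h, haf₂⟩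
  have hbB : b ∈ B := hBT b hb ⟨f₁, hf₁, hbf₁⟩
  -- the indicator function of `u` splits
  have hle : M.Z (M.star u)ᶜ ≤ M.Z Aᶜ ⊔ M.Z Bᶜ := by
    have h1 := M.finrank_Zd_add A
    have h2 := M.finrank_Zd_add B
    have h3 := M.finrank_Zd_add (M.star u)
    have h4 := M.euler_univ
    have h5 := ncard_add_ncard_compl A
    have h6 := ncard_add_ncard_compl B
    have h7 := ncard_add_ncard_compl (M.star u)
    have h8 : A.ncard + B.ncard = (M.star u).ncard := by
      rw [hB, ncard_sdiff (fun _ h => h.1)]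
      have := ncard_le_ncard (s := A) (t := M.star u) (fun _ h => h.1) (toFinite _)
      omega
    have h9 := Submodule.finrank_sup_add_finrank_inf_eq (M.Zd A) (M.Zd B)
    have h10 := Submodule.finrank_sup_add_finrank_inf_eq (M.Z Aᶜ) (M.Z Bᶜ)
    have h11 : Module.finrank ℚ ↥(M.Zd A ⊔ M.Zd B) = Nat.card Φ := by
      have hle : constOn {O} ≤ M.Zd A ⊔ M.Zd B := by
        refine constOn_le (fun a => Submodule.mem_sup_left fun _ _ _ _ _ _ => rfl) fun f hf => ?_
        have hsingle : ∀ C : Set E, (∀ e ∈ C, ¬ M.inc e f) → (Pi.single f 1 : Φ → ℚ) ∈ M.Zd C := by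
          intro C hC e he g g' hg hg'
          rw [Pi.single_eq_of_ne (fun h => hC e he (by rwa [← h])),
            Pi.single_eq_of_ne (fun h => hC e he (by rwa [← h]))]
        by_cases hfA : ∃ a ∈ A, M.inc a f
        · obtain ⟨a, ha, haf⟩ := hfA
          exact Submodule.mem_sup_right (hsingle B fun e he hef => hf (hshare a ha e he f haf hef))
        · push Not at hfA
          exact Submodule.mem_sup_left (hsingle A hfA)
      have h12 := finrank_constOn (singleton_nonempty O)
      rw [ncard_singleton] at h12
      have h13 := Submodule.finrank_mono hle
      have h14 := (M.Zd A ⊔ M.Zd B).finrank_le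
      rw [Module.finrank_fintype_fun_eq_card, ← Nat.card_eq_fintype_card] at h14
      omega
    have h12 : Module.finrank ℚ ↥(M.Zd A ⊓ M.Zd B) = Module.finrank ℚ (M.Zd (M.star u)) := by
      refine congrArg (fun N : Submodule ℚ (Φ → ℚ) => Module.finrank ℚ N) ?_
      refine le_antisymm (fun φ hφ e he => ?_)
        (le_inf (M.Zd_anti fun _ h => h.1) (M.Zd_anti fun _ h => h.1))
      by_cases heA : e ∈ A
      · exact hφ.1 e heA
      · exact hφ.2 e ⟨he, heA⟩
    have h13 : Module.finrank ℚ ↥(M.Z Aᶜ ⊓ M.Z Bᶜ) = Module.finrank ℚ (M.Z univ) := by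
      refine congrArg (fun N : Submodule ℚ (V → ℚ) => Module.finrank ℚ N) ?_
      refine le_antisymm (fun φ hφ e _ => ?_)
        (le_inf (M.Z_anti (subset_univ _)) (M.Z_anti (subset_univ _)))
      by_cases heA : e ∈ A
      · exact hφ.2 e fun h => h.2 heA
      · exact hφ.1 e heA
    refine (Submodule.eq_of_le_of_finrank_le (sup_le (M.Z_anti ?_) (M.Z_anti ?_)) ?_).ge
    · exact compl_subset_compl.2 fun _ h => h.1
    · exact compl_subset_compl.2 fun _ h => h.1
    · omega
  obtain ⟨φ, hφ, ψ, hψ, hφψ⟩ := Submodule.mem_sup.1 (hle (M.single_mem_Z (v := u) fun e he h => he h))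
  have hval : ∀ w, φ w + ψ w = (Pi.single u 1 : V → ℚ) w := fun w => congrFun hφψ w
  have hu : φ u + ψ u = 1 := by rw [hval, Pi.single_eq_same]
  have hw : ∀ w, w ≠ u → φ w + ψ w = 0 := fun w hw => by rw [hval, Pi.single_eq_of_ne hw]
  have hAe : ∀ e ∈ A, ψ (M.fst e) = ψ (M.snd e) := fun e he => hψ e fun h => h.2 he
  have hAX : ∀ e ∈ A, ∀ w, w ≠ u → ψ w = ψ u → φ w = φ u - 1 := fun e _ w hwu h => by
    linarith [hw w hwu]
  have hne : ∀ e ∈ M.star u, ∃ w, w ≠ u ∧ (M.fst e = u ∧ M.snd e = w ∨ M.fst e = w ∧ M.snd e = u) := by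
    rintro e (he | he)
    · exact ⟨M.snd e, fun h => M.fst_ne_snd e (he.trans h.symm), .inl ⟨he, rfl⟩⟩
    · exact ⟨M.fst e, fun h => M.fst_ne_snd e (h.trans he.symm), .inr ⟨rfl, he⟩⟩
  have hAtouch : ∀ e ∈ A, ∃ w, (w ≠ u ∧ φ w = φ u - 1) ∧
      (M.fst e = u ∧ M.snd e = w ∨ M.fst e = w ∧ M.snd e = u) := by
    intro e he
    obtain ⟨w, hwu, hew⟩ := hne e he.1
    refine ⟨w, ⟨hwu, hAX e he w hwu ?_⟩, hew⟩
    have := hAe e he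
    rcases hew with ⟨h1, h2⟩ | ⟨h1, h2⟩ <;> rw [h1, h2] at this
    · exact this.symm
    · exact this
  have hBtouch : ∀ e ∈ B, ¬ (M.fst e ∈ {w | w ≠ u ∧ φ w = φ u - 1} ∨
      M.snd e ∈ {w | w ≠ u ∧ φ w = φ u - 1}) := by
    intro e he h'
    obtain ⟨w, hwu, hew⟩ := hne e he.1
    have h1 := hφ e he.2
    rcases hew with ⟨h2, h3⟩ | ⟨h2, h3⟩ <;> rw [h2, h3] at h1 <;> rw [h2, h3] at h' <;>
      rcases h' with h' | h'
    · exact h'.1 rfl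
    · linarith [h'.2]
    · linarith [h'.2]
    · exact h'.1 rfl
  refine h.not_separated (X := {w | w ≠ u ∧ φ w = φ u - 1}) (u := u) (a := a)
    (b := b) (fun e he => ?_) ?_ (hBtouch b hbB) haO hbO ?_ ⟨f₁, (hTu f₁ hf₁).2, hbf₁⟩
  · by_cases heA : e ∈ A
    · obtain ⟨w, hw, hew⟩ := hAtouch e heA
      rcases hew with ⟨h2, h3⟩ | ⟨h2, h3⟩ <;> rw [h2, h3]
      · exact ⟨.inr rfl, .inl hw⟩
      · exact ⟨.inl hw, .inr rfl⟩
    · by_cases heu : e ∈ M.star u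
      · exact absurd he (hBtouch e ⟨heu, heA⟩)
      · have h1 := hφ e heA
        simp only [star, mem_ofPred_eq, not_or] at heu
        rcases he with he | he
        · exact ⟨.inl he, .inl ⟨heu.2, h1 ▸ he.2⟩⟩
        · exact ⟨.inl ⟨heu.1, h1 ▸ he.2⟩, .inl he⟩
  · obtain ⟨w, hw, hew⟩ := hAtouch a haA
    rcases hew with ⟨h2, h3⟩ | ⟨h2, h3⟩ <;> rw [h2, h3]
    · exact .inr hw
    · exact .inl hw
  · obtain ⟨-, g, hg, hag⟩ := haA
    exact ⟨g, (hSu g hg).2, hag⟩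

/-- At a vertex with an edge incident only to `O` and on another face, some edge is incident to `O`
and another face. -/
lemma exists_mixed_edge {v : V} {e : E} (he : e ∈ M.star v) (heO : M.inc e O) {f : Φ} (hf : f ≠ O)
    (hvf : M.vinc v f) : ∃ a ∈ M.star v, M.inc a O ∧ ∃ g ≠ O, M.inc a g := by
  by_contra! h
  obtain ⟨b, hb, hbf⟩ := M.exists_inc_of_vinc he hvf
  obtain ⟨a, ⟨ha, haO⟩, c, ⟨hc, hcO⟩, g, hag, hcg⟩ := M.faceConn_star v
    {a | a ∈ M.star v ∧ M.inc a O} (fun _ h => h.1) ⟨e, he, heO⟩ ⟨b, hb, fun h' => h b hb h'.2 f hf hbf⟩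
  by_cases hg : g = O
  · exact hcO ⟨hc, hg ▸ hcg⟩
  · exact h a ha haO g hg hag

/-- The vertices on a face other than `O`. -/
def inner (M : PlaneMap V E Φ) (O : Φ) : Set V := {v | ∃ f ≠ O, M.vinc v f}

lemma only_of_notMem_inner {v : V} (hv : v ∉ M.inner O) {e : E} (he : e ∈ M.star v) (f : Φ)
    (hf : M.inc e f) : f = O := by
  by_contra h
  exact hv ⟨f, h, M.vinc_of_inc he hf⟩

/-- An edge incident only to `O` does not separate inner vertices with further such edges. -/
lemma WeakConn.exists_side (h : M.WeakConn O) {e : E} (he : ∀ f, M.inc e f → f = O) {φ : V → ℚ}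
    (hφ : φ ∈ M.Z {e}ᶜ) {p q : V} (hpq : M.fst e = p ∧ M.snd e = q) (hne : φ p ≠ φ q)
    {x y : V} (hx : x ∈ M.inner O) (hy : y ∈ M.inner O) (hx' : ∃ a ∈ M.star x, M.inc a O)
    (hy' : ∃ a ∈ M.star y, M.inc a O) (hxp : φ x ≠ φ q) (hyq : φ y = φ q) : False := by
  obtain ⟨rfl, rfl⟩ := hpq
  obtain ⟨f, hf, hxf⟩ := hx
  obtain ⟨g, hg, hyg⟩ := hy
  obtain ⟨a, ha, haO⟩ := hx'
  obtain ⟨b, hb, hbO⟩ := hy'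
  obtain ⟨a', ha', haO', fa, hfa, haf⟩ := exists_mixed_edge ha haO hf hxf
  obtain ⟨b', hb', hbO', fb, hfb, hbf⟩ := exists_mixed_edge hb hbO hg hyg
  refine h.not_separated (X := {v | φ v ≠ φ (M.snd e)}) (u := M.snd e)
    (a := a') (b := b') (fun d hd => ?_) ?_ ?_ haO' hbO' ⟨fa, hfa, haf⟩ ⟨fb, hfb, hbf⟩
  · by_cases hde : d = e
    · subst hde
      exact ⟨.inl hne, .inr rfl⟩
    · have := hφ d hde
      rcases hd with hd | hd
      · exact ⟨.inl hd, .inl fun h => hd (this.trans h)⟩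
      · exact ⟨.inl fun h => hd (this.symm.trans h), .inl hd⟩
  · rcases ha' with rfl | rfl
    · exact .inl hxp
    · exact .inr hxp
  · have hbe : b' ≠ e := by
      rintro rfl
      exact hfb (he fb hbf)
    have := hφ b' hbe
    simp only [mem_ofPred_eq, not_or, not_not]
    rcases hb' with rfl | rfl
    · exact ⟨hyq, this.symm.trans hyq⟩
    · exact ⟨this.trans hyq, hyq⟩

/-- In a set with at most one boundary edge, some vertex has at most one edge. -/
lemma exists_leaf_of_cut {S : Set V} (n : ℕ) : ∀ Y : Set V, Y.ncard = n → Y.Nonempty → Y ⊆ S →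
    Disjoint Y (M.inner O) →
    (∀ e e', M.fst e ∈ S → M.snd e ∈ S → M.fst e' ∈ S → M.snd e' ∈ S →
      ¬ (M.fst e ∈ Y ↔ M.snd e ∈ Y) → ¬ (M.fst e' ∈ Y ↔ M.snd e' ∈ Y) → e = e') →
    ∃ v ∈ Y, ∀ e ∈ M.star v, ∀ e' ∈ M.star v, M.fst e ∈ S → M.snd e ∈ S → M.fst e' ∈ S →
      M.snd e' ∈ S → e = e' := by
  induction n using Nat.strong_induction_on with
  | h n ih =>
  intro Y hn hY hYS hd hc
  subst hn
  by_cases hin : ∃ e, M.fst e ∈ Y ∧ M.snd e ∈ Y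
  · obtain ⟨e, h1, h2⟩ := hin
    obtain ⟨φ, hφ, hne⟩ := M.exists_Z_compl_singleton (e := e) (O := O)
      (only_of_notMem_inner (disjoint_left.1 hd h1) (.inl rfl))
    have hd' : ∀ d, d ≠ e → φ (M.fst d) = φ (M.snd d) := fun d hde => hφ d hde
    have key : ∀ P : V → Prop, (∀ d, d ≠ e → (P (M.fst d) ↔ P (M.snd d))) → (∃ v ∈ Y, P v) →
        (∃ v ∈ Y, ¬ P v) → (∀ d, M.fst d ∈ S → M.snd d ∈ S →
          ¬ (M.fst d ∈ {v | v ∈ Y ∧ P v} ↔ M.snd d ∈ {v | v ∈ Y ∧ P v}) → d = e) →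
        ∃ v ∈ Y, ∀ e ∈ M.star v, ∀ e' ∈ M.star v, M.fst e ∈ S → M.snd e ∈ S → M.fst e' ∈ S →
          M.snd e' ∈ S → e = e' := by
      rintro P - ⟨v, hv, hPv⟩ ⟨w, hw, hPw⟩ hP
      obtain ⟨z, hz, hz'⟩ := ih _ (ncard_lt_ncard (s := {v | v ∈ Y ∧ P v}) (t := Y)
        ⟨fun _ h => h.1, fun h => hPw (h hw).2⟩ (toFinite _)) _ rfl ⟨v, hv, hPv⟩
        (fun _ h => hYS h.1) (hd.mono_left fun _ h => h.1) fun d d' h1 h2 h3 h4 h5 h6 =>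
          (hP d h1 h2 h5).trans (hP d' h3 h4 h6).symm
      exact ⟨z, hz.1, hz'⟩
    by_cases hcase : ∃ d, d ≠ e ∧ M.fst d ∈ S ∧ M.snd d ∈ S ∧
        ¬ (M.fst d ∈ {v | v ∈ Y ∧ φ v = φ (M.fst e)} ↔ M.snd d ∈ {v | v ∈ Y ∧ φ v = φ (M.fst e)})
    · obtain ⟨d, hde, hd1, hd2, hdc⟩ := hcase
      refine key (fun v => φ v ≠ φ (M.fst e)) (fun d hde => by rw [hd' d hde]) ⟨_, h2, hne.symm⟩
        ⟨_, h1, fun h => h rfl⟩ fun d' hd1' hd2' hdc' => ?_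
      by_contra hde'
      have e1 := hd' d hde
      have e2 := hd' d' hde'
      have : d = d' := by
        refine hc d d' hd1 hd2 hd1' hd2' (fun h => hdc ?_) fun h => hdc' ?_
        · simp only [mem_ofPred_eq, h, e1]
        · simp only [mem_ofPred_eq, h, e2]
      subst this
      simp only [mem_ofPred_eq, e1] at hdc hdc'
      by_cases hP : φ (M.snd d) = φ (M.fst e) <;> simp [hP] at hdc hdc'
    · push Not at hcase
      refine key (fun v => φ v = φ (M.fst e)) (fun d hde => by rw [hd' d hde]) ⟨_, h1, rfl⟩
        ⟨_, h2, hne.symm⟩ fun d hd1 hd2 hdc => ?_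
      by_contra hde
      exact hdc (hcase d hde hd1 hd2)
  · obtain ⟨v, hv⟩ := hY
    have hcr : ∀ e ∈ M.star v, ¬ (M.fst e ∈ Y ↔ M.snd e ∈ Y) := by
      rintro e (rfl | rfl) h
      · exact hin ⟨e, hv, h.1 hv⟩
      · exact hin ⟨e, h.2 hv, hv⟩
    exact ⟨v, hv, fun e he e' he' h1 h2 h3 h4 => hc e e' h1 h2 h3 h4 (hcr e he) (hcr e' he')⟩

/-- Beyond the inner vertices, the graph can be built up by adding leaves. -/
lemma WeakConn.exists_leaf (h : M.WeakConn O) {S : Set V} (hS : M.inner O ⊂ S) :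
    ∃ v ∈ S, v ∉ M.inner O ∧ ∀ e ∈ M.star v, ∀ e' ∈ M.star v, M.fst e ∈ S → M.snd e ∈ S →
      M.fst e' ∈ S → M.snd e' ∈ S → e = e' := by
  obtain ⟨-, v, hvS, hv⟩ := ssubset_iff_exists.1 hS
  by_cases hiso : ∃ e ∈ M.star v, M.fst e ∈ S ∧ M.snd e ∈ S
  · obtain ⟨e, hev, h1, h2⟩ := hiso
    have heO := only_of_notMem_inner hv hev
    obtain ⟨φ, hφ, hne⟩ := M.exists_Z_compl_singleton heO
    have hinc : ∃ f, M.inc e f := M.exists_inc e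
    have heO' : M.inc e O := by
      obtain ⟨f, hf⟩ := hinc
      rwa [heO f hf] at hf
    -- one of the two sides has no inner vertex with an edge incident only to `O`
    have key : ∀ P : V → Prop, (∀ d, d ≠ e → (P (M.fst d) ↔ P (M.snd d))) →
        (∃ v ∈ S, P v ∧ e ∈ M.star v) →
        (∀ v, P v → v ∈ M.inner O → ¬ ∃ d ∈ M.star v, ∀ f, M.inc d f → f = O) →
        ∃ v ∈ S, v ∉ M.inner O ∧ ∀ e ∈ M.star v, ∀ e' ∈ M.star v, M.fst e ∈ S → M.snd e ∈ S →
          M.fst e' ∈ S → M.snd e' ∈ S → e = e' := by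
      rintro P hP ⟨w, hwS, hw, hew⟩ hPin
      have hc : ∀ d, ¬ (M.fst d ∈ {v | v ∈ S ∧ P v ∧ ∃ d ∈ M.star v, ∀ f, M.inc d f → f = O} ↔
          M.snd d ∈ {v | v ∈ S ∧ P v ∧ ∃ d ∈ M.star v, ∀ f, M.inc d f → f = O}) →
          M.fst d ∈ S → M.snd d ∈ S → d = e := by
        intro d hdc hd1 hd2
        by_contra hde
        have hin : ∀ v, P v → (∃ d ∈ M.star v, ∀ f, M.inc d f → f = O) → v ∉ M.inner O :=
          fun v hv h h' => hPin v hv h' h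
        have hPd := hP d hde
        refine hdc ⟨fun h => ?_, fun h => ?_⟩
        · exact ⟨hd2, hPd.1 h.2.1, d, .inr rfl,
            only_of_notMem_inner (hin _ h.2.1 h.2.2) (.inl rfl)⟩
        · exact ⟨hd1, hPd.2 h.2.1, d, .inl rfl,
            only_of_notMem_inner (hin _ h.2.1 h.2.2) (.inr rfl)⟩
      obtain ⟨z, hz, hz'⟩ := exists_leaf_of_cut (M := M) (O := O) (S := S) _
        {v | v ∈ S ∧ P v ∧ ∃ d ∈ M.star v, ∀ f, M.inc d f → f = O} rfl ⟨w, hwS, hw, e, hew, heO⟩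
        (fun _ h => h.1) (disjoint_left.2 fun z hz hzi => hPin z hz.2.1 hzi hz.2.2)
        fun d d' h1 h2 h3 h4 h5 h6 => (hc d h5 h1 h2).trans (hc d' h6 h3 h4).symm
      exact ⟨z, hz.1, fun h => hPin z hz.2.1 h hz.2.2, hz'⟩
    have hO : ∀ z, (∃ d ∈ M.star z, ∀ f, M.inc d f → f = O) → ∃ d ∈ M.star z, M.inc d O := by
      rintro z ⟨d, hd, hdO⟩
      obtain ⟨f, hf⟩ := M.exists_inc d
      exact ⟨d, hd, hdO f hf ▸ hf⟩
    by_cases hside : ∃ z, φ z = φ (M.snd e) ∧ z ∈ M.inner O ∧ ∃ d ∈ M.star z, ∀ f, M.inc d f → f = O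
    · obtain ⟨z, hz, hzi, hzd⟩ := hside
      refine key (fun z => φ z ≠ φ (M.snd e)) (fun d hde => by rw [hφ d hde])
        ⟨M.fst e, h1, hne, .inl rfl⟩ fun x hx hxi hxd => ?_
      exact h.exists_side heO hφ ⟨rfl, rfl⟩ hne hxi hzi (hO x hxd) (hO z hzd) hx hz
    · push Not at hside
      refine key (fun z => φ z = φ (M.snd e)) (fun d hde => by rw [hφ d hde])
        ⟨M.snd e, h2, rfl, .inr rfl⟩ fun x hx hxi ⟨d, hd, hdf⟩ => ?_
      obtain ⟨f, hf, hfO⟩ := hside x hx hxi d hd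
      exact hfO (hdf f hf)
  · push Not at hiso
    exact ⟨v, hvS, hv, fun e he _ _ h1 h2 => absurd h2 (hiso e he h1)⟩

end PlaneMap

lemma reachable_of_adj {α β : Type} {G : SimpleGraph α} {H : SimpleGraph β} (f : α → β)
    (h : ∀ x y, G.Adj x y → H.Reachable (f x) (f y)) {a b : α} (hab : G.Reachable a b) :
    H.Reachable (f a) (f b) := by
  obtain ⟨p⟩ := hab
  induction p with
  | nil => exact .refl _
  | cons hxy _ ih => exact (h _ _ hxy).trans ih

lemma isAcyclic_sum {α β : Type} {G : SimpleGraph α} {H : SimpleGraph β} (hG : G.IsAcyclic)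
    (hH : H.IsAcyclic) : (G ⊕g H).IsAcyclic := by
  rw [SimpleGraph.isAcyclic_iff_forall_adj_isBridge] at *
  rintro (u | u) (v | v) huv
  · have h := hG (by simpa using huv : G.Adj u v)
    rw [SimpleGraph.isBridge_iff] at *
    refine fun hr => h (reachable_of_adj (Sum.elim id fun _ => u) ?_ hr)
    rintro (x | x) (y | y) hxy
    · refine SimpleGraph.Adj.reachable ?_
      simpa [SimpleGraph.deleteEdges_adj] using hxy
    · simp [SimpleGraph.deleteEdges_adj] at hxy
    · simp [SimpleGraph.deleteEdges_adj] at hxy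
    · exact .refl _
  · simp at huv
  · simp at huv
  · have h := hH (by simpa using huv : H.Adj u v)
    rw [SimpleGraph.isBridge_iff] at *
    refine fun hr => h (reachable_of_adj (Sum.elim (fun _ => u) id) ?_ hr)
    rintro (x | x) (y | y) hxy
    · exact .refl _
    · simp [SimpleGraph.deleteEdges_adj] at hxy
    · simp [SimpleGraph.deleteEdges_adj] at hxy
    · refine SimpleGraph.Adj.reachable ?_
      simpa [SimpleGraph.deleteEdges_adj] using hxy

/-- Every point lies in the bags of a connected (possibly empty) set of nodes. -/
def Tame {α : Type} (D : Decomp α) : Prop :=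
  ∀ x, (D.tree.induce {i | x ∈ D.bag i}).Preconnected

/-- The decomposition with a single bag. -/
def single {α : Type} (B : Set α) : Decomp α where
  ι := Unit
  tree := ⊥
  isTree := .of_subsingleton
  bag _ := B

lemma tame_single {α : Type} (B : Set α) : Tame (single B) := by
  rintro x ⟨⟨⟩, hi⟩ ⟨⟨⟩, hj⟩
  exact .refl _

/-- Joining two decompositions by an edge between the nodes `r` and `s`. -/
def glue {α : Type} (D D' : Decomp α) (r : D.ι) (s : D'.ι) : Decomp α where
  ι := D.ι ⊕ D'.ι
  tree := (D.tree ⊕g D'.tree) ⊔ SimpleGraph.edge (Sum.inl r) (Sum.inr s)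
  isTree := ⟨D.isTree.connected.sum_sup_edge D'.isTree.connected,
    (isAcyclic_sum D.isTree.isAcyclic D'.isTree.isAcyclic).sup_edge_of_not_reachable
      (SimpleGraph.not_reachable_sum_inl_inr _ _)⟩
  bag := Sum.elim D.bag D'.bag

lemma tame_glue {α : Type} {D D' : Decomp α} (hD : Tame D) (hD' : Tame D') {r : D.ι} {s : D'.ι}
    (h : ∀ x i j, x ∈ D.bag i → x ∈ D'.bag j → x ∈ D.bag r ∧ x ∈ D'.bag s) :
    Tame (glue D D' r s) := by
  intro x
  have h1 : ∀ i j (hi : x ∈ D.bag i) (hj : x ∈ D.bag j),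
      ((glue D D' r s).tree.induce {i | x ∈ (glue D D' r s).bag i}).Reachable
        ⟨Sum.inl i, hi⟩ ⟨Sum.inl j, hj⟩ := by
    intro i j hi hj
    refine reachable_of_adj (G := D.tree.induce {i | x ∈ D.bag i})
      (H := (glue D D' r s).tree.induce {i | x ∈ (glue D D' r s).bag i})
      (fun a => ⟨Sum.inl a.1, a.2⟩) (fun a b hab => SimpleGraph.Adj.reachable ?_)
      (hD x ⟨i, hi⟩ ⟨j, hj⟩)
    exact Or.inl hab
  have h2 : ∀ i j (hi : x ∈ D'.bag i) (hj : x ∈ D'.bag j),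
      ((glue D D' r s).tree.induce {i | x ∈ (glue D D' r s).bag i}).Reachable
        ⟨Sum.inr i, hi⟩ ⟨Sum.inr j, hj⟩ := by
    intro i j hi hj
    refine reachable_of_adj (G := D'.tree.induce {i | x ∈ D'.bag i})
      (H := (glue D D' r s).tree.induce {i | x ∈ (glue D D' r s).bag i})
      (fun a => ⟨Sum.inr a.1, a.2⟩) (fun a b hab => SimpleGraph.Adj.reachable ?_)
      (hD' x ⟨i, hi⟩ ⟨j, hj⟩)
    exact Or.inl hab
  have h3 : ∀ i j (hi : x ∈ D.bag i) (hj : x ∈ D'.bag j),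
      ((glue D D' r s).tree.induce {i | x ∈ (glue D D' r s).bag i}).Reachable
        ⟨Sum.inl i, hi⟩ ⟨Sum.inr j, hj⟩ := by
    intro i j hi hj
    obtain ⟨hr, hs⟩ := h x i j hi hj
    refine (h1 i r hi hr).trans (SimpleGraph.Reachable.trans (SimpleGraph.Adj.reachable ?_)
      (h2 s j hs hj))
    exact Or.inr ((SimpleGraph.edge_adj _ _ _ _).2 ⟨.inl ⟨rfl, rfl⟩, Sum.inl_ne_inr⟩)
  rintro ⟨i | i, hi⟩ ⟨j | j, hj⟩
  · exact h1 i j hi hj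
  · exact h3 i j hi hj
  · exact (h3 j i hj hi).symm
  · exact h2 i j hi hj

namespace PlaneMap

variable {V E Φ : Type} [Finite V] [Finite E] [Finite Φ] {M : PlaneMap V E Φ}

lemma Dec.exists_decomp [Nonempty E] {K : ℕ} (hK : 1 ≤ K) {C : Set E} (h : M.Dec K C) :
    ∃ D : Decomp Φ, Tame D ∧ (∀ i, D.bag i ⊆ M.faces C ∧ (D.bag i).ncard ≤ K + 1) ∧
      (∀ e ∈ C, ∃ i, {f | M.inc e f} ⊆ D.bag i) ∧ ∃ r, M.faces C ∩ M.faces Cᶜ ⊆ D.bag r := by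
  induction h with
  | leaf e =>
    refine ⟨single {f | M.inc e f}, tame_single _, fun _ => ⟨fun f hf => ⟨e, rfl, hf⟩, ?_⟩, ?_,
      (), ?_⟩
    · exact (M.ncard_faces_singleton_le e).trans (by omega)
    · rintro _ rfl
      exact ⟨(), Subset.rfl⟩
    · rintro f ⟨⟨_, rfl, h⟩, -⟩
      exact h
  | node c h0 h1 hc hb ih0 ih1 =>
    obtain ⟨D0, t0, b0, e0, r0, hr0⟩ := ih0
    obtain ⟨D1, t1, b1, e1, r1, hr1⟩ := ih1
    have hdb : ∀ i e f, f ∈ M.dborder c → c e = i → f ∈ M.faces {e | c e = i}ᶜ := by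
      rintro i e f ⟨a, b, ha, hb, hab⟩ -
      by_cases hai : c a = i
      · exact ⟨b, fun hbi => hab (hai.trans hbi.symm), hb⟩
      · exact ⟨a, hai, ha⟩
    set B := M.dborder c ∩ M.faces {e | c e ≠ 2}
    have h0B : ∀ f ∈ M.faces {e | c e = 0}, f ∈ M.faces {e | c e ≠ 2} := by
      rintro f ⟨e, he, hf⟩
      exact ⟨e, by simp [show c e = _ from he], hf⟩
    have h1B : ∀ f ∈ M.faces {e | c e = 1}, f ∈ M.faces {e | c e ≠ 2} := by
      rintro f ⟨e, he, hf⟩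
      exact ⟨e, by simp [show c e = _ from he], hf⟩
    have hB0 : ∀ f ∈ B, f ∈ M.faces {e | c e = 0} → f ∈ D0.bag r0 := by
      rintro f hf ⟨e, he, hef⟩
      exact hr0 ⟨⟨e, he, hef⟩, hdb 0 e f hf.1 he⟩
    have hB1 : ∀ f ∈ B, f ∈ M.faces {e | c e = 1} → f ∈ D1.bag r1 := by
      rintro f hf ⟨e, he, hef⟩
      exact hr1 ⟨⟨e, he, hef⟩, hdb 1 e f hf.1 he⟩
    have h01 : ∀ f ∈ M.faces {e | c e = 0}, f ∈ M.faces {e | c e = 1} → f ∈ B := by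
      rintro f ⟨e, he, hef⟩ ⟨e', he', hef'⟩
      refine ⟨⟨e, e', hef, hef', ?_⟩, h0B f ⟨e, he, hef⟩⟩
      rw [show c e = 0 from he, show c e' = 1 from he']
      decide
    have tA : Tame (glue (single B) D0 () r0) := tame_glue (tame_single _) t0
      fun x i j hi hj => ⟨hi, hB0 x hi ((b0 j).1 hj)⟩
    refine ⟨glue (glue (single B) D0 () r0) D1 (Sum.inl ()) r1, tame_glue tA t1 ?_, ?_, ?_,
      Sum.inl (Sum.inl ()), ?_⟩
    · rintro x (i | i) j hi hj
      · exact ⟨hi, hB1 x hi ((b1 j).1 hj)⟩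
      · have := h01 x ((b0 i).1 hi) ((b1 j).1 hj)
        exact ⟨this, hB1 x this ((b1 j).1 hj)⟩
    · rintro ((i | i) | i)
      · exact ⟨inter_subset_right, (ncard_le_ncard inter_subset_left (toFinite _)).trans
          (M.ncard_dborder_le hc hK hb)⟩
      · exact ⟨fun f hf => h0B f ((b0 i).1 hf), (b0 i).2⟩
      · exact ⟨fun f hf => h1B f ((b1 i).1 hf), (b1 i).2⟩
    · intro e he
      have : c e = 0 ∨ c e = 1 := by
        have h2 : c e ≠ 2 := he
        revert h2
        generalize c e = k
        fin_cases k <;> simp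
      rcases this with h | h
      · obtain ⟨i, hi⟩ := e0 e h
        exact ⟨Sum.inl (Sum.inr i), hi⟩
      · obtain ⟨i, hi⟩ := e1 e h
        exact ⟨Sum.inr i, hi⟩
    · rintro f ⟨⟨e, he, hef⟩, ⟨e', he', hef'⟩⟩
      refine ⟨⟨e, e', hef, hef', fun h => ?_⟩, ⟨e, he, hef⟩⟩
      simp only [mem_compl_iff, mem_ofPred_eq, not_not] at he he'
      exact he (h.trans he')

/-- The faces have a tree decomposition, with bags of size `K + 1`, such that faces sharing an edge
share a bag. -/
lemma exists_face_decomp [Nonempty E] {ι : Type} {T : SimpleGraph ι} {X : ι → Set V} {φ : E → ι}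
    {K : ℕ} (h1 : 1 ≤ K) (hT : T.IsTree) (hX : ∀ v, (T.induce {i | v ∈ X i}).Connected)
    (hφ : ∀ v, ∀ e ∈ M.star v, v ∈ X (φ e)) (hK : ∀ t, (X t).ncard ≤ K) :
    ∃ D : Decomp Φ, Tame D ∧ (∀ i, (D.bag i).ncard ≤ K + 1) ∧
      ∀ e, ∃ i, {f | M.inc e f} ⊆ D.bag i := by
  obtain ⟨e₀⟩ := id ‹Nonempty E›
  obtain ⟨D, tD, bD, eD, r, hr⟩ := (Dec.leaf (M := M) (K := K) e₀).exists_decomp h1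
  rcases ({e₀}ᶜ : Set E).eq_empty_or_nonempty with h | h
  · refine ⟨D, tD, fun i => (bD i).2, fun e => eD e ?_⟩
    by_contra he
    exact h.subset he
  · obtain ⟨D', tD', bD', eD', r', hr'⟩ :=
      (M.dec_compl_singleton hT hX hφ hK e₀ h).exists_decomp h1
    rw [compl_compl] at hr'
    refine ⟨glue D D' r r', tame_glue tD tD' fun x i j hi hj => ?_, ?_, fun e => ?_⟩
    · have h1 := (bD i).1 hi
      have h2 := (bD' j).1 hj
      exact ⟨hr ⟨h1, h2⟩, hr' ⟨h2, h1⟩⟩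
    · rintro (i | i)
      · exact (bD i).2
      · exact (bD' i).2
    · by_cases he : e = e₀
      · obtain ⟨i, hi⟩ := eD e he
        exact ⟨Sum.inl i, hi⟩
      · obtain ⟨i, hi⟩ := eD' e he
        exact ⟨Sum.inr i, hi⟩

end PlaneMap

namespace PlaneMap

variable {V E Φ : Type} [Finite V] [Finite E] [Finite Φ] {M : PlaneMap V E Φ} {O : Φ}

/-- Replacing faces other than `O` by the vertices on their boundary. -/
def vertexDecomp (M : PlaneMap V E Φ) (O : Φ) (D : Decomp Φ) : Decomp V where
  ι := D.ι
  tree := D.tree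
  isTree := D.isTree
  bag i := {v | ∃ f ∈ D.bag i, f ≠ O ∧ M.vinc v f}

lemma WeakConn.tame_vertexDecomp (h : M.WeakConn O) {D : Decomp Φ} (hD : Tame D)
    (hDe : ∀ e, ∃ i, {f | M.inc e f} ⊆ D.bag i) : Tame (M.vertexDecomp O D) := by
  rintro v ⟨i, hi⟩ ⟨j, hj⟩
  set H := (M.vertexDecomp O D).tree.induce {i | v ∈ (M.vertexDecomp O D).bag i} with hH
  have hface : ∀ f (hfO : f ≠ O) (hfv : M.vinc v f) a b (ha : f ∈ D.bag a) (hb : f ∈ D.bag b),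
      H.Reachable ⟨a, f, ha, hfO, hfv⟩ ⟨b, f, hb, hfO, hfv⟩ := by
    intro f hfO hfv a b ha hb
    refine reachable_of_adj (G := D.tree.induce {i | f ∈ D.bag i}) (H := H)
      (fun a => ⟨a.1, f, a.2, hfO, hfv⟩) (fun a b hab => SimpleGraph.Adj.reachable ?_)
      (hD f ⟨a, ha⟩ ⟨b, hb⟩)
    exact hab
  set S : Set Φ := {f | (M.vinc v f ∧ f ≠ O) ∧
    ∃ k, ∃ hk : v ∈ (M.vertexDecomp O D).bag k, f ∈ D.bag k ∧ H.Reachable ⟨i, hi⟩ ⟨k, hk⟩} with hS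
  set T : Set Φ := {f | (M.vinc v f ∧ f ≠ O) ∧ f ∉ S} with hT
  obtain ⟨g, hgj, hgO, hgv⟩ := id hj
  have hgS : g ∈ S := by
    by_contra hgS
    obtain ⟨f, hfi, hfO, hfv⟩ := id hi
    obtain ⟨e, p, ⟨⟨hpv, hpO⟩, k, hk, hpk, hik⟩, q, ⟨⟨hqv, hqO⟩, hqS⟩, hep, heq⟩ :=
      h.conn_vinc (u := v) (S := S) (T := T) ⟨f, ⟨hfv, hfO⟩, i, hi, hfi, .refl _⟩
        ⟨g, ⟨hgv, hgO⟩, hgS⟩ (disjoint_left.2 fun f h h' => h'.2 h)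
        (fun f hfv hfO => (em (f ∈ S)).imp id fun h => ⟨⟨hfv, hfO⟩, h⟩) (fun f h => h.1)
        (fun f h => h.1)
    obtain ⟨m, hm⟩ := hDe e
    exact hqS ⟨⟨hqv, hqO⟩, m, ⟨p, hm hep, hpO, hpv⟩, hm heq,
      hik.trans (hface p hpO hpv k m hpk (hm hep))⟩
  obtain ⟨-, k, hk, hgk, hik⟩ := hgS
  exact hik.trans (hface g hgO hgv k j hgk hgj)

lemma ncard_vertexDecomp_le {D : Decomp Φ} {l m : ℕ}
    (hl : ∀ f ≠ O, {v | M.vinc v f}.ncard ≤ l) {i : D.ι} (hm : (D.bag i).ncard ≤ m) :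
    ((M.vertexDecomp O D).bag i).ncard ≤ m * l := by
  classical
  have := Fintype.ofFinite V
  have hfin := toFinite (D.bag i)
  rw [ncard_eq_toFinset_card _ hfin] at hm
  have : (M.vertexDecomp O D).bag i =
      ((hfin.toFinset.biUnion fun f => if f = O then ∅ else {v | M.vinc v f}.toFinset : Finset V) :
        Set V) := by
    ext v
    simp only [vertexDecomp, mem_ofPred_eq, Finset.coe_biUnion, Finite.coe_toFinset, mem_iUnion,
      exists_prop, Finset.mem_coe]
    refine exists_congr fun f => and_congr_right fun _ => ?_
    by_cases hf : f = O <;> simp [hf]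
  rw [this, ncard_coe_finset]
  refine (Finset.card_biUnion_le_card_mul _ _ l fun f _ => ?_).trans (Nat.mul_le_mul_right l hm)
  by_cases hf : f = O
  · simp [hf]
  · rw [if_neg hf, ← ncard_eq_toFinset_card']
    exact hl f hf

lemma WeakConn.exists_ne_of_inner (h : M.WeakConn O) {e : E} (h1 : M.fst e ∈ M.inner O)
    (h2 : M.snd e ∈ M.inner O) : ∃ f ≠ O, M.inc e f := by
  by_contra! he
  have heO : ∀ f, M.inc e f → f = O := fun f hf => by
    by_contra h
    exact he f h hf
  obtain ⟨f, hf⟩ := M.exists_inc e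
  have hO : M.inc e O := by rwa [heO f hf] at hf
  obtain ⟨φ, hφ, hne⟩ := M.exists_Z_compl_singleton heO
  exact h.exists_side heO hφ ⟨rfl, rfl⟩ hne h1 h2 ⟨e, .inl rfl, hO⟩ ⟨e, .inr rfl, hO⟩ hne rfl

/-- `D` covers the plane graph spanned by `S` and the boundaries of the faces other than `O`. -/
structure Covers (M : PlaneMap V E Φ) (O : Φ) (N : ℕ) (S : Set V) (D : Decomp V) : Prop where
  tame : Tame D
  subset : ∀ i, D.bag i ⊆ S
  ncard_le : ∀ i, (D.bag i).ncard ≤ N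
  vertex : ∀ v ∈ S, ∃ i, v ∈ D.bag i
  edge : ∀ e, M.fst e ∈ S → M.snd e ∈ S → ∃ i, M.fst e ∈ D.bag i ∧ M.snd e ∈ D.bag i
  face : ∀ f ≠ O, ∃ i, {v | M.vinc v f} ⊆ D.bag i

lemma WeakConn.covers_inner [Nonempty E] (h : M.WeakConn O) {D : Decomp Φ} (hD : Tame D)
    (hDe : ∀ e, ∃ i, {f | M.inc e f} ⊆ D.bag i) {l m : ℕ}
    (hl : ∀ f ≠ O, {v | M.vinc v f}.ncard ≤ l) (hm : ∀ i, (D.bag i).ncard ≤ m) :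
    M.Covers O (m * l) (M.inner O) (M.vertexDecomp O D) := by
  have hface : ∀ f ≠ O, ∃ i, {v | M.vinc v f} ⊆ (M.vertexDecomp O D).bag i := by
    intro f hf
    obtain ⟨e, he⟩ := M.exists_edge ‹_› f
    obtain ⟨i, hi⟩ := hDe e
    exact ⟨i, fun v hv => ⟨f, hi he, hf, hv⟩⟩
  refine ⟨h.tame_vertexDecomp hD hDe, ?_, fun i => ncard_vertexDecomp_le hl (hm i), ?_, ?_, hface⟩
  · rintro i v ⟨f, -, hf, hv⟩
    exact ⟨f, hf, hv⟩
  · rintro v ⟨f, hf, hv⟩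
    exact (hface f hf).imp fun i hi => hi hv
  · intro e h1 h2
    obtain ⟨f, hf, hef⟩ := h.exists_ne_of_inner h1 h2
    exact (hface f hf).imp fun i hi =>
      ⟨hi (M.vinc_of_inc (.inl rfl) hef), hi (M.vinc_of_inc (.inr rfl) hef)⟩

/-- Attaching a vertex with at most one neighbour. -/
lemma Covers.insert_leaf {N : ℕ} {S : Set V} {v : V} {D : Decomp V} (hN : 2 ≤ N) (hvS : v ∈ S)
    (hv : v ∉ M.inner O) (hD : M.Covers O N (S \ {v}) D)
    (hleaf : ∀ e ∈ M.star v, ∀ e' ∈ M.star v, M.fst e ∈ S → M.snd e ∈ S →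
      M.fst e' ∈ S → M.snd e' ∈ S → e = e') : ∃ D, M.Covers O N S D := by
  have key : ∃ P : Set V, P ⊆ S \ {v} ∧ P.ncard ≤ 1 ∧ (∃ r, P ⊆ D.bag r) ∧
      ∀ e ∈ M.star v, M.fst e ∈ S → M.snd e ∈ S →
        M.fst e ∈ insert v P ∧ M.snd e ∈ insert v P := by
    by_cases he : ∃ e ∈ M.star v, M.fst e ∈ S ∧ M.snd e ∈ S
    · obtain ⟨e, hev, h1, h2⟩ := he
      have : ∃ p ∈ S, p ≠ v ∧ M.fst e ∈ ({v, p} : Set V) ∧ M.snd e ∈ ({v, p} : Set V) := by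
        have := M.fst_ne_snd e
        rcases hev with rfl | rfl
        · exact ⟨_, h2, this.symm, by simp, by simp⟩
        · exact ⟨_, h1, this, by simp, by simp⟩
      obtain ⟨p, hpS, hpv, h3, h4⟩ := this
      obtain ⟨r, hr⟩ := hD.vertex p ⟨hpS, hpv⟩
      refine ⟨{p}, by simp [hpS, hpv], by simp, ⟨r, by simpa using hr⟩, fun e' he' h1' h2' => ?_⟩
      rw [← hleaf e hev e' he' h1 h2 h1' h2']
      exact ⟨h3, h4⟩
    · exact ⟨∅, empty_subset _, by simp, ⟨D.isTree.connected.nonempty.some, empty_subset _⟩,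
        fun e he1 h1 h2 => (he ⟨e, he1, h1, h2⟩).elim⟩
  obtain ⟨P, hPS, hP1, ⟨r, hr⟩, hPe⟩ := key
  refine ⟨glue D (single (insert v P)) r (), ?_, ?_, ?_, ?_, ?_, ?_⟩
  · refine tame_glue hD.tame (tame_single _) fun x i j hi hj => ?_
    rcases hj with rfl | hj
    · exact ((hD.subset i hi).2 rfl).elim
    · exact ⟨hr hj, .inr hj⟩
  · rintro (i | i)
    · exact (hD.subset i).trans sdiff_subset
    · exact insert_subset hvS (hPS.trans sdiff_subset)
  · rintro (i | i)
    · exact hD.ncard_le i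
    · exact (ncard_insert_le v P).trans (by omega)
  · intro u hu
    by_cases huv : u = v
    · exact ⟨Sum.inr (), .inl huv⟩
    · obtain ⟨i, hi⟩ := hD.vertex u ⟨hu, huv⟩
      exact ⟨Sum.inl i, hi⟩
  · intro e h1 h2
    by_cases he : e ∈ M.star v
    · exact ⟨Sum.inr (), hPe e he h1 h2⟩
    · obtain ⟨h3, h4⟩ := not_or.1 he
      obtain ⟨i, hi⟩ := hD.edge e ⟨h1, h3⟩ ⟨h2, h4⟩
      exact ⟨Sum.inl i, hi⟩
  · intro f hf
    obtain ⟨i, hi⟩ := hD.face f hf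
    exact ⟨Sum.inl i, hi⟩

lemma WeakConn.exists_covers (h : M.WeakConn O) {N : ℕ} (hN : 2 ≤ N) {D : Decomp V}
    (hD : M.Covers O N (M.inner O) D) : ∃ D, M.Covers O N univ D := by
  suffices ∀ n, ∀ S : Set V, S.ncard = n → M.inner O ⊆ S → ∃ D, M.Covers O N S D from
    this _ univ rfl (subset_univ _)
  intro n
  induction n with
  | zero =>
    intro S hS hsub
    rw [ncard_eq_zero] at hS
    subst hS
    rw [subset_empty_iff] at hsub
    exact ⟨D, hsub ▸ hD⟩
  | succ n ih =>
    intro S hS hsub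
    rcases hsub.eq_or_ssubset with rfl | hss
    · exact ⟨D, hD⟩
    obtain ⟨v, hvS, hv, hleaf⟩ := h.exists_leaf hss
    obtain ⟨D', hD'⟩ := ih (S \ {v}) (by rw [ncard_sdiff_singleton_of_mem hvS]; omega)
      (subset_sdiff_singleton hsub hv)
    exact hD'.insert_leaf hN hvS hv hleaf

/-- A tree decomposition of the vertices yields one with bags covering the faces other than `O`. -/
theorem WeakConn.exists_covers_univ [Nonempty E] (h : M.WeakConn O) {ι : Type} {T : SimpleGraph ι}
    {X : ι → Set V} {φ : E → ι} {K l : ℕ} (h1 : 1 ≤ K) (hT : T.IsTree)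
    (hX : ∀ v, (T.induce {i | v ∈ X i}).Connected) (hφ : ∀ v, ∀ e ∈ M.star v, v ∈ X (φ e))
    (hK : ∀ t, (X t).ncard ≤ K) (hl1 : 1 ≤ l) (hl : ∀ f ≠ O, {v | M.vinc v f}.ncard ≤ l) :
    ∃ D, M.Covers O ((K + 1) * l) univ D := by
  obtain ⟨D, hD, hm, hDe⟩ := M.exists_face_decomp h1 hT hX hφ hK
  exact h.exists_covers (by nlinarith) (h.covers_inner hD hDe hl hm)

end PlaneMap

lemma exists_unbounded_comp {K : Set ℂ} (hK : IsCompact K) :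
    ∃ U ∈ comps K, ¬ IsBounded U := by
  obtain ⟨R, hR⟩ := hK.isBounded.subset_ball (0 : ℂ)
  have hray : ∀ x : ℝ, x ∈ Ici |R| → (x : ℂ) ∉ K := by
    intro x hx hxK
    have := hR hxK
    rw [mem_ball_zero_iff, Complex.norm_real] at this
    exact absurd (this.trans_le ((le_abs_self R).trans (mem_Ici.1 hx)))
      (not_lt.2 (le_abs_self x))
  refine ⟨_, ⟨(|R| : ℝ), hray _ self_mem_Ici, rfl⟩, fun hb => ?_⟩
  have hsub : (fun x : ℝ => (x : ℂ)) '' Ici |R| ⊆ connectedComponentIn Kᶜ ((|R| : ℝ) : ℂ) :=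
    IsPreconnected.subset_connectedComponentIn
      (isPreconnected_Ici.image _ Complex.continuous_ofReal.continuousOn)
      (mem_image_of_mem _ self_mem_Ici) (by rintro _ ⟨x, hx, rfl⟩; exact hray x hx)
  obtain ⟨r, hr⟩ := hb.exists_norm_le
  have hmem : |R| + |r| + 1 ∈ Ici |R| := mem_Ici.2 (by linarith [abs_nonneg r])
  have := hr _ (hsub (mem_image_of_mem _ hmem))
  rw [Complex.norm_real, Real.norm_of_nonneg (by positivity)] at this
  linarith [le_abs_self r, abs_nonneg R]

/-- The plane as the complex numbers. -/
noncomputable def toC : (ℝ × ℝ) ≃L[ℝ] ℂ := Complex.equivRealProdCLM.symm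

lemma toC_image_compl (s : Set (ℝ × ℝ)) : toC '' sᶜ = (toC '' s)ᶜ :=
  image_compl_eq toC.bijective

lemma toC_image_comp (s : Set (ℝ × ℝ)) {x : ℝ × ℝ} (hx : x ∉ s) :
    toC '' connectedComponentIn sᶜ x = connectedComponentIn (toC '' s)ᶜ (toC x) := by
  rw [← toC_image_compl]
  exact toC.toHomeomorph.image_connectedComponentIn hx

lemma toC_image_closure (s : Set (ℝ × ℝ)) : toC '' closure s = closure (toC '' s) :=
  toC.toHomeomorph.image_closure s

lemma isBounded_toC_image {s : Set (ℝ × ℝ)} : IsBounded (toC '' s) ↔ IsBounded s := by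
  refine ⟨fun h => ?_, fun h => toC.lipschitz.isBounded_image h⟩
  have := toC.symm.lipschitz.isBounded_image h
  rwa [← image_comp, show (toC.symm ∘ toC : ℝ × ℝ → ℝ × ℝ) = id from
    funext toC.symm_apply_apply, image_id] at this

lemma mem_toC_image {s : Set (ℝ × ℝ)} {x : ℝ × ℝ} : toC x ∈ toC '' s ↔ x ∈ s :=
  toC.injective.mem_set_image

variable {V : Type} {G : SimpleGraph V}

lemma exists_ends (P : PlaneEmbedding G) (e : G.edgeSet) : ∃ uv : V × V,
    (e : Sym2 V) = s(uv.1, uv.2) ∧ IsArc (toC (P.pos uv.1)) (toC (P.pos uv.2)) (toC '' P.arc e) := by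
  obtain ⟨u, v, he, γ, hγ, hr⟩ := P.arc_path e
  refine ⟨(u, v), he, fun t => toC (γ.extend t), toC.continuous.comp γ.continuous_extend,
    fun s hs t ht hst => ?_, by simp, by simp, ?_⟩
  · have := toC.injective hst
    rw [γ.extend_apply hs, γ.extend_apply ht] at this
    exact congrArg Subtype.val (hγ this)
  · rw [← hr, ← image_image (fun x => toC x) (fun t : ℝ => γ.extend t)]
    congr 1
    ext x
    constructor
    · rintro ⟨t, ht, rfl⟩
      exact ⟨⟨t, ht⟩, (γ.extend_apply ht).symm⟩
    · rintro ⟨t, rfl⟩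
      exact ⟨t, t.2, γ.extend_apply t.2⟩

/-- The drawing in the complex plane given by a plane embedding. -/
noncomputable def drawing (P : PlaneEmbedding G) : Drawing V G.edgeSet where
  pos v := toC (P.pos v)
  pos_inj := toC.injective.comp P.pos_inj
  fst e := (exists_ends P e).choose.1
  snd e := (exists_ends P e).choose.2
  arc e := toC '' P.arc e
  isArc e := (exists_ends P e).choose_spec.2
  avoid e w hw := by
    have := P.arc_avoid e w (mem_toC_image.1 hw)
    rwa [(exists_ends P e).choose_spec.1, Sym2.mem_iff] at this
  inter e f hef x hx := by
    rw [← image_inter toC.injective] at hx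
    obtain ⟨y, hy, rfl⟩ := hx
    obtain ⟨w, -, -, rfl⟩ := P.arc_inter e f hef y hy
    exact ⟨w, rfl⟩

lemma edge_eq (P : PlaneEmbedding G) (e : G.edgeSet) :
    (e : Sym2 V) = s((drawing P).fst e, (drawing P).snd e) := (exists_ends P e).choose_spec.1

lemma skel_drawing (P : PlaneEmbedding G) : (drawing P).skel univ = toC '' P.image := by
  simp only [Drawing.skel, drawing, PlaneEmbedding.image, image_union, image_iUnion, ← range_comp,
    mem_univ, iUnion_true]
  rfl

lemma image_mem_comps {P : PlaneEmbedding G} {f : Set (ℝ × ℝ)} (hf : P.IsFace f) :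
    toC '' f ∈ comps ((drawing P).skel univ) := by
  obtain ⟨x, hx, rfl⟩ := hf
  rw [skel_drawing, toC_image_comp _ hx]
  exact ⟨toC x, fun h => hx (mem_toC_image.1 h), rfl⟩

lemma exists_face_of_mem_comps {P : PlaneEmbedding G} {U : Set ℂ}
    (hU : U ∈ comps ((drawing P).skel univ)) : ∃ f, P.IsFace f ∧ toC '' f = U := by
  obtain ⟨p, hp, rfl⟩ := hU
  obtain ⟨x, rfl⟩ := toC.surjective p
  rw [skel_drawing, mem_toC_image] at hp
  exact ⟨_, ⟨x, hp, rfl⟩, by rw [toC_image_comp _ hp, skel_drawing]⟩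

/-- A bounded face, as a face of the drawing. -/
def toFace (P : PlaneEmbedding G) (f : {f // P.IsBoundedFace f}) : (drawing P).Face :=
  ⟨toC '' f.1, image_mem_comps f.2.1⟩

lemma inc_toFace {P : PlaneEmbedding G} {e : G.edgeSet} {f : {f // P.IsBoundedFace f}} :
    (drawing P).Inc e (toFace P f) ↔ P.arc e ⊆ closure f.1 := by
  rw [Drawing.Inc, toFace, ← toC_image_closure]
  exact image_subset_image_iff toC.injective

lemma vInc_toFace {P : PlaneEmbedding G} {f : {f // P.IsBoundedFace f}} :
    {v | (drawing P).VInc v (toFace P f)} = P.boundaryVerts f.1 := by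
  ext v
  rw [mem_ofPred_eq, Drawing.VInc, toFace, ← toC_image_closure]
  exact mem_toC_image

lemma exists_outer [Fintype V] [Fintype G.edgeSet] (P : PlaneEmbedding G) : ∃ O : (drawing P).Face,
    ∀ f, f ≠ O ↔ ∃ g, toFace P g = f := by
  have hK := (drawing P).isCompact_skel univ
  obtain ⟨U, hU, hUb⟩ := exists_unbounded_comp hK
  refine ⟨⟨U, hU⟩, fun f => ⟨fun hf => ?_, ?_⟩⟩
  · obtain ⟨g, hg, hgf⟩ := exists_face_of_mem_comps f.2
    refine ⟨⟨g, hg, isBounded_toC_image.1 ?_⟩, Subtype.ext hgf⟩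
    by_contra hb
    refine hf (Subtype.ext ?_)
    rw [hgf] at hb
    obtain ⟨p, hp, hfp⟩ := f.2
    obtain ⟨q, hq, rfl⟩ := hU
    rw [hfp] at hb ⊢
    exact (comp_eq_iff hq).2 (sameComp_of_unbounded hK hb hUb)
  · rintro ⟨g, rfl⟩ h
    refine hUb ?_
    have hg : toC '' g.1 = U := congrArg Subtype.val h
    exact hg ▸ isBounded_toC_image.2 g.2.2

lemma weakConn_of_connected [Fintype V] [Fintype G.edgeSet] {P : PlaneEmbedding G}
    (h : P.weakDual.Connected) {O : (drawing P).Face} (hO : ∀ f, f ≠ O ↔ ∃ g, toFace P g = f) :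
    (drawing P).planeMap.WeakConn O := by
  rintro S ⟨a, ha⟩ hOS ⟨b, hb, hbO⟩
  obtain ⟨a', rfl⟩ := (hO a).1 fun h => hOS (h ▸ ha)
  obtain ⟨b', rfl⟩ := (hO b).1 hbO
  obtain ⟨p⟩ := h.preconnected a' b'
  obtain ⟨d, -, h1, h2⟩ := p.exists_boundary_dart (toFace P ⁻¹' S) ha hb
  have hd := (SimpleGraph.fromRel_adj _ _ _).1 d.adj
  have : ∃ e, P.arc e ⊆ closure d.fst.1 ∧ P.arc e ⊆ closure d.snd.1 :=
    hd.2.elim id fun ⟨e, h, h'⟩ => ⟨e, h', h⟩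
  obtain ⟨e, h3, h4⟩ := this
  exact ⟨e, _, _, inc_toFace.2 h3, inc_toFace.2 h4, h1, h2, (hO _).2 ⟨_, rfl⟩⟩

lemma exists_treewidth_decomp [Finite V] (G : SimpleGraph V) :
    ∃ D : Decomp V, IsTreeDecomp G D ∧ ∀ i, (D.bag i).ncard ≤ treewidth G + 1 := by
  refine Nat.sInf_mem (s := {k | ∃ D : Decomp V, IsTreeDecomp G D ∧ ∀ i, (D.bag i).ncard ≤ k + 1})
    ⟨Nat.card V, single univ, ⟨fun v => ⟨(), mem_univ v⟩, fun u v _ =>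
      ⟨(), mem_univ u, mem_univ v⟩, fun v => ?_⟩, fun i => ?_⟩
  · exact SimpleGraph.Connected.mk (tame_single _ v) (nonempty := ⟨⟨(), mem_univ v⟩⟩)
  · exact (ncard_le_card _).trans (Nat.le_succ _)

lemma PlaneMap.nonempty_edge {E Φ : Type} [Finite V] [Finite E] [Finite Φ] (M : PlaneMap V E Φ)
    {f g : Φ} (hfg : f ≠ g) : Nonempty E := by
  have := Fintype.ofFinite V
  by_contra h
  rw [not_nonempty_iff] at h
  have h1 := M.euler_univ
  have h2 := (M.Z univ).finrank_le
  rw [Module.finrank_fintype_fun_eq_card, ← Nat.card_eq_fintype_card] at h2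
  have h3 := Finite.one_lt_card_iff_nontrivial.2 ⟨f, g, hfg⟩
  rw [Nat.card_of_isEmpty (α := E)] at h1
  omega

lemma PlaneMap.Covers.isEmDecomp [Fintype V] [Fintype G.edgeSet] {P : PlaneEmbedding G}
    {O : (drawing P).Face} (hO : ∀ f, f ≠ O ↔ ∃ g, toFace P g = f) {N : ℕ} {D : Decomp V}
    (h : (drawing P).planeMap.Covers O N univ D) : IsEmDecomp P D := by
  refine ⟨⟨fun v => h.vertex v (mem_univ v), fun u v huv => ?_, fun v => ?_⟩, fun f hf => ?_⟩
  · obtain ⟨i, h1, h2⟩ := h.edge ⟨s(u, v), huv⟩ (mem_univ _) (mem_univ _)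
    have := edge_eq P ⟨s(u, v), huv⟩
    refine ⟨i, ?_⟩
    rcases Sym2.eq_iff.1 this with ⟨hu, hv⟩ | ⟨hu, hv⟩
    · exact ⟨hu.symm ▸ h1, hv.symm ▸ h2⟩
    · exact ⟨hu.symm ▸ h2, hv.symm ▸ h1⟩
  · obtain ⟨i, hi⟩ := h.vertex v (mem_univ v)
    exact SimpleGraph.Connected.mk (h.tame v) (nonempty := ⟨⟨i, hi⟩⟩)
  · obtain ⟨i, hi⟩ := h.face _ ((hO _).2 ⟨⟨f, hf⟩, rfl⟩)
    exact ⟨i, vInc_toFace.symm.subset.trans hi⟩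

theorem emwidth_add_one_le [Fintype V] (P : PlaneEmbedding G) (l : ℕ)
    (hl : ∀ f, P.IsBoundedFace f → (P.boundaryVerts f).ncard ≤ l)
    (hconn : P.weakDual.Connected) : emwidth P + 1 ≤ (treewidth G + 2) * l := by
  have := Fintype.ofFinite G.edgeSet
  obtain ⟨O, hO⟩ := exists_outer P
  have hW := weakConn_of_connected hconn hO
  obtain ⟨f₀⟩ := hconn.nonempty
  have hf₀ := (hO _).2 ⟨f₀, rfl⟩
  have hE := (drawing P).planeMap.nonempty_edge hf₀
  have hl' : ∀ f ≠ O, {v | (drawing P).planeMap.vinc v f}.ncard ≤ l := by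
    intro f hf
    obtain ⟨g, rfl⟩ := (hO f).1 hf
    exact (congrArg ncard vInc_toFace).trans_le (hl g.1 g.2)
  have hl1 : 1 ≤ l := by
    obtain ⟨e, he⟩ := (drawing P).planeMap.exists_edge hE (toFace P f₀)
    refine le_trans ?_ (hl' _ hf₀)
    exact (ncard_pos (toFinite _)).2 ⟨_, (drawing P).planeMap.vinc_of_inc (.inl rfl) he⟩
  obtain ⟨D, ⟨-, hDe, hDc⟩, hDw⟩ := exists_treewidth_decomp G
  have hφ : ∀ e : G.edgeSet, ∃ i, (drawing P).fst e ∈ D.bag i ∧ (drawing P).snd e ∈ D.bag i := by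
    intro e
    refine hDe _ _ ?_
    rw [← SimpleGraph.mem_edgeSet, ← edge_eq]
    exact e.2
  choose φ hφ using hφ
  obtain ⟨D', hD'⟩ := hW.exists_covers_univ (K := treewidth G + 1) (φ := φ) (by omega) D.isTree hDc
    (by
      rintro v e (rfl | rfl)
      · exact (hφ e).1
      · exact (hφ e).2) hDw hl1 hl'
  have hpos : 1 ≤ (treewidth G + 2) * l := Nat.mul_pos (by omega) hl1
  have h1 : emwidth P ≤ (treewidth G + 2) * l - 1 :=
    Nat.sInf_le ⟨D', hD'.isEmDecomp hO, fun i => by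
      rw [Nat.sub_add_cancel hpos]
      exact hD'.ncard_le i⟩
  omega

end PlaneTopology

/-- If every bounded face of a plane graph has length at most `l` and
its weak dual is connected, then `emw(G) ≤ (tw(G) + 2)·l − 1`. -/
theorem emwidth_le_of_connected_weakDual {V : Type} [Fintype V]
    {G : SimpleGraph V} (P : PlaneEmbedding G) (l : ℕ)
    (hl : ∀ f, P.IsBoundedFace f → (P.boundaryVerts f).ncard ≤ l)
    (hconn : P.weakDual.Connected) :
    (emwidth P : ℤ) ≤ (treewidth G + 2) * l - 1 := by
  have := PlaneTopology.emwidth_add_one_le P l hl hconn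
  zify at this
  linarith
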